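/- For every ε with 0 < ε < 1 and every ε' with 0 < ε' < ε/(2/3+ε), there exists t₀(ε,ε') such that for every integer t ≥ t₀(ε,ε'), there is at most one pair of integers (n,m) with 1 ≤ m < n, exp((log n)^{2/3+ε}) ≤ m ≤ n/exp((log n)^{1−ε'}), and C(n,m) = t. -/

import Mathlib

section

open Finset

/-! ### Vinogradov systems and mean values -/

/-- Power sums determine elementary symmetric polynomials when the integers
`1, …, k` are invertible. -/
lemma aeval_esymm_eq_of_psum_eq {R : Type*} [CommRing R] {k : ℕ}
    (hunit : ∀ j : ℕ, 1 ≤ j → j ≤ k → IsUnit (j : R)) {x y : Fin k → R}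
    (h : ∀ j, 1 ≤ j → j ≤ k → ∑ i, x i ^ j = ∑ i, y i ^ j) (j : ℕ) (hj : j ≤ k) :
    MvPolynomial.aeval x (MvPolynomial.esymm (Fin k) ℤ j) =
      MvPolynomial.aeval y (MvPolynomial.esymm (Fin k) ℤ j) := by
  induction j using Nat.strong_induction_on with
  | _ j ih =>
    rcases Nat.eq_zero_or_pos j with rfl | hpos
    · simp
    · have key : ∀ z : Fin k → R, (j : R) * MvPolynomial.aeval z (MvPolynomial.esymm (Fin k) ℤ j) =
          (-1) ^ (j + 1) * ∑ a ∈ antidiagonal j with a.1 < j,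
            (-1) ^ a.1 * MvPolynomial.aeval z (MvPolynomial.esymm (Fin k) ℤ a.1) *
              ∑ i, z i ^ a.2 := by
        intro z
        have := congrArg (MvPolynomial.aeval z) (MvPolynomial.mul_esymm_eq_sum (Fin k) ℤ j)
        simpa [MvPolynomial.psum, map_sum] using this
      refine (hunit j hpos hj).mul_left_cancel ?_
      rw [key x, key y]
      congr 1
      refine sum_congr rfl fun a ha => ?_
      simp only [mem_filter, HasAntidiagonal.mem_antidiagonal] at ha
      rw [ih a.1 ha.2 (by omega), h a.2 (by omega) (by omega)]

lemma prod_sub_eq_zero_of_psum_eq {R : Type*} [CommRing R] {k : ℕ}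
    (hunit : ∀ j : ℕ, 1 ≤ j → j ≤ k → IsUnit (j : R)) {x y : Fin k → R}
    (h : ∀ j, 1 ≤ j → j ≤ k → ∑ i, x i ^ j = ∑ i, y i ^ j) (i : Fin k) :
    ∏ l, (y i - x l) = 0 := by
  have hpoly : ((univ.val.map x).map fun t => Polynomial.X - Polynomial.C t).prod =
      ((univ.val.map y).map fun t => Polynomial.X - Polynomial.C t).prod := by
    rw [Multiset.prod_X_sub_X_eq_sum_esymm, Multiset.prod_X_sub_X_eq_sum_esymm]
    simp only [Multiset.card_map]
    refine sum_congr rfl fun j hj => ?_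
    have hj' : j ≤ k := by simpa [Nat.lt_succ_iff] using hj
    have := aeval_esymm_eq_of_psum_eq hunit h j hj'
    rw [MvPolynomial.aeval_esymm_eq_multiset_esymm, MvPolynomial.aeval_esymm_eq_multiset_esymm]
      at this
    rw [this]
  have hev := congrArg (Polynomial.eval (y i)) hpoly
  have hP : ∀ z : Fin k → R, Polynomial.eval (y i)
      ((univ.val.map z).map fun t => Polynomial.X - Polynomial.C t).prod = ∏ l, (y i - z l) := by
    intro z
    have : ((univ.val.map z).map fun t => Polynomial.X - Polynomial.C t).prod =
      ∏ l, (Polynomial.X - Polynomial.C (z l)) := by simp [Finset.prod, Function.comp_def]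
    rw [this, Polynomial.eval_prod]
    simp
  rw [hP, hP] at hev
  rw [hev]
  exact prod_eq_zero (mem_univ i) (sub_self _)

/-- If two integer `k`-tuples have the same power sums modulo `p ^ k` and the first has entries
distinct mod `p`, then every entry of the second is congruent to an entry of the first. -/
lemma exists_modEq_of_psum_modEq {p k : ℕ} (hp : p.Prime) (hkp : k < p) {x y : Fin k → ℤ}
    (hx : ∀ i j, x i ≡ x j [ZMOD p] → i = j)
    (h : ∀ j, 1 ≤ j → j ≤ k → ∑ i, x i ^ j ≡ ∑ i, y i ^ j [ZMOD (p : ℤ) ^ k]) (i : Fin k) :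
    ∃ l, y i ≡ x l [ZMOD (p : ℤ) ^ k] := by
  have hunit : ∀ j : ℕ, 1 ≤ j → j ≤ k → IsUnit (j : ZMod (p ^ k)) := by
    intro j h1 h2
    rw [ZMod.isUnit_iff_coprime]
    exact Nat.Coprime.pow_right _ (Nat.coprime_of_lt_prime (by omega) (by omega) hp).symm
  have hz := prod_sub_eq_zero_of_psum_eq hunit (x := fun l => (x l : ZMod (p ^ k)))
    (y := fun l => (y l : ZMod (p ^ k))) (fun j h1 h2 => by
      have := (ZMod.intCast_eq_intCast_iff _ _ (p ^ k)).2 (by simpa using h j h1 h2)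
      simpa using this) i
  have hdvd : (p : ℤ) ^ k ∣ ∏ l, (y i - x l) := by
    have : ((∏ l, (y i - x l) : ℤ) : ZMod (p ^ k)) = 0 := by simpa using hz
    simpa using (ZMod.intCast_zmod_eq_zero_iff_dvd _ (p ^ k)).1 (by simpa using this)
  have hpz : Prime (p : ℤ) := Nat.prime_iff_prime_int.1 hp
  have hk : 0 < k := i.pos
  obtain ⟨l, -, hl⟩ := (Prime.dvd_finsetProd_iff hpz _).1 ((dvd_pow_self _ hk.ne').trans hdvd)
  refine ⟨l, ?_⟩
  rw [← mul_prod_erase univ _ (mem_univ l)] at hdvd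
  have hcop : IsCoprime ((p : ℤ) ^ k) (∏ m ∈ univ.erase l, (y i - x m)) := by
    refine IsCoprime.pow_left ?_
    rw [hpz.irreducible.coprime_iff_not_dvd]
    intro hd
    obtain ⟨m, hm, hmd⟩ := (Prime.dvd_finsetProd_iff hpz _).1 hd
    have : x m ≡ x l [ZMOD p] := by
      rw [Int.modEq_iff_dvd]
      have := dvd_sub hmd hl
      simpa using this
    exact (mem_erase.1 hm).1 (hx _ _ this)
  have := hcop.dvd_of_dvd_mul_right hdvd
  exact (Int.modEq_iff_dvd.2 this).symm

/-- The number of pairs in `S` with equal images under `Φ`. -/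
def energy {X V : Type*} [DecidableEq V] (S : Finset X) (Φ : X → V) : ℕ :=
  #{z ∈ S ×ˢ S | Φ z.1 = Φ z.2}

lemma addChar_sum_eq_prod {V ι : Type*} [AddCommMonoid V] (ψ : AddChar V ℂ) (S : Finset ι)
    (f : ι → V) : ψ (∑ i ∈ S, f i) = ∏ i ∈ S, ψ (f i) := by
  classical
  induction S using Finset.induction_on with
  | empty => simp
  | insert a S ha ih => rw [sum_insert ha, prod_insert ha, AddChar.map_add_eq_mul, ih]

section Energy

variable {X Y V : Type*} [DecidableEq V]

lemma card_filter_eq_sum_mul (A : Finset X) (B : Finset Y) (Φ : X → V) (Ψ : Y → V)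
    (W : Finset V) (hW : ∀ x ∈ A, Φ x ∈ W) :
    #{z ∈ A ×ˢ B | Φ z.1 = Ψ z.2} = ∑ v ∈ W, #{x ∈ A | Φ x = v} * #{y ∈ B | Ψ y = v} := by
  classical
  rw [card_eq_sum_card_fiberwise (f := fun z => Φ z.1) (t := W)]
  · refine sum_congr rfl fun v _ => ?_
    rw [← card_product]
    congr 1
    ext ⟨x, y⟩
    simp only [mem_filter, mem_product]
    constructor
    · rintro ⟨⟨⟨h1, h2⟩, h3⟩, h4⟩
      exact ⟨⟨h1, h4⟩, h2, h3.symm.trans h4⟩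
    · rintro ⟨⟨h1, h4⟩, h2, h3⟩
      exact ⟨⟨⟨h1, h2⟩, h4.trans h3.symm⟩, h4⟩
  · intro z hz
    simp only [coe_filter, mem_product, Set.mem_ofPred_eq] at hz
    exact hW _ hz.1.1

/-- Cauchy–Schwarz for additive coincidences. -/
lemma two_mul_card_filter_le (A : Finset X) (B : Finset Y) (Φ : X → V) (Ψ : Y → V) :
    2 * #{z ∈ A ×ˢ B | Φ z.1 = Ψ z.2} ≤ energy A Φ + energy B Ψ := by
  classical
  set W := A.image Φ ∪ B.image Ψ
  have hA : ∀ x ∈ A, Φ x ∈ W := fun x hx => mem_union_left _ (mem_image_of_mem _ hx)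
  have hB : ∀ x ∈ B, Ψ x ∈ W := fun x hx => mem_union_right _ (mem_image_of_mem _ hx)
  rw [energy, energy, card_filter_eq_sum_mul A B Φ Ψ W hA, card_filter_eq_sum_mul A A Φ Φ W hA,
    card_filter_eq_sum_mul B B Ψ Ψ W hB, mul_sum, ← sum_add_distrib]
  refine sum_le_sum fun v _ => ?_
  have := two_mul_le_add_sq (#{x ∈ A | Φ x = v}) (#{y ∈ B | Ψ y = v})
  nlinarith

lemma energy_cover {C : Type*} (I : Finset C) (S : Finset X) (T : C → Finset X) (Φ : X → V)
    (h : ∀ x ∈ S, ∃ c ∈ I, x ∈ T c) : energy S Φ ≤ #I * ∑ c ∈ I, energy (T c) Φ := by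
  classical
  have h1 : energy S Φ ≤ ∑ c ∈ I, ∑ d ∈ I, #{z ∈ T c ×ˢ T d | Φ z.1 = Φ z.2} := by
    rw [← sum_product' I I (fun c d => #{z ∈ T c ×ˢ T d | Φ z.1 = Φ z.2})]
    refine le_trans (card_le_card ?_) card_biUnion_le
    rintro ⟨x, y⟩ hz
    simp only [mem_filter, mem_product, mem_biUnion, Prod.exists] at hz ⊢
    obtain ⟨c, hc, hxc⟩ := h x hz.1.1
    obtain ⟨d, hd, hyd⟩ := h y hz.1.2
    exact ⟨c, d, ⟨hc, hd⟩, ⟨hxc, hyd⟩, hz.2⟩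
  have h2 : 2 * ∑ c ∈ I, ∑ d ∈ I, #{z ∈ T c ×ˢ T d | Φ z.1 = Φ z.2} ≤
      2 * (#I * ∑ c ∈ I, energy (T c) Φ) := by
    calc 2 * ∑ c ∈ I, ∑ d ∈ I, #{z ∈ T c ×ˢ T d | Φ z.1 = Φ z.2}
        = ∑ c ∈ I, ∑ d ∈ I, 2 * #{z ∈ T c ×ˢ T d | Φ z.1 = Φ z.2} := by
          simp only [mul_sum]
      _ ≤ ∑ c ∈ I, ∑ d ∈ I, (energy (T c) Φ + energy (T d) Φ) :=
          sum_le_sum fun c _ => sum_le_sum fun d _ => two_mul_card_filter_le _ _ _ _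
      _ = 2 * (#I * ∑ c ∈ I, energy (T c) Φ) := by
          simp only [sum_add_distrib, sum_const, smul_eq_mul, ← mul_sum]
          ring
  omega

lemma energy_le_of_bij {S : Finset X} {T : Finset Y} {Φ : X → V} {W : Type*} [DecidableEq W]
    {Ψ : Y → W} (e : X → Y) (he : ∀ x ∈ S, e x ∈ T) (hinj : Set.InjOn e S)
    (h : ∀ x ∈ S, ∀ y ∈ S, Φ x = Φ y → Ψ (e x) = Ψ (e y)) : energy S Φ ≤ energy T Ψ := by
  refine card_le_card_of_injOn (fun z => (e z.1, e z.2)) ?_ ?_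
  · rintro ⟨x, y⟩ hz
    simp only [coe_filter, mem_product, Set.mem_ofPred_eq] at hz ⊢
    exact ⟨⟨he _ hz.1.1, he _ hz.1.2⟩, h _ hz.1.1 _ hz.1.2 hz.2⟩
  · rintro ⟨x, y⟩ hz ⟨x', y'⟩ hz' heq
    simp only [coe_filter, mem_product, Set.mem_ofPred_eq, Prod.mk.injEq] at hz hz' heq ⊢
    exact ⟨hinj hz.1.1 hz'.1.1 heq.1, hinj hz.1.2 hz'.1.2 heq.2⟩

/-- The number of representations of a difference is at most the energy. -/
lemma card_filter_sub_eq_le [AddCommGroup V] (S : Finset X) (Φ : X → V) (w : V) :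
    #{z ∈ S ×ˢ S | Φ z.1 - Φ z.2 = w} ≤ energy S Φ := by
  have h := two_mul_card_filter_le S S Φ (fun x => Φ x + w)
  have h2 : energy S (fun x => Φ x + w) = energy S Φ := by simp [energy]
  have h3 : ({z ∈ S ×ˢ S | Φ z.1 - Φ z.2 = w} : Finset _) =
      {z ∈ S ×ˢ S | Φ z.1 = Φ z.2 + w} := by
    refine filter_congr fun z _ => ?_
    rw [sub_eq_iff_eq_add, add_comm]
  rw [h3]
  omega

lemma sum_norm_sq_addChar [AddCommGroup V] [Fintype V] (S : Finset X) (Φ : X → V) :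
    ∑ ψ : AddChar V ℂ, ‖∑ x ∈ S, ψ (Φ x)‖ ^ 2 = Fintype.card V * (energy S Φ : ℝ) := by
  have h : ∀ ψ : AddChar V ℂ, ((‖∑ x ∈ S, ψ (Φ x)‖ ^ 2 : ℝ) : ℂ) =
      ∑ z ∈ S ×ˢ S, ψ (Φ z.1 - Φ z.2) := by
    intro ψ
    rw [Complex.ofReal_pow, ← Complex.mul_conj', map_sum, sum_mul_sum, ← sum_product']
    refine sum_congr rfl fun z _ => ?_
    rw [AddChar.map_sub_eq_div, div_eq_mul_inv, ← AddChar.map_neg_eq_inv, AddChar.map_neg_eq_conj]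
  have h2 : ((∑ ψ : AddChar V ℂ, ‖∑ x ∈ S, ψ (Φ x)‖ ^ 2 : ℝ) : ℂ) =
      ((Fintype.card V * (energy S Φ : ℝ) : ℝ) : ℂ) := by
    rw [Complex.ofReal_sum]
    simp_rw [h]
    rw [sum_comm]
    simp_rw [AddChar.sum_apply_eq_ite, sub_eq_zero]
    rw [← sum_filter, sum_const, energy]
    simp [mul_comm]
  exact_mod_cast h2

end Energy

lemma exists_zmod_injOn {X : Type*} {k : ℕ} (S : Finset X) (Φ : X → Fin k → ℤ) :
    ∃ M : ℕ, 0 < M ∧ ∀ x ∈ S, ∀ y ∈ S,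
      ((fun i => (Φ x i : ZMod M)) = fun i => (Φ y i : ZMod M)) → Φ x = Φ y := by
  classical
  set M := 1 + ∑ z ∈ S ×ˢ S, ∑ i, (Φ z.1 i - Φ z.2 i).natAbs with hM
  refine ⟨M, by omega, fun x hx y hy h => funext fun i => ?_⟩
  have h1 := congrFun h i
  have h2 : (M : ℤ) ∣ Φ x i - Φ y i := by
    have := (ZMod.intCast_eq_intCast_iff_dvd_sub _ _ M).1 h1.symm
    exact this
  have h3 : (Φ x i - Φ y i).natAbs < M := by
    have a1 := single_le_sum (f := fun i => (Φ x i - Φ y i).natAbs) (fun _ _ => Nat.zero_le _)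
      (mem_univ i)
    have a2 := single_le_sum (f := fun z : X × X => ∑ i, (Φ z.1 i - Φ z.2 i).natAbs)
      (fun _ _ => Nat.zero_le _) (mem_product.2 ⟨hx, hy⟩ : (x, y) ∈ S ×ˢ S)
    simp only at a1 a2
    omega
  have := Int.eq_zero_of_dvd_of_natAbs_lt_natAbs h2 (by simpa using h3)
  omega

section Vector

variable {k : ℕ}

lemma energy_zmod_eq {X : Type*} (S : Finset X) (Φ : X → Fin k → ℤ) (M : ℕ)
    (h : ∀ x ∈ S, ∀ y ∈ S,
      ((fun i => (Φ x i : ZMod M)) = fun i => (Φ y i : ZMod M)) → Φ x = Φ y) :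
    energy S (fun x i => (Φ x i : ZMod M)) = energy S Φ := by
  unfold energy
  congr 1
  refine filter_congr fun z hz => ?_
  rw [mem_product] at hz
  exact ⟨h _ hz.1 _ hz.2, fun e => by simp only [e]⟩

/-- Hölder's inequality for solution counts. -/
lemma energy_piFinset_le {ι : Type*} [Fintype ι] [DecidableEq ι] [Nonempty ι]
    (A : ι → Finset ℤ) (φ : ℤ → Fin k → ℤ) :
    energy (Fintype.piFinset A) (fun x => ∑ i, φ (x i)) ≤
      ∑ j, energy (Fintype.piFinset fun _ : ι => A j) (fun x => ∑ i, φ (x i)) := by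
  classical
  set U := univ.biUnion A with hU
  obtain ⟨M, hM0, hM⟩ := exists_zmod_injOn (Fintype.piFinset fun _ : ι => U)
    (fun x => ∑ i, φ (x i))
  have : NeZero M := ⟨hM0.ne'⟩
  have hsub : ∀ B : ι → Finset ℤ, (∀ i, B i ⊆ U) →
      (Fintype.card (Fin k → ZMod M) : ℝ) * energy (Fintype.piFinset B) (fun x => ∑ i, φ (x i)) =
      ∑ ψ : AddChar (Fin k → ZMod M) ℂ,
        ∏ i, ‖∑ x ∈ B i, ψ (fun l => (φ x l : ZMod M))‖ ^ 2 := by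
    intro B hB
    have hBU : Fintype.piFinset B ⊆ Fintype.piFinset fun _ : ι => U :=
      Fintype.piFinset_subset _ _ hB
    rw [← energy_zmod_eq _ _ M fun x hx y hy => hM x (hBU hx) y (hBU hy), ← sum_norm_sq_addChar]
    refine sum_congr rfl fun ψ _ => ?_
    rw [prod_pow, ← norm_prod, prod_univ_sum]
    congr 2
    refine sum_congr rfl fun x _ => ?_
    rw [← addChar_sum_eq_prod]
    congr 1
    ext l
    simp
  have hAU : ∀ j, A j ⊆ U := fun j => subset_biUnion_of_mem A (mem_univ j)
  have hcard : (0 : ℝ) < Fintype.card (Fin k → ZMod M) := by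
    exact_mod_cast Fintype.card_pos
  have key : (Fintype.card (Fin k → ZMod M) : ℝ) *
      energy (Fintype.piFinset A) (fun x => ∑ i, φ (x i)) ≤
      (Fintype.card (Fin k → ZMod M) : ℝ) *
      ∑ j, (energy (Fintype.piFinset fun _ : ι => A j) (fun x => ∑ i, φ (x i)) : ℝ) := by
    rw [hsub A hAU, mul_sum]
    simp_rw [fun j => hsub (fun _ => A j) (fun _ => hAU j)]
    rw [sum_comm]
    refine sum_le_sum fun ψ _ => ?_
    set g := fun i => ‖∑ x ∈ A i, ψ (fun l => (φ x l : ZMod M))‖ ^ 2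
    obtain ⟨j, -, hj⟩ := exists_max_image univ g univ_nonempty
    calc ∏ i, g i ≤ ∏ _i : ι, g j := prod_le_prod (fun i _ => by positivity) fun i hi => hj i hi
      _ ≤ ∑ j, ∏ _i : ι, g j :=
        single_le_sum (f := fun j => ∏ _i : ι, g j) (fun j _ => by positivity) (mem_univ j)
  exact_mod_cast le_of_mul_le_mul_left key hcard

lemma energy_prod_piFinset_le {Z I : Type*} (s : ℕ) (hs : 0 < s) (T : Finset Z)
    (Φ : Z → Fin k → ℤ) (φ : ℤ → Fin k → ℤ) (J : Finset I) (A : I → Finset ℤ) (B : Finset ℤ)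
    (hB : ∀ (f : ℤ → ℂ), ∑ x ∈ B, f x = ∑ a ∈ J, ∑ x ∈ A a, f x) (hAB : ∀ a ∈ J, A a ⊆ B) :
    energy (T ×ˢ Fintype.piFinset fun _ : Fin s => B) (fun z => Φ z.1 + ∑ i, φ (z.2 i)) ≤
      #J ^ (2 * s - 1) * ∑ a ∈ J, energy (T ×ˢ Fintype.piFinset fun _ : Fin s => A a)
        (fun z => Φ z.1 + ∑ i, φ (z.2 i)) := by
  classical
  obtain ⟨M, hM0, hM⟩ := exists_zmod_injOn (T ×ˢ Fintype.piFinset fun _ : Fin s => B)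
    (fun z => Φ z.1 + ∑ i, φ (z.2 i))
  have : NeZero M := ⟨hM0.ne'⟩
  have hsub : ∀ D : Finset ℤ, D ⊆ B →
      (Fintype.card (Fin k → ZMod M) : ℝ) * energy (T ×ˢ Fintype.piFinset fun _ : Fin s => D)
        (fun z => Φ z.1 + ∑ i, φ (z.2 i)) =
      ∑ ψ : AddChar (Fin k → ZMod M) ℂ, ‖∑ z ∈ T, ψ (fun l => (Φ z l : ZMod M))‖ ^ 2 *
        ‖∑ x ∈ D, ψ (fun l => (φ x l : ZMod M))‖ ^ (2 * s) := by
    intro D hD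
    have hDU : T ×ˢ (Fintype.piFinset fun _ : Fin s => D) ⊆
        T ×ˢ Fintype.piFinset fun _ : Fin s => B :=
      product_subset_product le_rfl (Fintype.piFinset_subset _ _ fun _ => hD)
    rw [← energy_zmod_eq _ _ M fun x hx y hy => hM x (hDU hx) y (hDU hy), ← sum_norm_sq_addChar]
    refine sum_congr rfl fun ψ _ => ?_
    rw [mul_comm 2 s, pow_mul, ← mul_pow, ← norm_pow (∑ x ∈ D, ψ _), ← norm_mul]
    congr 2
    rw [← Fin.prod_const, prod_univ_sum, sum_mul_sum, ← sum_product']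
    refine sum_congr rfl fun x _ => ?_
    rw [← addChar_sum_eq_prod, ← AddChar.map_add_eq_mul]
    congr 1
    ext l
    simp
  have hcard : (0 : ℝ) < Fintype.card (Fin k → ZMod M) := by
    exact_mod_cast Fintype.card_pos
  have key : (Fintype.card (Fin k → ZMod M) : ℝ) *
      energy (T ×ˢ Fintype.piFinset fun _ : Fin s => B) (fun z => Φ z.1 + ∑ i, φ (z.2 i)) ≤
      (Fintype.card (Fin k → ZMod M) : ℝ) *
      (#J ^ (2 * s - 1) * ∑ a ∈ J, (energy (T ×ˢ Fintype.piFinset fun _ : Fin s => A a)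
        (fun z => Φ z.1 + ∑ i, φ (z.2 i)) : ℝ)) := by
    rw [hsub B le_rfl, mul_left_comm, mul_sum]
    rw [sum_congr rfl fun a ha => hsub (A a) (hAB a ha), sum_comm, mul_sum]
    refine sum_le_sum fun ψ _ => ?_
    rw [← mul_sum, mul_left_comm]
    refine mul_le_mul_of_nonneg_left ?_ (by positivity)
    rw [hB]
    obtain ⟨r, hr⟩ : ∃ r, 2 * s = r + 1 := ⟨2 * s - 1, by omega⟩
    rw [hr, Nat.add_sub_cancel]
    calc _ ≤ (∑ a ∈ J, ‖∑ x ∈ A a, ψ (fun l => (φ x l : ZMod M))‖) ^ (r + 1) :=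
          pow_le_pow_left₀ (norm_nonneg _) (norm_sum_le _ _) _
      _ ≤ _ := by
          rcases J.eq_empty_or_nonempty with rfl | hJ
          · simp
          have := pow_sum_div_card_le_sum_pow (s := J)
            (f := fun a => ‖∑ x ∈ A a, ψ (fun l => (φ x l : ZMod M))‖)
            (fun a _ => norm_nonneg _) r
          rwa [div_le_iff₀' (by have := hJ.card_pos; positivity)] at this
  exact_mod_cast le_of_mul_le_mul_left key hcard

end Vector

/-- The moment curve `x ↦ (x, x ^ 2, …, x ^ k)`. -/
def momentCurve (k : ℕ) (x : ℤ) : Fin k → ℤ := fun h => x ^ (h.1 + 1)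

/-- Number of solutions of the Vinogradov system of degree `k` with variables indexed by `ι`
(on each side) ranging over `0, …, N - 1`. -/
noncomputable def vinogradovCount (ι : Type*) [Fintype ι] [DecidableEq ι] (k N : ℕ) : ℕ :=
  energy (Fintype.piFinset fun _ : ι => Ico (0 : ℤ) N) fun x => ∑ i, momentCurve k (x i)

lemma sum_momentCurve_eq_iff {ι : Type*} [Fintype ι] {k : ℕ} {x y : ι → ℤ} :
    ∑ i, momentCurve k (x i) = ∑ i, momentCurve k (y i) ↔
      ∀ h, 1 ≤ h → h ≤ k → ∑ i, x i ^ h = ∑ i, y i ^ h := by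
  constructor
  · intro e h h1 h2
    have := congrFun e ⟨h - 1, by omega⟩
    simpa [momentCurve, Nat.sub_add_cancel h1] using this
  · intro e
    ext h
    simpa [momentCurve] using e (h.1 + 1) (by omega) (by omega)

lemma psum_sub_const_eq {ι : Type*} [Fintype ι] {k : ℕ} {x y : ι → ℤ}
    (e : ∀ h, 1 ≤ h → h ≤ k → ∑ i, x i ^ h = ∑ i, y i ^ h) (a : ℤ) (h : ℕ) (hk : h ≤ k) :
    ∑ i, (x i - a) ^ h = ∑ i, (y i - a) ^ h := by
  have key : ∀ z : ι → ℤ, ∑ i, (z i - a) ^ h =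
      ∑ m ∈ range (h + 1), (∑ i, z i ^ m) * ((-a) ^ (h - m) * (h.choose m)) := by
    intro z
    simp_rw [sub_eq_add_neg, add_pow, sum_mul]
    rw [sum_comm]
    simp only [mul_assoc]
  rw [key, key]
  refine sum_congr rfl fun m hm => ?_
  rw [mem_range] at hm
  rcases Nat.eq_zero_or_pos m with rfl | h0
  · simp
  · rw [e m h0 (by omega)]

section

variable {ι κ : Type*} [Fintype ι] [DecidableEq ι] [Fintype κ] [DecidableEq κ] {k : ℕ}

lemma vinogradovCount_le_of_equiv (e : ι ≃ κ) (N : ℕ) :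
    vinogradovCount ι k N ≤ vinogradovCount κ k N := by
  refine energy_le_of_bij (fun x => x ∘ e.symm) ?_ ?_ ?_
  · intro x hx
    simp only [Fintype.mem_piFinset] at hx ⊢
    exact fun i => hx _
  · intro x _ y _ h
    exact (e.symm.surjective.injective_comp_right h)
  · intro x _ y _ h
    simp only [Function.comp_apply]
    rw [Equiv.sum_comp e.symm fun i => momentCurve k (x i),
      Equiv.sum_comp e.symm fun i => momentCurve k (y i)]
    exact h

/-- Points of `[0, N)` in a fixed residue class. -/
noncomputable def residueClass (N p : ℕ) (r : ℤ) : Finset ℤ := {x ∈ Ico (0 : ℤ) N | x % p = r}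

lemma energy_residueClass_le {N p : ℕ} (hp : 0 < p) (r : ℤ) :
    energy (Fintype.piFinset fun _ : ι => residueClass N p r)
      (fun x => ∑ i, momentCurve k (x i)) ≤ vinogradovCount ι k (N / p + 1) := by
  have hp' : (0 : ℤ) < p := by exact_mod_cast hp
  have hdec : ∀ x ∈ residueClass N p r, x = r + p * (x / p) := by
    intro x hx
    simp only [residueClass, mem_filter] at hx
    rw [← hx.2, Int.emod_add_mul_ediv]
  refine energy_le_of_bij (fun x i => x i / p) ?_ ?_ ?_
  · intro x hx
    simp only [Fintype.mem_piFinset, residueClass, mem_filter, mem_Ico] at hx ⊢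
    intro i
    refine ⟨Int.ediv_nonneg (hx i).1.1 hp'.le, ?_⟩
    push_cast
    have := Int.ediv_le_ediv hp' (hx i).1.2.le
    omega
  · intro x hx y hy h
    rw [mem_coe, Fintype.mem_piFinset] at hx hy
    ext i
    rw [hdec _ (hx i), hdec _ (hy i)]
    have := congrFun h i
    simp only at this
    rw [this]
  · intro x hx y hy h
    simp only [Fintype.mem_piFinset] at hx hy
    rw [sum_momentCurve_eq_iff] at h ⊢
    intro m h1 h2
    have h3 := psum_sub_const_eq h r m h2
    have h4 : ∀ z : ι → ℤ, (∀ i, z i ∈ residueClass N p r) →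
        ∑ i, (z i - r) ^ m = (p : ℤ) ^ m * ∑ i, (z i / p) ^ m := by
      intro z hz
      rw [mul_sum]
      refine sum_congr rfl fun i _ => ?_
      rw [← mul_pow]
      congr 1
      linarith [hdec _ (hz i)]
    rw [h4 x hx, h4 y hy] at h3
    exact mul_left_cancel₀ (pow_ne_zero _ hp'.ne') h3

lemma energy_prod_le {X Y : Type*} {V : Type*} [AddCommGroup V] [DecidableEq V] (T : Finset X)
    (S : Finset Y) (Φ : X → V) (Ψ : Y → V) (R : X → Finset X) (m : ℕ)
    (hR : ∀ z ∈ T, ∀ w ∈ T, ∀ u ∈ S, ∀ v ∈ S, Φ z + Ψ u = Φ w + Ψ v → z ∈ R w)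
    (hm : ∀ w ∈ T, #(R w) ≤ m) :
    energy (T ×ˢ S) (fun z => Φ z.1 + Ψ z.2) ≤ #T * m * energy S Ψ := by
  classical
  have h1 : energy (T ×ˢ S) (fun z => Φ z.1 + Ψ z.2) ≤
      ∑ w ∈ T, ∑ z ∈ R w, #{q ∈ S ×ˢ S | Ψ q.1 - Ψ q.2 = Φ w - Φ z} := by
    have : ∀ w ∈ T, ∑ z ∈ R w, #{q ∈ S ×ˢ S | Ψ q.1 - Ψ q.2 = Φ w - Φ z} =
        #((R w).sigma fun z => {q ∈ S ×ˢ S | Ψ q.1 - Ψ q.2 = Φ w - Φ z}) := fun w _ =>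
      (card_sigma _ _).symm
    rw [sum_congr rfl this, ← card_sigma]
    refine card_le_card_of_injOn
      (fun q => ⟨q.2.1, ⟨q.1.1, (q.1.2, q.2.2)⟩⟩) ?_ ?_
    · rintro ⟨⟨z, u⟩, ⟨w, v⟩⟩ hq
      simp only [coe_filter, mem_product, Set.mem_ofPred_eq] at hq
      simp only [mem_coe, mem_sigma, mem_filter, mem_product]
      obtain ⟨⟨⟨hz, hu⟩, hw, hv⟩, heq⟩ := hq
      refine ⟨hw, hR z hz w hw u hu v hv heq, ⟨hu, hv⟩, ?_⟩
      rw [sub_eq_sub_iff_add_eq_add, add_comm, heq]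
    · rintro ⟨⟨z, u⟩, ⟨w, v⟩⟩ _ ⟨⟨z', u'⟩, ⟨w', v'⟩⟩ _ h
      simp only [Sigma.mk.injEq, heq_eq_eq, Prod.mk.injEq] at h ⊢
      tauto
  calc _ ≤ _ := h1
    _ ≤ ∑ w ∈ T, ∑ z ∈ R w, energy S Ψ :=
      sum_le_sum fun w _ => sum_le_sum fun z _ => card_filter_sub_eq_le _ _ _
    _ = ∑ w ∈ T, #(R w) * energy S Ψ := by simp
    _ ≤ ∑ w ∈ T, m * energy S Ψ :=
      sum_le_sum fun w hw => Nat.mul_le_mul_right _ (hm w hw)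
    _ = _ := by simp [mul_assoc]

/-- `k`-tuples with entries in `[0, N)` that are pairwise incongruent modulo `p`. -/
noncomputable def distinctTuples (k N p : ℕ) : Finset (Fin k → ℤ) :=
  {z ∈ Fintype.piFinset fun _ : Fin k => Ico (0 : ℤ) N | ∀ i j, z i % p = z j % p → i = j}

/-- Linnik's lemma. -/
lemma card_psum_modEq_le {N p : ℕ} (hp : p.Prime) (hkp : k < p) (hN : N ≤ p ^ k) (a : ℤ)
    (w : Fin k → ℤ) :
    #{z ∈ distinctTuples k N p | ∀ h, 1 ≤ h → h ≤ k →
      (p : ℤ) ^ h ∣ ∑ i, (z i - a) ^ h - ∑ i, (w i - a) ^ h} ≤ k ^ k * p ^ (k * (k - 1) / 2) := by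
  classical
  set R := ({z ∈ distinctTuples k N p | ∀ h, 1 ≤ h → h ≤ k →
      (p : ℤ) ^ h ∣ ∑ i, (z i - a) ^ h - ∑ i, (w i - a) ^ h} : Finset _) with hR
  have hp0 : (0 : ℤ) < p := by exact_mod_cast hp.pos
  let q : (Fin k → ℤ) → Fin k → ℤ := fun z h =>
    (∑ i, (z i - a) ^ (h.1 + 1) - ∑ i, (w i - a) ^ (h.1 + 1)) / (p : ℤ) ^ (h.1 + 1)
  let f : (Fin k → ℤ) → Fin k → ℤ := fun z h => q z h % (p : ℤ) ^ (k - 1 - h.1)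
  have himage : #(R.image f) ≤ p ^ (k * (k - 1) / 2) := by
    have hsub : R.image f ⊆
        Fintype.piFinset fun h : Fin k => Ico (0 : ℤ) ((p : ℤ) ^ (k - 1 - h.1)) := by
      intro y hy
      obtain ⟨z, -, rfl⟩ := mem_image.1 hy
      rw [Fintype.mem_piFinset]
      intro h
      rw [mem_Ico]
      exact ⟨Int.emod_nonneg _ (pow_pos hp0 _).ne', Int.emod_lt_of_pos _ (pow_pos hp0 _)⟩
    refine (card_le_card hsub).trans (le_of_eq ?_)
    rw [Fintype.card_piFinset]
    have : ∀ h : Fin k, #(Ico (0 : ℤ) ((p : ℤ) ^ (k - 1 - h.1))) = p ^ (k - 1 - h.1) := by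
      intro h
      rw [Int.card_Ico, sub_zero, ← Nat.cast_pow, Int.toNat_natCast]
    simp_rw [this]
    rw [prod_pow_eq_pow_sum, Fin.sum_univ_eq_sum_range (fun i => k - 1 - i) k,
      sum_range_reflect (fun i => i) k, sum_range_id]
  have hfib : ∀ y ∈ R.image f, #{z ∈ R | f z = y} ≤ k ^ k := by
    intro y hy
    obtain ⟨z₀, hz₀, rfl⟩ := mem_image.1 hy
    have hz₀' := (mem_filter.1 hz₀)
    have hd₀ := (mem_filter.1 hz₀'.1)
    have hmain : ∀ z ∈ R, f z = f z₀ → ∀ i, ∃ l, z i = z₀ l := by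
      intro z hz hfz i
      have hz' := (mem_filter.1 hz)
      have hd := (mem_filter.1 hz'.1)
      have hcong : ∀ h, 1 ≤ h → h ≤ k →
          ∑ i, (z₀ i - a) ^ h ≡ ∑ i, (z i - a) ^ h [ZMOD (p : ℤ) ^ k] := by
        intro h h1 h2
        have e := congrFun hfz ⟨h - 1, by omega⟩
        simp only [f, q, Nat.sub_add_cancel h1] at e
        obtain ⟨c, hc⟩ := hz'.2 h h1 h2
        obtain ⟨c₀, hc₀⟩ := hz₀'.2 h h1 h2
        have hph : (p : ℤ) ^ h ≠ 0 := (pow_pos hp0 _).ne'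
        rw [hc, hc₀, Int.mul_ediv_cancel_left _ hph, Int.mul_ediv_cancel_left _ hph] at e
        have e2 : (p : ℤ) ^ (k - 1 - (h - 1)) ∣ c - c₀ := Int.ModEq.dvd (Eq.symm e)
        rw [Int.modEq_iff_dvd]
        have e3 : ∑ i, (z i - a) ^ h - ∑ i, (z₀ i - a) ^ h = (p : ℤ) ^ h * (c - c₀) := by
          rw [mul_sub, ← hc, ← hc₀]; ring
        rw [e3]
        have : (p : ℤ) ^ k = p ^ h * p ^ (k - 1 - (h - 1)) := by
          rw [← pow_add]; congr 1; omega
        rw [this]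
        exact mul_dvd_mul_left _ e2
      have hinj : ∀ i j, z₀ i - a ≡ z₀ j - a [ZMOD p] → i = j := fun i j hij =>
        hd₀.2 i j (by simpa [Int.ModEq] using Int.ModEq.add_right a hij)
      obtain ⟨l, hl⟩ := exists_modEq_of_psum_modEq hp hkp (x := fun i => z₀ i - a)
        (y := fun i => z i - a) hinj hcong i
      · refine ⟨l, ?_⟩
        have h1 := (Fintype.mem_piFinset.1 hd.1) i
        have h2 := (Fintype.mem_piFinset.1 hd₀.1) l
        rw [mem_Ico] at h1 h2
        have h3 : z i ≡ z₀ l [ZMOD (p : ℤ) ^ k] := by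
          have := hl.add_right a
          simpa using this
        have hN' : (N : ℤ) ≤ (p : ℤ) ^ k := by exact_mod_cast hN
        have h4 := h3
        unfold Int.ModEq at h4
        rwa [Int.emod_eq_of_lt h1.1 (by omega), Int.emod_eq_of_lt h2.1 (by omega)] at h4
    have hsub : ({z ∈ R | f z = f z₀} : Finset _) ⊆
        (univ : Finset (Fin k → Fin k)).image fun σ i => z₀ (σ i) := by
      intro z hz
      rw [mem_filter] at hz
      choose σ hσ using hmain z hz.1 hz.2
      exact mem_image.2 ⟨σ, mem_univ _, funext fun i => (hσ i).symm⟩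
    refine (card_le_card hsub).trans (card_image_le.trans ?_)
    simp
  calc #R ≤ k ^ k * #(R.image f) := card_le_mul_card_image R (k ^ k) hfib
    _ ≤ _ := Nat.mul_le_mul_left _ himage

end

section

variable {k s N p : ℕ}

lemma sum_elim_momentCurve (x : Fin k ⊕ Fin s → ℤ) (l : ℕ) :
    ∑ i, momentCurve l (x i) =
      ∑ i, momentCurve l (x (Sum.inl i)) + ∑ i, momentCurve l (x (Sum.inr i)) :=
  Fintype.sum_sum_type _

lemma energy_sum_le_prod {l : ℕ} (S : Finset (Fin k ⊕ Fin s → ℤ))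
    (T : Finset (Fin k → ℤ)) (B : Finset ℤ)
    (hT : ∀ x ∈ S, x ∘ Sum.inl ∈ T) (hB : ∀ x ∈ S, ∀ i, x (Sum.inr i) ∈ B) :
    energy S (fun x => ∑ i, momentCurve l (x i)) ≤
      energy (T ×ˢ Fintype.piFinset fun _ : Fin s => B)
        (fun z => ∑ i, momentCurve l (z.1 i) + ∑ i, momentCurve l (z.2 i)) := by
  refine energy_le_of_bij (fun x => (x ∘ Sum.inl, x ∘ Sum.inr)) ?_ ?_ ?_
  · intro x hx
    simp only [mem_product, Fintype.mem_piFinset]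
    exact ⟨hT x hx, fun i => hB x hx i⟩
  · intro x _ y _ h
    simp only [Prod.mk.injEq] at h
    funext i
    rcases i with i | i
    · exact congrFun h.1 i
    · exact congrFun h.2 i
  · intro x _ y _ h
    rw [sum_elim_momentCurve, sum_elim_momentCurve] at h
    exact h

lemma card_Ico_zero_int (N : ℕ) : #(Ico (0 : ℤ) N) = N := by simp

lemma vinogradovCount_sum_le (l N : ℕ) :
    vinogradovCount (Fin k ⊕ Fin s) l N ≤ N ^ (2 * k) * vinogradovCount (Fin s) l N := by
  refine (energy_sum_le_prod _ (Fintype.piFinset fun _ => Ico (0 : ℤ) N) (Ico (0 : ℤ) N) ?_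
    ?_).trans ?_
  · intro x hx
    rw [Fintype.mem_piFinset] at hx ⊢
    exact fun i => hx _
  · intro x hx i
    rw [Fintype.mem_piFinset] at hx
    exact hx _
  · refine (energy_prod_le _ _ (fun z : Fin k → ℤ => ∑ i, momentCurve l (z i))
      (fun z : Fin s → ℤ => ∑ i, momentCurve l (z i))
      (fun _ => Fintype.piFinset fun _ => Ico (0 : ℤ) N) (N ^ k)
      (fun z hz _ _ _ _ _ _ _ => hz) (fun _ _ => ?_)).trans (le_of_eq ?_)
    · simp
    · rw [Fintype.card_piFinset]
      simp only [card_Ico_zero_int, prod_const, card_univ, Fintype.card_fin]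
      rw [two_mul, pow_add]
      rfl

lemma energy_distinct_le (hs : 0 < s) (hp : p.Prime) (hkp : k < p) (hN : N ≤ p ^ k) :
    energy (distinctTuples k N p ×ˢ Fintype.piFinset fun _ : Fin s => Ico (0 : ℤ) N)
        (fun z => ∑ i, momentCurve k (z.1 i) + ∑ i, momentCurve k (z.2 i)) ≤
      p ^ (2 * s) * (N ^ k * (k ^ k * p ^ (k * (k - 1) / 2)) *
        vinogradovCount (Fin s) k (N / p + 1)) := by
  have hp0 : (0 : ℤ) < p := by exact_mod_cast hp.pos
  have h1 := energy_prod_piFinset_le s hs (distinctTuples k N p)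
    (fun z => ∑ i, momentCurve k (z i)) (momentCurve k) (Ico (0 : ℤ) p)
    (residueClass N p) (Ico (0 : ℤ) N) (fun f => ?_) (fun a _ => filter_subset _ _)
  swap
  · exact (sum_fiberwise_of_maps_to (fun x _ => mem_Ico.2
      ⟨Int.emod_nonneg x hp0.ne', Int.emod_lt_of_pos x hp0⟩) f).symm
  refine h1.trans ?_
  have h2 : ∀ a ∈ Ico (0 : ℤ) p, energy (distinctTuples k N p ×ˢ
      Fintype.piFinset fun _ : Fin s => residueClass N p a)
        (fun z => ∑ i, momentCurve k (z.1 i) + ∑ i, momentCurve k (z.2 i)) ≤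
      N ^ k * (k ^ k * p ^ (k * (k - 1) / 2)) * vinogradovCount (Fin s) k (N / p + 1) := by
    intro a _
    refine (energy_prod_le _ _ (fun z : Fin k → ℤ => ∑ i, momentCurve k (z i))
      (fun z : Fin s → ℤ => ∑ i, momentCurve k (z i))
      (fun w => {z ∈ distinctTuples k N p | ∀ h, 1 ≤ h → h ≤ k →
        (p : ℤ) ^ h ∣ ∑ i, (z i - a) ^ h - ∑ i, (w i - a) ^ h}) _ ?_
        (fun w _ => card_psum_modEq_le hp hkp hN a w)).trans ?_
    · intro z hz w hw u hu v hv heq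
      rw [mem_filter]
      refine ⟨hz, ?_⟩
      intro h h1 h2
      have e1 : ∑ i, momentCurve k (Sum.elim z u i) = ∑ i, momentCurve k (Sum.elim w v i) := by
        rw [sum_elim_momentCurve, sum_elim_momentCurve]
        exact heq
      rw [sum_momentCurve_eq_iff] at e1
      have e2 := psum_sub_const_eq e1 a h h2
      rw [Fintype.sum_sum_type, Fintype.sum_sum_type] at e2
      simp only [Sum.elim_inl, Sum.elim_inr] at e2
      have e3 : ∀ u : Fin s → ℤ, u ∈ (Fintype.piFinset fun _ => residueClass N p a) →
          (p : ℤ) ^ h ∣ ∑ i, (u i - a) ^ h := by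
        intro u hu
        rw [Fintype.mem_piFinset] at hu
        refine dvd_sum fun i _ => pow_dvd_pow_of_dvd ?_ h
        have := (mem_filter.1 (hu i)).2
        rw [← this]
        exact Int.dvd_self_sub_emod
      have e4 : ∑ i, (z i - a) ^ h - ∑ i, (w i - a) ^ h =
          ∑ i, (v i - a) ^ h - ∑ i, (u i - a) ^ h := by linarith
      rw [e4]
      exact dvd_sub (e3 v hv) (e3 u hu)
    · have hc : #(distinctTuples k N p) ≤ N ^ k := by
        refine (card_filter_le _ _).trans (le_of_eq ?_)
        simp
      exact Nat.mul_le_mul (Nat.mul_le_mul_right _ hc) (energy_residueClass_le hp.pos a)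
  refine (Nat.mul_le_mul_left _ (sum_le_sum h2)).trans (le_of_eq ?_)
  rw [sum_const, card_Ico_zero_int, smul_eq_mul, ← mul_assoc, ← pow_succ]
  congr 2
  omega

lemma exists_perm_extending {ι κ : Type*} [Fintype ι] [DecidableEq ι] [Fintype κ]
    (f g : κ → ι) (hf : Function.Injective f) (hg : Function.Injective g) :
    ∃ σ : Equiv.Perm ι, ∀ i, σ (f i) = g i := by
  classical
  let e : Set.range f ≃ Set.range g := (Equiv.ofInjective f hf).symm.trans (Equiv.ofInjective g hg)
  refine ⟨e.extendSubtype, fun i => ?_⟩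
  rw [Equiv.extendSubtype_apply_of_mem e _ ⟨i, rfl⟩]
  simp [e, Equiv.ofInjective_symm_apply]

lemma exists_perm_or_cover {ι : Type*} [Fintype ι] [DecidableEq ι] (hp : 0 < p)
    (f : Fin k → ι) (hf : Function.Injective f) (x : ι → ℤ) :
    (∃ σ : Equiv.Perm ι, ∀ i j, x (σ (f i)) % p = x (σ (f j)) % p → i = j) ∨
    ∃ c : Fin k → ℤ, (∀ i, c i ∈ Ico (0 : ℤ) p) ∧ ∃ τ : ι → Fin k, ∀ i, x i % p = c (τ i) := by
  classical
  have hp' : (0 : ℤ) < p := by exact_mod_cast hp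
  set R : Finset ℤ := univ.image fun i => x i % p with hR
  have hmem : ∀ i, x i % p ∈ R := fun i => mem_image_of_mem _ (mem_univ i)
  rcases le_total k #R with h | h
  · left
    obtain ⟨g⟩ : Nonempty (Fin k ↪ R) := Function.Embedding.nonempty_of_card_le (by simpa using h)
    have : ∀ j, ∃ i, x i % p = g j := fun j => by
      obtain ⟨i, -, hi⟩ := mem_image.1 (g j).2
      exact ⟨i, hi⟩
    choose q hq using this
    obtain ⟨σ, hσ⟩ := exists_perm_extending f q hf (fun i j hij => g.injective (Subtype.ext (by
      rw [← hq, ← hq, hij])))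
    refine ⟨σ, fun i j hij => g.injective (Subtype.ext ?_)⟩
    rw [← hq, ← hq, ← hσ, ← hσ, hij]
  · right
    obtain ⟨g⟩ : Nonempty (R ↪ Fin k) := Function.Embedding.nonempty_of_card_le (by simpa using h)
    refine ⟨fun i => if h : ∃ r, g r = i then (h.choose : ℤ) else 0, fun i => ?_,
      fun i => g ⟨_, hmem i⟩, fun i => ?_⟩
    · dsimp only
      split_ifs with h
      · obtain ⟨j, -, hj⟩ := mem_image.1 h.choose.2
        rw [← hj, mem_Ico]
        exact ⟨Int.emod_nonneg _ hp'.ne', Int.emod_lt_of_pos _ hp'⟩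
      · simpa using hp'
    · have h : ∃ r, g r = g ⟨_, hmem i⟩ := ⟨_, rfl⟩
      dsimp only
      rw [dif_pos h, g.injective h.choose_spec]

/-- The recursive inequality for the Vinogradov system. -/
lemma vinogradovCount_recursion (hk : 0 < k) (hs : 0 < s) (hp : p.Prime) (hkp : k < p)
    (hN : N ≤ p ^ k) :
    vinogradovCount (Fin (k + s)) k N ≤ 2 * ((k + s).factorial ^ 2 * (p ^ (2 * s) *
        (N ^ k * (k ^ k * p ^ (k * (k - 1) / 2)) * vinogradovCount (Fin s) k (N / p + 1))) +
      (p ^ k * k ^ (k + s)) ^ 2 * ((k + s) * ((N / p + 1) ^ (2 * k) *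
        vinogradovCount (Fin s) k (N / p + 1)))) := by
  classical
  have : Nonempty (Fin k ⊕ Fin s) := ⟨Sum.inl ⟨0, hk⟩⟩
  refine (vinogradovCount_le_of_equiv finSumFinEquiv.symm N).trans ?_
  set Φ : (Fin k ⊕ Fin s → ℤ) → Fin k → ℤ := fun x => ∑ i, momentCurve k (x i)
  set Box := Fintype.piFinset fun _ : Fin k ⊕ Fin s => Ico (0 : ℤ) N with hBox
  let G : Equiv.Perm (Fin k ⊕ Fin s) → Finset (Fin k ⊕ Fin s → ℤ) := fun σ =>
    {x ∈ Box | ∀ i j, x (σ (Sum.inl i)) % p = x (σ (Sum.inl j)) % p → i = j}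
  let C : Finset ((Fin k → ℤ) × (Fin k ⊕ Fin s → Fin k)) :=
    (Fintype.piFinset fun _ : Fin k => Ico (0 : ℤ) p) ×ˢ univ
  let D : (Fin k → ℤ) × (Fin k ⊕ Fin s → Fin k) → Finset (Fin k ⊕ Fin s → ℤ) := fun c =>
    Fintype.piFinset fun i => residueClass N p (c.1 (c.2 i))
  have hG : ∀ σ, energy (G σ) Φ ≤ p ^ (2 * s) * (N ^ k * (k ^ k * p ^ (k * (k - 1) / 2)) *
        vinogradovCount (Fin s) k (N / p + 1)) := by
    intro σ
    refine le_trans ?_ (energy_distinct_le hs hp hkp hN)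
    refine le_trans (energy_le_of_bij (T := {x ∈ Box | ∀ i j, x (Sum.inl i) % (p : ℤ) =
      x (Sum.inl j) % (p : ℤ) → i = j}) (Ψ := Φ) (fun x => x ∘ σ) ?_ ?_ ?_)
      (energy_sum_le_prod _ (distinctTuples k N p) (Ico (0 : ℤ) N) ?_ ?_)
    · intro x hx
      simp only [G, Box, mem_filter, Fintype.mem_piFinset] at hx ⊢
      exact ⟨fun i => hx.1 _, hx.2⟩
    · intro x _ y _ h
      exact σ.surjective.injective_comp_right h
    · intro x _ y _ h
      simp only [Φ, Function.comp_apply]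
      rw [Equiv.sum_comp σ fun i => momentCurve k (x i),
        Equiv.sum_comp σ fun i => momentCurve k (y i)]
      exact h
    · intro x hx
      simp only [Box, distinctTuples, mem_filter, Fintype.mem_piFinset] at hx ⊢
      exact ⟨fun i => hx.1 _, hx.2⟩
    · intro x hx i
      simp only [Box, mem_filter, Fintype.mem_piFinset] at hx
      exact hx.1 _
  have hD : ∀ c ∈ C, energy (D c) Φ ≤ (k + s) * ((N / p + 1) ^ (2 * k) *
        vinogradovCount (Fin s) k (N / p + 1)) := by
    intro c _
    refine (energy_piFinset_le _ _).trans ((sum_le_sum fun i _ =>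
      (energy_residueClass_le hp.pos _).trans (vinogradovCount_sum_le _ _)).trans (le_of_eq ?_))
    simp
  have hcover : ∀ x ∈ Box, ∃ b ∈ (univ : Finset Bool),
      x ∈ cond b (univ.biUnion G) (C.biUnion D) := by
    intro x hx
    rcases exists_perm_or_cover hp.pos Sum.inl (Sum.inl_injective (β := Fin s)) x with
      ⟨σ, hσ⟩ | ⟨c, hc, τ, hτ⟩
    · refine ⟨true, mem_univ _, mem_biUnion.2 ⟨σ, mem_univ _, mem_filter.2 ⟨hx, hσ⟩⟩⟩
    · refine ⟨false, mem_univ _, mem_biUnion.2 ⟨(c, τ), ?_, ?_⟩⟩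
      · simp only [C, mem_product, Fintype.mem_piFinset, mem_univ, and_true]
        exact hc
      · simp only [D, Fintype.mem_piFinset, residueClass, mem_filter]
        rw [Fintype.mem_piFinset] at hx
        exact fun i => ⟨hx i, hτ i⟩
  refine (energy_cover _ _ _ Φ hcover).trans ?_
  simp only [card_univ, Fintype.card_bool, Fintype.sum_bool, cond_true, cond_false]
  refine Nat.mul_le_mul_left _ (Nat.add_le_add ?_ ?_)
  · refine (energy_cover univ _ G Φ fun x hx => by simpa using hx).trans ?_
    refine (Nat.mul_le_mul_left _ (sum_le_sum fun σ _ => hG σ)).trans (le_of_eq ?_)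
    simp only [sum_const, card_univ, Fintype.card_perm, Fintype.card_sum, Fintype.card_fin,
      smul_eq_mul]
    ring
  · refine (energy_cover C _ D Φ fun x hx => by simpa using hx).trans ?_
    refine (Nat.mul_le_mul_left _ (sum_le_sum hD)).trans (le_of_eq ?_)
    have hC : #C = p ^ k * k ^ (k + s) := by
      simp [C, card_product]
    rw [sum_const, hC, smul_eq_mul]
    ring

end

section

variable {k s : ℕ}

lemma vinogradovCount_le_pow (s k N : ℕ) : vinogradovCount (Fin s) k N ≤ N ^ (2 * s) := by
  refine (card_filter_le _ _).trans (le_of_eq ?_)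
  rw [card_product, Fintype.card_piFinset, prod_const, card_Ico_zero_int]
  simp [two_mul, pow_add]

lemma exists_prime_near_root {N : ℕ} (hk : 0 < k) (hN : k ^ k ≤ N) :
    ∃ p : ℕ, p.Prime ∧ k < p ∧ N ≤ p ^ k ∧ (N : ℝ) ^ ((1 : ℝ) / k) ≤ p ∧
      (p : ℝ) ≤ 4 * (N : ℝ) ^ ((1 : ℝ) / k) := by
  set x : ℝ := (N : ℝ) ^ ((1 : ℝ) / k) with hx
  have hk' : (0 : ℝ) < k := by exact_mod_cast hk
  have hxk : x ^ k = N := by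
    rw [hx, ← Real.rpow_natCast, ← Real.rpow_mul (by positivity), one_div,
      inv_mul_cancel₀ hk'.ne', Real.rpow_one]
  have hx0 : 0 ≤ x := by positivity
  have hkx : (k : ℝ) ≤ x := by
    have : (k : ℝ) ^ k ≤ x ^ k := by rw [hxk]; exact_mod_cast hN
    exact le_of_pow_le_pow_left₀ hk.ne' hx0 this
  have hx1 : 1 ≤ x := le_trans (by exact_mod_cast hk) hkx
  obtain ⟨p, hp, h1, h2⟩ := Nat.exists_prime_lt_and_le_two_mul ⌈x⌉₊
    (Nat.ceil_pos.2 (by linarith)).ne'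
  have h3 : x ≤ ⌈x⌉₊ := Nat.le_ceil x
  have h4 : (⌈x⌉₊ : ℝ) < x + 1 := Nat.ceil_lt_add_one hx0
  have h5 : (⌈x⌉₊ : ℝ) < p := by exact_mod_cast h1
  have h6 : (p : ℝ) ≤ 2 * ⌈x⌉₊ := by exact_mod_cast h2
  refine ⟨p, hp, ?_, ?_, by linarith, by linarith⟩
  · have : (k : ℝ) < p := by linarith
    exact_mod_cast this
  · have : (N : ℝ) ≤ (p : ℝ) ^ k := by
      rw [← hxk]
      exact pow_le_pow_left₀ hx0 (by linarith) k
    exact_mod_cast this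

lemma cast_triangle (k : ℕ) : ((k * (k - 1) / 2 : ℕ) : ℝ) = k * (k - 1) / 2 := by
  rw [← Nat.choose_two_right, Nat.cast_choose_two]

lemma vinogradovCount_constant_le (hk : 2 ≤ k) (hs : s + k ≤ 11 * k ^ 2) :
    2 * ((k + s).factorial ^ 2 * 4 ^ (2 * s) * k ^ k * 4 ^ (k * (k - 1) / 2) * 2 ^ (2 * s)) +
      2 * ((4 ^ k * k ^ (k + s)) ^ 2 * (k + s) * 2 ^ (2 * k + 2 * s)) ≤ k ^ (203 * k ^ 2) := by
  have hk1 : 1 ≤ k := by omega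
  have hkk : k ≤ k ^ 2 := by nlinarith
  have hk2 : 1 ≤ k ^ 2 := Nat.one_le_pow _ _ hk1
  have h4 : ∀ n, 4 ^ n ≤ k ^ (2 * n) := fun n => by
    rw [pow_mul]; exact Nat.pow_le_pow_left (by nlinarith) n
  have h2 : ∀ n, 2 ^ n ≤ k ^ n := fun n => Nat.pow_le_pow_left hk n
  have h11 : k + s ≤ k ^ 6 := by
    have : 2 ^ 4 ≤ k ^ 4 := h2 4
    calc k + s ≤ 11 * k ^ 2 := by omega
      _ ≤ k ^ 4 * k ^ 2 := Nat.mul_le_mul_right _ (by omega)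
      _ = k ^ 6 := by ring
  have hf : (k + s).factorial ^ 2 ≤ k ^ (132 * k ^ 2) := by
    calc (k + s).factorial ^ 2 ≤ ((k ^ 6) ^ (k + s)) ^ 2 :=
          Nat.pow_le_pow_left ((Nat.factorial_le_pow _).trans (Nat.pow_le_pow_left h11 _)) 2
      _ = k ^ (6 * (k + s) * 2) := by rw [← pow_mul, ← pow_mul, mul_assoc]
      _ ≤ _ := Nat.pow_le_pow_right hk1 (by omega)
  have htri : k * (k - 1) / 2 ≤ k ^ 2 := by
    refine (Nat.div_le_self _ _).trans ?_
    rw [pow_two]; exact Nat.mul_le_mul_left _ (by omega)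
  have hA : 2 * ((k + s).factorial ^ 2 * 4 ^ (2 * s) * k ^ k * 4 ^ (k * (k - 1) / 2) *
      2 ^ (2 * s)) ≤ k ^ (202 * k ^ 2) := by
    calc _ ≤ k ^ 1 * (k ^ (132 * k ^ 2) * k ^ (2 * (2 * s)) * k ^ k *
          k ^ (2 * (k * (k - 1) / 2)) * k ^ (2 * s)) :=
          Nat.mul_le_mul (by simpa using hk) (Nat.mul_le_mul (Nat.mul_le_mul (Nat.mul_le_mul
            (Nat.mul_le_mul hf (h4 _)) le_rfl) (h4 _)) (h2 _))
      _ = k ^ (1 + (132 * k ^ 2 + 2 * (2 * s) + k + 2 * (k * (k - 1) / 2) + 2 * s)) := by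
          simp only [pow_add]
      _ ≤ _ := Nat.pow_le_pow_right hk1 (by omega)
  have hB : 2 * ((4 ^ k * k ^ (k + s)) ^ 2 * (k + s) * 2 ^ (2 * k + 2 * s)) ≤
      k ^ (202 * k ^ 2) := by
    calc _ ≤ k ^ 1 * ((k ^ (2 * k) * k ^ (k + s)) ^ 2 * k ^ 6 * k ^ (2 * k + 2 * s)) :=
          Nat.mul_le_mul (by simpa using hk) (Nat.mul_le_mul (Nat.mul_le_mul (Nat.pow_le_pow_left
            (Nat.mul_le_mul_right _ (h4 _)) 2) h11) (h2 _))
      _ = k ^ (1 + ((2 * k + (k + s)) * 2 + 6 + (2 * k + 2 * s))) := by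
          rw [← pow_add, ← pow_mul]
          simp only [pow_add]
      _ ≤ _ := Nat.pow_le_pow_right hk1 (by omega)
  calc _ ≤ k ^ (202 * k ^ 2) + k ^ (202 * k ^ 2) := Nat.add_le_add hA hB
    _ = 2 * k ^ (202 * k ^ 2) := by ring
    _ ≤ k ^ (k ^ 2) * k ^ (202 * k ^ 2) :=
      Nat.mul_le_mul_right _ (hk.trans (Nat.le_self_pow (by omega) k))
    _ = _ := by rw [← pow_add]; congr 1; ring

lemma vinogradovCount_step (hk : 2 ≤ k) (hs : k ^ 2 ≤ s) (hs' : s + k ≤ 11 * k ^ 2)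
    {η D : ℝ} (hη0 : 0 ≤ η) (hη : η ≤ k * (k + 1) / 2) (hD : 0 ≤ D)
    (ih : ∀ N : ℕ, 1 ≤ N → (vinogradovCount (Fin s) k N : ℝ) ≤ D * (N : ℝ) ^ (2 * (s : ℝ) - η))
    {N : ℕ} (hN : k ^ k ≤ N) :
    (vinogradovCount (Fin (k + s)) k N : ℝ) ≤ (k : ℝ) ^ (203 * k ^ 2) * D *
      (N : ℝ) ^ (2 * ((s : ℝ) + k) - (η * (1 - 1 / k) + (k + 1) / 2)) := by
  obtain ⟨p, hp, hkp, hNp, hxp, hpx⟩ := exists_prime_near_root (by omega) hN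
  have hrec := vinogradovCount_recursion (s := s) (by omega) (by nlinarith) hp hkp hNp
  set x : ℝ := (N : ℝ) ^ ((1 : ℝ) / k) with hx
  set J := vinogradovCount (Fin s) k (N / p + 1)
  have hk' : (2 : ℝ) ≤ k := by exact_mod_cast hk
  have hN1 : 1 ≤ N := le_trans (Nat.one_le_pow _ _ (by omega)) hN
  have hN1' : (1 : ℝ) ≤ N := by exact_mod_cast hN1
  have hx1 : 1 ≤ x := Real.one_le_rpow hN1' (by positivity)
  have hx0 : 0 < x := by linarith
  have hNx : (N : ℝ) = x ^ (k : ℝ) := by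
    rw [hx, ← Real.rpow_mul (by positivity), one_div, inv_mul_cancel₀ (by positivity),
      Real.rpow_one]
  have hs2 : (k : ℝ) ^ 2 ≤ s := by exact_mod_cast hs
  have hη2 : 0 ≤ 2 * (s : ℝ) - η := by nlinarith
  set y : ℝ := x ^ ((k : ℝ) - 1) with hy
  have hy1 : 1 ≤ y := Real.one_le_rpow hx1 (by linarith)
  have hN' : ((N / p + 1 : ℕ) : ℝ) ≤ 2 * y := by
    have h1 : ((N / p : ℕ) : ℝ) ≤ (N : ℝ) / p := Nat.cast_div_le
    have h2 : (N : ℝ) / p ≤ N / x := by gcongr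
    have h3 : (N : ℝ) / x = y := by
      rw [hNx, hy, Real.rpow_sub hx0, Real.rpow_one]
    push_cast
    linarith
  have hJ : (J : ℝ) ≤ D * (2 ^ (2 * s) * y ^ (2 * (s : ℝ) - η)) := by
    refine (ih _ (Nat.le_add_left _ _)).trans (mul_le_mul_of_nonneg_left ?_ hD)
    calc ((N / p + 1 : ℕ) : ℝ) ^ (2 * (s : ℝ) - η) ≤ (2 * y) ^ (2 * (s : ℝ) - η) :=
          Real.rpow_le_rpow (by positivity) hN' hη2
      _ = 2 ^ (2 * (s : ℝ) - η) * y ^ (2 * (s : ℝ) - η) :=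
          Real.mul_rpow (by norm_num) (by positivity)
      _ ≤ 2 ^ ((2 * s : ℕ) : ℝ) * y ^ (2 * (s : ℝ) - η) := by
          gcongr
          · norm_num
          · push_cast; linarith
      _ = _ := by rw [Real.rpow_natCast]
  have hyx : ∀ a : ℝ, y ^ a = x ^ (((k : ℝ) - 1) * a) := fun a => by
    rw [hy, ← Real.rpow_mul hx0.le]
  have hxn : ∀ a : ℕ, x ^ a = x ^ (a : ℝ) := fun a => (Real.rpow_natCast x a).symm
  set T : ℝ := (N : ℝ) ^ (2 * ((s : ℝ) + k) - (η * (1 - 1 / k) + (k + 1) / 2)) with hT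
  have hTx : T = x ^ ((k : ℝ) * (2 * ((s : ℝ) + k) - (η * (1 - 1 / k) + (k + 1) / 2))) := by
    rw [hT, hNx, ← Real.rpow_mul hx0.le]
  have hfirst : (p : ℝ) ^ (2 * s) * ((N : ℝ) ^ k * ((k : ℝ) ^ k * (p : ℝ) ^ (k * (k - 1) / 2)) *
      J) ≤ 4 ^ (2 * s) * k ^ k * 4 ^ (k * (k - 1) / 2) * 2 ^ (2 * s) * (D * T) := by
    calc _ ≤ (4 * x) ^ (2 * s) * ((x ^ (k : ℝ)) ^ k * ((k : ℝ) ^ k *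
          (4 * x) ^ (k * (k - 1) / 2)) * (D * (2 ^ (2 * s) * y ^ (2 * (s : ℝ) - η)))) := by
          rw [hNx]; gcongr
      _ = 4 ^ (2 * s) * k ^ k * 4 ^ (k * (k - 1) / 2) * 2 ^ (2 * s) * (D *
          (x ^ (2 * s) * (x ^ (k : ℝ)) ^ k * x ^ (k * (k - 1) / 2) * y ^ (2 * (s : ℝ) - η))) := by
          rw [mul_pow, mul_pow]; ring
      _ = _ := by
          congr 2
          rw [hTx, hyx, ← Real.rpow_natCast (x ^ (k : ℝ)) k, ← Real.rpow_mul hx0.le, hxn, hxn,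
            ← Real.rpow_add hx0, ← Real.rpow_add hx0, ← Real.rpow_add hx0, cast_triangle]
          congr 1
          push_cast
          field_simp
          ring
  have hsecond : ((p : ℝ) ^ k * (k : ℝ) ^ (k + s)) ^ 2 * (((k : ℝ) + s) *
      (((N / p + 1 : ℕ) : ℝ) ^ (2 * k) * J)) ≤
      (4 ^ k * k ^ (k + s)) ^ 2 * (k + s) * 2 ^ (2 * k + 2 * s) * (D * T) := by
    calc _ ≤ ((4 * x) ^ k * (k : ℝ) ^ (k + s)) ^ 2 * (((k : ℝ) + s) *
          ((2 * y) ^ (2 * k) * (D * (2 ^ (2 * s) * y ^ (2 * (s : ℝ) - η))))) := by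
          gcongr
      _ = (4 ^ k * k ^ (k + s)) ^ 2 * (k + s) * 2 ^ (2 * k + 2 * s) * (D *
          (x ^ (2 * k) * y ^ (2 * k) * y ^ (2 * (s : ℝ) - η))) := by
          rw [mul_pow, mul_pow]; ring
      _ ≤ _ := by
          gcongr
          rw [hTx, ← Real.rpow_natCast y, hyx, hyx, hxn, ← Real.rpow_add hx0,
            ← Real.rpow_add hx0]
          apply Real.rpow_le_rpow_of_exponent_le hx1
          have : (k : ℝ) * (2 * ((s : ℝ) + k) - (η * (1 - 1 / k) + (k + 1) / 2)) =
              2 * k * (s + k) - (η * (k - 1) + k * (k + 1) / 2) := by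
            field_simp
          rw [this]
          push_cast
          nlinarith
  have hcon : 2 * (((k + s).factorial : ℝ) ^ 2 * 4 ^ (2 * s) * (k : ℝ) ^ k *
      4 ^ (k * (k - 1) / 2) * 2 ^ (2 * s)) +
      2 * ((4 ^ k * (k : ℝ) ^ (k + s)) ^ 2 * (k + s) * 2 ^ (2 * k + 2 * s)) ≤
      (k : ℝ) ^ (203 * k ^ 2) := by
    exact_mod_cast vinogradovCount_constant_le hk hs'
  have hrec' : (vinogradovCount (Fin (k + s)) k N : ℝ) ≤ 2 * (((k + s).factorial : ℝ) ^ 2 *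
      ((p : ℝ) ^ (2 * s) * ((N : ℝ) ^ k * ((k : ℝ) ^ k * (p : ℝ) ^ (k * (k - 1) / 2)) * J)) +
      ((p : ℝ) ^ k * (k : ℝ) ^ (k + s)) ^ 2 * (((k : ℝ) + s) *
      (((N / p + 1 : ℕ) : ℝ) ^ (2 * k) * J))) := by
    exact_mod_cast hrec
  have hT0 : 0 ≤ T := by positivity
  calc _ ≤ _ := hrec'
    _ ≤ 2 * (((k + s).factorial : ℝ) ^ 2 * (4 ^ (2 * s) * k ^ k * 4 ^ (k * (k - 1) / 2) *
        2 ^ (2 * s) * (D * T)) + (4 ^ k * k ^ (k + s)) ^ 2 * (k + s) * 2 ^ (2 * k + 2 * s) *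
        (D * T)) := by
        gcongr
    _ = (2 * (((k + s).factorial : ℝ) ^ 2 * 4 ^ (2 * s) * (k : ℝ) ^ k *
      4 ^ (k * (k - 1) / 2) * 2 ^ (2 * s)) +
      2 * ((4 ^ k * (k : ℝ) ^ (k + s)) ^ 2 * (k + s) * 2 ^ (2 * k + 2 * s))) * (D * T) := by
        ring
    _ ≤ (k : ℝ) ^ (203 * k ^ 2) * (D * T) := by gcongr
    _ = _ := by ring

lemma vinogradovCount_iterate (hk : 2 ≤ k) (l : ℕ) (hl : l ≤ 10 * k) {N : ℕ} (hN : 1 ≤ N) :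
    (vinogradovCount (Fin (k ^ 2 + k * l)) k N : ℝ) ≤ (k : ℝ) ^ (k ^ 3 + 203 * k ^ 2 * l) *
      (N : ℝ) ^ (2 * ((k ^ 2 + k * l : ℕ) : ℝ) -
        (k : ℝ) * (k + 1) / 2 * (1 - (1 - 1 / (k : ℝ)) ^ l)) := by
  have hk' : (2 : ℝ) ≤ k := by exact_mod_cast hk
  have hb0 : 0 ≤ 1 - 1 / (k : ℝ) := by
    rw [sub_nonneg, div_le_one (by positivity)]; linarith
  have hb1 : 1 - 1 / (k : ℝ) ≤ 1 := by
    have : 0 ≤ 1 / (k : ℝ) := by positivity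
    linarith
  have hη0 : ∀ l, 0 ≤ (k : ℝ) * (k + 1) / 2 * (1 - (1 - 1 / (k : ℝ)) ^ l) := fun l =>
    mul_nonneg (by positivity) (sub_nonneg.2 (pow_le_one₀ hb0 hb1))
  have hη1 : ∀ l, (k : ℝ) * (k + 1) / 2 * (1 - (1 - 1 / (k : ℝ)) ^ l) ≤ k * (k + 1) / 2 :=
    fun l => mul_le_of_le_one_right (by positivity) (by linarith [pow_nonneg hb0 l])
  induction l generalizing N with
  | zero =>
    have h1 : (vinogradovCount (Fin (k ^ 2 + k * 0)) k N : ℝ) ≤ (N : ℝ) ^ (2 * (k ^ 2)) := by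
      exact_mod_cast vinogradovCount_le_pow (k ^ 2) k N
    refine h1.trans ?_
    have h2 : (1 : ℝ) ≤ (k : ℝ) ^ (k ^ 3 + 203 * k ^ 2 * 0) := one_le_pow₀ (by linarith)
    have h3 : (N : ℝ) ^ (2 * k ^ 2) = (N : ℝ) ^ (2 * ((k ^ 2 + k * 0 : ℕ) : ℝ) -
        (k : ℝ) * (k + 1) / 2 * (1 - (1 - 1 / (k : ℝ)) ^ 0)) := by
      rw [← Real.rpow_natCast]
      congr 1
      push_cast
      ring
    rw [h3]
    exact le_mul_of_one_le_left (by positivity) h2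
  | succ l ih =>
    have ih' := fun N hN => @ih (by omega) N hN
    rcases le_total (k ^ k) N with hkN | hkN
    · have h1 := vinogradovCount_step hk (s := k ^ 2 + k * l) (Nat.le_add_right _ _)
        (by nlinarith) (hη0 l) (hη1 l) (by positivity) ih' hkN
      have e : k ^ 2 + k * (l + 1) = k + (k ^ 2 + k * l) := by ring
      rw [e]
      refine h1.trans (le_of_eq ?_)
      rw [← pow_add]
      congr 2
      · ring
      · have hq : (k : ℝ) * (1 - (1 - 1 / (k : ℝ))) = 1 := by field_simp; ring
        push_cast
        rw [pow_succ]
        linear_combination ((k : ℝ) + 1) / 2 * hq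
    · have h1 : (vinogradovCount (Fin (k ^ 2 + k * (l + 1))) k N : ℝ) ≤
          (N : ℝ) ^ (2 * (k ^ 2 + k * (l + 1))) := by
        exact_mod_cast vinogradovCount_le_pow (k ^ 2 + k * (l + 1)) k N
      refine h1.trans ?_
      set η := (k : ℝ) * (k + 1) / 2 * (1 - (1 - 1 / (k : ℝ)) ^ (l + 1)) with hη
      have hN' : (1 : ℝ) ≤ N := by exact_mod_cast hN
      have h2 : (N : ℝ) ^ (2 * (k ^ 2 + k * (l + 1))) = (N : ℝ) ^ η *
          (N : ℝ) ^ (2 * ((k ^ 2 + k * (l + 1) : ℕ) : ℝ) - η) := by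
        rw [← Real.rpow_natCast, ← Real.rpow_add (by linarith)]
        congr 1
        push_cast
        ring
      rw [h2]
      gcongr
      calc (N : ℝ) ^ η ≤ (N : ℝ) ^ ((k ^ 2 : ℕ) : ℝ) := by
            apply Real.rpow_le_rpow_of_exponent_le hN'
            refine (hη1 _).trans ?_
            push_cast
            nlinarith
        _ = (N : ℝ) ^ (k ^ 2) := by rw [Real.rpow_natCast]
        _ ≤ ((k : ℝ) ^ k) ^ (k ^ 2) := by
            gcongr
            exact_mod_cast hkN
        _ = (k : ℝ) ^ (k ^ 3) := by rw [← pow_mul]; congr 1; ring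
        _ ≤ _ := pow_le_pow_right₀ (by linarith) (by omega)

/-- A form of Vinogradov's mean value theorem. -/
theorem vinogradovCount_le (hk : 2 ≤ k) {N : ℕ} (hN : 1 ≤ N) :
    (vinogradovCount (Fin (11 * k ^ 2)) k N : ℝ) ≤ (k : ℝ) ^ (2031 * k ^ 3) *
      (N : ℝ) ^ (22 * (k : ℝ) ^ 2 - 999 / 1000 * ((k : ℝ) * (k + 1) / 2)) := by
  have h := vinogradovCount_iterate hk (10 * k) le_rfl hN
  have hk' : (2 : ℝ) ≤ k := by exact_mod_cast hk
  have e : k ^ 2 + k * (10 * k) = 11 * k ^ 2 := by ring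
  rw [e] at h
  refine h.trans ?_
  have hN' : (1 : ℝ) ≤ N := by exact_mod_cast hN
  have hsmall : (1 - 1 / (k : ℝ)) ^ (10 * k) ≤ 1 / 1000 := by
    have h1 : 1 - 1 / (k : ℝ) ≤ Real.exp (-(1 / (k : ℝ))) := by
      linarith [Real.add_one_le_exp (-(1 / (k : ℝ)))]
    have h0 : 0 ≤ 1 - 1 / (k : ℝ) := by
      rw [sub_nonneg, div_le_one (by positivity)]; linarith
    calc (1 - 1 / (k : ℝ)) ^ (10 * k) ≤ Real.exp (-(1 / (k : ℝ))) ^ (10 * k) :=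
          pow_le_pow_left₀ h0 h1 _
      _ = Real.exp (-10) := by
          rw [← Real.exp_nat_mul]
          congr 1
          push_cast
          field_simp
      _ = (Real.exp 1 ^ 10)⁻¹ := by rw [Real.exp_neg, ← Real.exp_nat_mul]; norm_num
      _ ≤ (2 ^ 10 : ℝ)⁻¹ := by
          gcongr
          linarith [Real.add_one_le_exp 1]
      _ ≤ 1 / 1000 := by norm_num
  refine mul_le_mul (pow_le_pow_right₀ (by linarith) ?_)
    (Real.rpow_le_rpow_of_exponent_le hN' ?_) (by positivity) (by positivity)
  · exact le_of_eq (by ring)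
  · push_cast
    nlinarith [mul_nonneg (show (0:ℝ) ≤ k * (k + 1) / 2 by positivity) (sub_nonneg.2 hsmall)]

end

/-! ### Bilinear exponential sums -/

/-- The additive character `x ↦ exp (2 π i x)` of the real line. -/
noncomputable def unitExp (x : ℝ) : ℂ := Complex.exp ((2 * Real.pi * x : ℝ) * Complex.I)

lemma unitExp_add (x y : ℝ) : unitExp (x + y) = unitExp x * unitExp y := by
  rw [unitExp, unitExp, unitExp, ← Complex.exp_add]
  congr 1
  push_cast
  ring

@[simp] lemma unitExp_zero : unitExp 0 = 1 := by simp [unitExp]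

@[simp] lemma norm_unitExp (x : ℝ) : ‖unitExp x‖ = 1 := Complex.norm_exp_ofReal_mul_I _

lemma unitExp_sum {ι : Type*} (s : Finset ι) (f : ι → ℝ) :
    unitExp (∑ i ∈ s, f i) = ∏ i ∈ s, unitExp (f i) := by
  classical
  induction s using Finset.induction_on with
  | empty => simp
  | insert a s ha ih => rw [sum_insert ha, prod_insert ha, unitExp_add, ih]

lemma conj_unitExp (x : ℝ) : (starRingEnd ℂ) (unitExp x) = unitExp (-x) := by
  rw [unitExp, unitExp, ← Complex.exp_conj]
  congr 1
  rw [map_mul, Complex.conj_ofReal, Complex.conj_I]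
  push_cast
  ring

lemma unitExp_sub (x y : ℝ) : unitExp (x - y) = unitExp x * (starRingEnd ℂ) (unitExp y) := by
  rw [conj_unitExp, ← unitExp_add, sub_eq_add_neg]

lemma norm_unitExp_sub_one (x : ℝ) : ‖unitExp x - 1‖ = 2 * |Real.sin (Real.pi * x)| := by
  have := Complex.norm_exp_I_mul_ofReal_sub_one (2 * Real.pi * x)
  rw [unitExp, mul_comm, this, norm_mul, Real.norm_eq_abs, Real.norm_eq_abs,
    abs_of_pos (by norm_num : (0:ℝ) < 2)]
  congr 3
  ring

lemma norm_unitExp_sub_unitExp_le (x y : ℝ) :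
    ‖unitExp x - unitExp y‖ ≤ 2 * Real.pi * |x - y| := by
  have h : unitExp x - unitExp y = unitExp y * (unitExp (x - y) - 1) := by
    rw [mul_sub, mul_one, ← unitExp_add, add_sub_cancel]
  rw [h, norm_mul, norm_unitExp, one_mul, norm_unitExp_sub_one, mul_assoc]
  gcongr
  refine (Real.abs_sin_le_abs).trans (le_of_eq ?_)
  rw [abs_mul, abs_of_pos Real.pi_pos]

lemma four_mul_abs_le_norm_unitExp_sub_one {x : ℝ} (hx : |x| ≤ 1 / 2) :
    4 * |x| ≤ ‖unitExp x - 1‖ := by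
  have hpi := Real.pi_pos
  have h := Real.mul_abs_le_abs_sin (x := Real.pi * x) (by
    rw [abs_mul, abs_of_pos hpi]; nlinarith)
  rw [norm_unitExp_sub_one]
  rw [abs_mul, abs_of_pos hpi] at h
  have : 2 / Real.pi * (Real.pi * |x|) = 2 * |x| := by field_simp
  linarith

section

variable {k s : ℕ}

lemma norm_unitExp_sum_pow {X : Type*} (U : Finset X) (φ : X → Fin k → ℤ)
    (L : (Fin k → ℤ) →+ ℝ) (s : ℕ) :
    ((‖∑ x ∈ U, unitExp (L (φ x))‖ ^ (2 * s) : ℝ) : ℂ) =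
      ∑ z ∈ (Fintype.piFinset fun _ : Fin s => U) ×ˢ (Fintype.piFinset fun _ : Fin s => U),
        unitExp (L (∑ i, φ (z.1 i) - ∑ i, φ (z.2 i))) := by
  classical
  have hS : (∑ x ∈ U, unitExp (L (φ x))) ^ s =
      ∑ z ∈ Fintype.piFinset fun _ : Fin s => U, unitExp (L (∑ i, φ (z i))) := by
    have := prod_univ_sum (fun _ : Fin s => U) (fun _ x => unitExp (L (φ x)))
    rw [prod_const, card_univ, Fintype.card_fin] at this
    rw [this]
    refine sum_congr rfl fun z _ => ?_
    rw [map_sum, unitExp_sum]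
  rw [pow_mul, Complex.ofReal_pow, Complex.ofReal_pow, ← Complex.mul_conj', mul_pow, ← map_pow, hS,
    map_sum, sum_mul_sum, sum_product]
  refine sum_congr rfl fun z _ => sum_congr rfl fun w _ => ?_
  rw [map_sub, unitExp_sub]

/-- The bilinear form with diagonal coefficients `c`. -/
noncomputable def diagForm (c : Fin k → ℝ) (a : Fin k → ℤ) : (Fin k → ℤ) →+ ℝ where
  toFun n := ∑ i, c i * a i * n i
  map_zero' := by simp
  map_add' x y := by simp [mul_add, sum_add_distrib]

lemma diagForm_apply (c : Fin k → ℝ) (a n : Fin k → ℤ) :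
    diagForm c a n = ∑ i, c i * a i * n i := rfl

lemma diagForm_comm (c : Fin k → ℝ) (a n : Fin k → ℤ) : diagForm c a n = diagForm c n a := by
  simp only [diagForm_apply]
  exact sum_congr rfl fun i _ => by ring

/-- The box containing all values of the Vinogradov system with `s` variables on each side. -/
noncomputable def momentBox (k s Y : ℕ) : Finset (Fin k → ℤ) :=
  Fintype.piFinset fun i => Icc (-(s * Y ^ (i.1 + 1) : ℤ)) (s * Y ^ (i.1 + 1))

lemma sub_mem_momentBox {Y : ℕ} {x y : Fin s → ℤ}
    (hx : x ∈ Fintype.piFinset fun _ : Fin s => Ico (0 : ℤ) Y)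
    (hy : y ∈ Fintype.piFinset fun _ : Fin s => Ico (0 : ℤ) Y) :
    ∑ i, momentCurve k (x i) - ∑ i, momentCurve k (y i) ∈ momentBox k s Y := by
  have key : ∀ x ∈ (Fintype.piFinset fun _ : Fin s => Ico (0 : ℤ) Y), ∀ j : Fin k,
      0 ≤ (∑ i, momentCurve k (x i)) j ∧ (∑ i, momentCurve k (x i)) j ≤ s * Y ^ (j.1 + 1) := by
    intro x hx j
    simp only [Fintype.mem_piFinset, mem_Ico] at hx
    rw [Finset.sum_apply]
    refine ⟨sum_nonneg fun i _ => pow_nonneg (hx i).1 _, ?_⟩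
    calc ∑ i, momentCurve k (x i) j ≤ ∑ _i : Fin s, (Y : ℤ) ^ (j.1 + 1) :=
          sum_le_sum fun i _ => pow_le_pow_left₀ (hx i).1 (hx i).2.le _
      _ = _ := by simp
  rw [momentBox, Fintype.mem_piFinset]
  intro j
  have h1 := key x hx j
  have h2 := key y hy j
  rw [mem_Icc, Pi.sub_apply]
  constructor <;> linarith

lemma sum_moment_diff_le (Y : ℕ) (F : (Fin k → ℤ) → ℝ) (hF : ∀ n, 0 ≤ F n) :
    ∑ z ∈ (Fintype.piFinset fun _ : Fin s => Ico (0 : ℤ) Y) ×ˢ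
      (Fintype.piFinset fun _ : Fin s => Ico (0 : ℤ) Y),
        F (∑ i, momentCurve k (z.1 i) - ∑ i, momentCurve k (z.2 i)) ≤
      vinogradovCount (Fin s) k Y * ∑ n ∈ momentBox k s Y, F n := by
  classical
  rw [← sum_fiberwise_of_maps_to (t := momentBox k s Y)
    (g := fun z : (Fin s → ℤ) × (Fin s → ℤ) =>
      ∑ i, momentCurve k (z.1 i) - ∑ i, momentCurve k (z.2 i))
    (fun z hz => sub_mem_momentBox (mem_product.1 hz).1 (mem_product.1 hz).2), mul_sum]
  refine sum_le_sum fun n _ => ?_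
  rw [sum_congr rfl (g := fun _ => F n) (fun z hz => by rw [(mem_filter.1 hz).2]), sum_const,
    nsmul_eq_mul]
  refine mul_le_mul_of_nonneg_right ?_ (hF n)
  exact_mod_cast card_filter_sub_eq_le _ (fun x : Fin s → ℤ => ∑ i, momentCurve k (x i)) n

/-- The contribution of a single coordinate to the double large sieve bound. -/
noncomputable def linearPart (c : ℝ) (M : ℕ) : ℝ :=
  ∑ m ∈ Icc (-(M : ℤ)) M, ‖∑ n ∈ Icc (-(M : ℤ)) M, unitExp (c * m * n)‖

lemma sum_momentBox_norm (c : Fin k → ℝ) (s Y : ℕ) :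
    ∑ m ∈ momentBox k s Y, ‖∑ n ∈ momentBox k s Y, unitExp (diagForm c m n)‖ =
      ∏ i : Fin k, linearPart (c i) (s * Y ^ (i.1 + 1)) := by
  simp only [linearPart]
  push_cast
  rw [prod_univ_sum]
  refine sum_congr rfl fun m _ => ?_
  rw [← norm_prod, prod_univ_sum]
  congr 1
  refine sum_congr rfl fun n _ => ?_
  rw [diagForm_apply, unitExp_sum]

lemma norm_bilinear_sum_pow_le (hs : 0 < s) (Y : ℕ) (c : Fin k → ℝ) :
    ‖∑ u ∈ Ico (0 : ℤ) Y, ∑ v ∈ Ico (0 : ℤ) Y,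
        unitExp (diagForm c (momentCurve k u) (momentCurve k v))‖ ^ (4 * s ^ 2) ≤
      (Y : ℝ) ^ (8 * s ^ 2 - 4 * s) * (vinogradovCount (Fin s) k Y : ℝ) ^ 2 *
        ∏ i : Fin k, linearPart (c i) (s * Y ^ (i.1 + 1)) := by
  set U := Ico (0 : ℤ) Y with hU
  have hUc : (#U : ℝ) = Y := by rw [hU, card_Ico_zero_int]
  set P := Fintype.piFinset fun _ : Fin s => U with hP
  have hPc : (#(P ×ˢ P) : ℝ) = (Y : ℝ) ^ (2 * s) := by
    rw [card_product, hP, Fintype.card_piFinset, prod_const, card_univ, Fintype.card_fin]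
    push_cast
    rw [hUc, two_mul, pow_add]
  let d : (Fin s → ℤ) × (Fin s → ℤ) → Fin k → ℤ := fun z =>
    ∑ i, momentCurve k (z.1 i) - ∑ i, momentCurve k (z.2 i)
  let h : (Fin k → ℤ) → ℂ := fun n => ∑ u ∈ U, unitExp (diagForm c n (momentCurve k u))
  set J : ℝ := (vinogradovCount (Fin s) k Y : ℝ)
  set G : ℝ := ∑ u ∈ U, ‖∑ v ∈ U, unitExp (diagForm c (momentCurve k u) (momentCurve k v))‖ ^
    (2 * s) with hG
  have hG0 : 0 ≤ G := sum_nonneg fun u _ => by positivity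
  have h1 : ‖∑ u ∈ U, ∑ v ∈ U, unitExp (diagForm c (momentCurve k u) (momentCurve k v))‖ ^
      (2 * s) ≤ (Y : ℝ) ^ (2 * s - 1) * G := by
    obtain ⟨n, hn⟩ : ∃ n, 2 * s = n + 1 := ⟨2 * s - 1, by omega⟩
    rw [hG, hn, Nat.add_sub_cancel, ← hUc]
    refine (pow_le_pow_left₀ (norm_nonneg _) (norm_sum_le _ _) _).trans ?_
    exact pow_sum_le_card_mul_sum_pow (fun _ _ => norm_nonneg _) n
  have h2 : G ≤ ∑ z ∈ P ×ˢ P, ‖h (d z)‖ := by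
    have : (G : ℂ) = ∑ z ∈ P ×ˢ P, h (d z) := by
      rw [hG, Complex.ofReal_sum]
      simp_rw [norm_unitExp_sum_pow]
      rw [sum_comm]
      refine sum_congr rfl fun z _ => sum_congr rfl fun u _ => ?_
      rw [diagForm_comm]
    rw [← Complex.norm_of_nonneg hG0, this]
    exact norm_sum_le _ _
  have h3 : (∑ z ∈ P ×ˢ P, ‖h (d z)‖) ^ (2 * s) ≤
      ((Y : ℝ) ^ (2 * s)) ^ (2 * s - 1) * ∑ z ∈ P ×ˢ P, ‖h (d z)‖ ^ (2 * s) := by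
    obtain ⟨n, hn⟩ : ∃ n, 2 * s = n + 1 := ⟨2 * s - 1, by omega⟩
    rw [← hPc, hn, Nat.add_sub_cancel]
    exact pow_sum_le_card_mul_sum_pow (fun _ _ => norm_nonneg _) n
  have h4 : ∑ z ∈ P ×ˢ P, ‖h (d z)‖ ^ (2 * s) ≤ J * ∑ n ∈ momentBox k s Y, ‖h n‖ ^ (2 * s) :=
    sum_moment_diff_le Y (fun n => ‖h n‖ ^ (2 * s)) fun n => by positivity
  have h5 : ∑ n ∈ momentBox k s Y, ‖h n‖ ^ (2 * s) ≤
      J * ∏ i : Fin k, linearPart (c i) (s * Y ^ (i.1 + 1)) := by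
    rw [← sum_momentBox_norm]
    refine le_trans ?_ (sum_moment_diff_le Y
      (fun m => ‖∑ n ∈ momentBox k s Y, unitExp (diagForm c m n)‖) fun n => norm_nonneg _)
    set H : ℝ := ∑ n ∈ momentBox k s Y, ‖h n‖ ^ (2 * s) with hH
    have hH0 : 0 ≤ H := sum_nonneg fun u _ => by positivity
    have : (H : ℂ) = ∑ z ∈ P ×ˢ P, ∑ n ∈ momentBox k s Y, unitExp (diagForm c (d z) n) := by
      rw [hH, Complex.ofReal_sum]
      simp only [h]
      simp_rw [norm_unitExp_sum_pow]
      rw [sum_comm]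
      refine sum_congr rfl fun z _ => sum_congr rfl fun u _ => ?_
      rw [diagForm_comm]
    rw [← Complex.norm_of_nonneg hH0, this]
    exact norm_sum_le _ _
  set W := ∏ i : Fin k, linearPart (c i) (s * Y ^ (i.1 + 1))
  have hexp : 4 * s ^ 2 = (2 * s) * (2 * s) := by ring
  have hJ0 : 0 ≤ J := by positivity
  calc _ = (‖∑ u ∈ U, ∑ v ∈ U, unitExp (diagForm c (momentCurve k u) (momentCurve k v))‖ ^
      (2 * s)) ^ (2 * s) := by rw [← pow_mul, hexp]
    _ ≤ ((Y : ℝ) ^ (2 * s - 1) * G) ^ (2 * s) := pow_le_pow_left₀ (by positivity) h1 _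
    _ = (Y : ℝ) ^ ((2 * s - 1) * (2 * s)) * G ^ (2 * s) := by rw [mul_pow, ← pow_mul]
    _ ≤ (Y : ℝ) ^ ((2 * s - 1) * (2 * s)) * (((Y : ℝ) ^ (2 * s)) ^ (2 * s - 1) *
        (J * (J * W))) := by
        refine mul_le_mul_of_nonneg_left ?_ (by positivity)
        refine ((pow_le_pow_left₀ hG0 h2 _).trans h3).trans ?_
        refine mul_le_mul_of_nonneg_left (h4.trans ?_) (by positivity)
        exact mul_le_mul_of_nonneg_left h5 hJ0
    _ = _ := by
        have : 8 * s ^ 2 - 4 * s = (2 * s - 1) * (2 * s) + 2 * s * (2 * s - 1) := by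
          obtain ⟨n, rfl⟩ : ∃ n, s = n + 1 := ⟨s - 1, by omega⟩
          have : 2 * (n + 1) - 1 = 2 * n + 1 := by omega
          rw [this]
          have : 8 * (n + 1) ^ 2 = (2 * n + 1) * (2 * (n + 1)) + 2 * (n + 1) * (2 * n + 1) +
            4 * (n + 1) := by ring
          omega
        rw [this, pow_add, pow_mul _ (2 * s) (2 * s - 1)]
        ring

end

lemma sum_Icc_int_eq_sum_range {A : Type*} [AddCommMonoid A] (f : ℤ → A) (M : ℕ) :
    ∑ n ∈ Icc (-(M : ℤ)) M, f n = ∑ n ∈ range (2 * M + 1), f (n - M) := by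
  symm
  refine sum_nbij' (fun n => (n : ℤ) - M) (fun n => (n + M).toNat) ?_ ?_ ?_ ?_ ?_
  · intro n hn
    rw [mem_range] at hn
    rw [mem_Icc]
    omega
  · intro n hn
    rw [mem_Icc] at hn
    rw [mem_range]
    omega
  · intro n _
    simp
  · intro n hn
    rw [mem_Icc] at hn
    omega
  · intro n _
    rfl

lemma norm_sum_range_unitExp_mul_le (θ β : ℝ) (N : ℕ) :
    ‖∑ n ∈ range N, unitExp (θ * n + β)‖ * ‖unitExp θ - 1‖ ≤ 2 := by
  have h : (∑ n ∈ range N, unitExp (θ * n + β)) * (unitExp θ - 1) =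
      unitExp (θ * N + β) - unitExp β := by
    rw [sum_mul]
    have : ∀ n : ℕ, unitExp (θ * n + β) * (unitExp θ - 1) =
        unitExp (θ * (n + 1 : ℕ) + β) - unitExp (θ * n + β) := fun n => by
      rw [mul_sub, mul_one, ← unitExp_add]
      congr 2
      push_cast
      ring
    rw [sum_congr rfl fun n _ => this n, sum_range_sub (fun n : ℕ => unitExp (θ * n + β))]
    simp
  rw [← norm_mul, h]
  refine (norm_sub_le _ _).trans ?_
  simp only [norm_unitExp]
  norm_num

lemma norm_sum_Icc_unitExp_le {θ : ℝ} (h0 : θ ≠ 0) (hθ : |θ| ≤ 1 / 2) (M : ℕ) :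
    ‖∑ n ∈ Icc (-(M : ℤ)) M, unitExp (θ * n)‖ ≤ 1 / (2 * |θ|) := by
  have h1 : ∑ n ∈ Icc (-(M : ℤ)) M, unitExp (θ * n) =
      ∑ n ∈ range (2 * M + 1), unitExp (θ * n + -(θ * M)) := by
    rw [sum_Icc_int_eq_sum_range (fun n : ℤ => unitExp (θ * n))]
    refine sum_congr rfl fun n _ => ?_
    congr 1
    push_cast
    ring
  rw [h1]
  have h2 := norm_sum_range_unitExp_mul_le θ (-(θ * M)) (2 * M + 1)
  have h3 := four_mul_abs_le_norm_unitExp_sub_one hθ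
  have h4 : 0 < |θ| := abs_pos.2 h0
  rw [le_div_iff₀ (by positivity)]
  nlinarith [norm_nonneg (∑ n ∈ range (2 * M + 1), unitExp (θ * n + -(θ * M)))]

lemma sum_Icc_int_le {F : ℤ → ℝ} {G : ℕ → ℝ} (M : ℕ)
    (h : ∀ m : ℤ, m.natAbs ≤ M → F m ≤ G m.natAbs) (hG : ∀ n, 0 ≤ G n) :
    ∑ m ∈ Icc (-(M : ℤ)) M, F m ≤ ∑ n ∈ range (M + 1), 2 * G n := by
  rw [← sum_fiberwise_of_maps_to (t := range (M + 1)) (g := Int.natAbs) (fun m hm => by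
    rw [mem_Icc] at hm
    rw [mem_range]
    omega)]
  refine sum_le_sum fun n _ => ?_
  have hsub : {m ∈ Icc (-(M : ℤ)) M | m.natAbs = n} ⊆ {(n : ℤ), -(n : ℤ)} := by
    intro m hm
    rw [mem_filter] at hm
    rw [mem_insert, mem_singleton]
    omega
  calc ∑ m ∈ Icc (-(M : ℤ)) M with m.natAbs = n, F m
      ≤ ∑ m ∈ Icc (-(M : ℤ)) M with m.natAbs = n, G n := by
        refine sum_le_sum fun m hm => ?_
        rw [mem_filter, mem_Icc] at hm
        rw [← hm.2]
        exact h m (by omega)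
    _ = #{m ∈ Icc (-(M : ℤ)) M | m.natAbs = n} * G n := by rw [sum_const, nsmul_eq_mul]
    _ ≤ 2 * G n := by
        refine mul_le_mul_of_nonneg_right ?_ (hG n)
        exact_mod_cast (card_le_card hsub).trans card_le_two

lemma sum_range_inv_le (M : ℕ) : ∑ n ∈ range M, (1 : ℝ) / (n + 1) ≤ 1 + Real.log M := by
  have h := harmonic_le_one_add_log M
  unfold harmonic at h
  push_cast at h
  simpa [one_div] using h

lemma linearPart_nonneg (c : ℝ) (M : ℕ) : 0 ≤ linearPart c M :=
  sum_nonneg fun _ _ => norm_nonneg _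

lemma linearPart_le_sq (c : ℝ) {M : ℕ} (hM : 1 ≤ M) : linearPart c M ≤ (3 * M) ^ 2 := by
  have hM' : (1 : ℝ) ≤ M := by exact_mod_cast hM
  have hcard : (#(Icc (-(M : ℤ)) M) : ℝ) ≤ 3 * M := by
    rw [Int.card_Icc]
    have : (M + 1 - -(M : ℤ)).toNat = 2 * M + 1 := by omega
    rw [this]
    push_cast
    linarith
  have h1 : ∀ m : ℤ, ‖∑ n ∈ Icc (-(M : ℤ)) M, unitExp (c * m * n)‖ ≤ 3 * M := fun m => by
    refine (norm_sum_le _ _).trans ?_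
    simpa using hcard
  calc linearPart c M ≤ ∑ m ∈ Icc (-(M : ℤ)) M, (3 * M : ℝ) := sum_le_sum fun m _ => h1 m
    _ = #(Icc (-(M : ℤ)) M) * (3 * M : ℝ) := by rw [sum_const, nsmul_eq_mul]
    _ ≤ _ := by rw [sq]; gcongr

lemma linearPart_le {c : ℝ} (hc : c ≠ 0) {M : ℕ} (hM : 1 ≤ M) (hcM : |c| * M ≤ 1 / 4) :
    linearPart c M ≤ (3 + Real.log M) / |c| := by
  have hc0 : 0 < |c| := abs_pos.2 hc
  have hM' : (1 : ℝ) ≤ M := by exact_mod_cast hM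
  let G : ℕ → ℝ := fun n => if n = 0 then 2 * M + 1 else 1 / (2 * |c| * n)
  have hG : ∀ n, 0 ≤ G n := fun n => by
    simp only [G]
    split_ifs <;> positivity
  have h1 : linearPart c M ≤ ∑ n ∈ range (M + 1), 2 * G n := by
    refine sum_Icc_int_le M (fun m hm => ?_) hG
    simp only [G, Int.natAbs_eq_zero]
    split_ifs with h
    · subst h
      refine (norm_sum_le _ _).trans ?_
      simp only [norm_unitExp, sum_const, nsmul_eq_mul, mul_one, Int.card_Icc]
      have : (M + 1 - -(M : ℤ)).toNat = 2 * M + 1 := by omega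
      rw [this]
      push_cast
      rfl
    · have hm' : |(m : ℝ)| = (m.natAbs : ℝ) := by
        rw [Nat.cast_natAbs, Int.cast_abs]
      have hmM : |(m : ℝ)| ≤ M := by rw [hm']; exact_mod_cast hm
      have h2 : |c * m| ≤ 1 / 2 := by
        rw [abs_mul]
        nlinarith
      refine (norm_sum_Icc_unitExp_le (mul_ne_zero hc (by exact_mod_cast h)) h2 M).trans
        (le_of_eq ?_)
      rw [abs_mul, hm', mul_assoc]
  refine h1.trans ?_
  rw [sum_range_succ']
  have h3 : ∑ n ∈ range M, 2 * G (n + 1) ≤ (1 + Real.log M) / |c| := by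
    have : ∀ n, 2 * G (n + 1) = 1 / |c| * (1 / ((n : ℝ) + 1)) := fun n => by
      simp only [G, Nat.add_eq_zero_iff, one_ne_zero, and_false, if_false]
      push_cast
      field_simp
    simp_rw [this, ← mul_sum]
    rw [div_eq_mul_one_div (1 + Real.log M), mul_comm (1 + Real.log M)]
    exact mul_le_mul_of_nonneg_left (sum_range_inv_le M) (one_div_pos.2 hc0).le
  have h4 : 2 * G 0 ≤ 2 / |c| := by
    rw [le_div_iff₀ hc0]
    simp only [G, if_true]
    nlinarith
  have : (3 + Real.log M) / |c| = (1 + Real.log M) / |c| + 2 / |c| := by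
    rw [← add_div]; congr 1; ring
  rw [this]
  exact add_le_add h3 h4

lemma linearPart_le_exp (c : ℝ) {s i : ℕ} (hs : 1 ≤ s) {Y : ℕ} (hY : 1 ≤ Y) :
    linearPart c (s * Y ^ i) ≤ Real.exp (2 * Real.log (3 * s) + 2 * i * Real.log Y) := by
  have hY0 : (0 : ℝ) < Y := by exact_mod_cast hY
  have hs0 : (0 : ℝ) < s := by exact_mod_cast hs
  refine (linearPart_le_sq c (Nat.one_le_iff_ne_zero.2 (by positivity))).trans (le_of_eq ?_)
  have : (3 * ((s * Y ^ i : ℕ) : ℝ)) ^ 2 = Real.exp (Real.log ((3 * s * (Y : ℝ) ^ i) ^ 2)) := by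
    rw [Real.exp_log (by positivity)]
    push_cast
    ring
  rw [this, Real.log_pow, Real.log_mul (by positivity) (by positivity), Real.log_pow]
  push_cast
  ring_nf

lemma linearPart_le_exp_of_small {c : ℝ} {s i k : ℕ} (hs : 1 ≤ s) (hik : i ≤ k) {Y : ℕ}
    (hY : 1 ≤ Y) (h1 : |c| * (s * (Y : ℝ) ^ i) ≤ 1 / 4)
    (h2 : Real.exp (-(7 / 4 * i * Real.log Y)) ≤ |c|) :
    linearPart c (s * Y ^ i) ≤
      Real.exp (7 / 4 * i * Real.log Y + Real.log (3 + Real.log (s * (Y : ℝ) ^ k))) := by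
  have hY1 : (1 : ℝ) ≤ Y := by exact_mod_cast hY
  have hs1 : (1 : ℝ) ≤ s := by exact_mod_cast hs
  have hc0 : 0 < |c| := (Real.exp_pos _).trans_le h2
  have hM : 1 ≤ s * Y ^ i := Nat.one_le_iff_ne_zero.2 (by positivity)
  have h3 := linearPart_le (abs_pos.1 hc0) hM (by push_cast; exact h1)
  have hle : (s : ℝ) * (Y : ℝ) ^ i ≤ s * (Y : ℝ) ^ k := by gcongr
  have h1le : (1 : ℝ) ≤ s * (Y : ℝ) ^ i := by exact_mod_cast hM
  have hlog0 := Real.log_nonneg h1le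
  have hlog : Real.log (s * (Y : ℝ) ^ i) ≤ Real.log (s * (Y : ℝ) ^ k) :=
    Real.log_le_log (by positivity) hle
  push_cast at h3
  refine h3.trans ?_
  rw [Real.exp_add, Real.exp_log (by linarith), div_eq_mul_inv, mul_comm]
  refine mul_le_mul ?_ (by linarith) (by linarith) (Real.exp_pos _).le
  rw [Real.exp_neg] at h2
  exact inv_le_of_inv_le₀ (Real.exp_pos _) h2

lemma norm_bilinear_sum_le_exp {k : ℕ} (hk : 2 ≤ k) {Y : ℕ} (hY : 1 ≤ Y) (c : Fin k → ℝ)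
    (G : Finset (Fin k))
    (h1 : ∀ i ∈ G, |c i| * ((11 * k ^ 2 : ℕ) * (Y : ℝ) ^ (i.1 + 1)) ≤ 1 / 4)
    (h2 : ∀ i ∈ G, Real.exp (-(7 / 4 * (i.1 + 1 : ℕ) * Real.log Y)) ≤ |c i|) :
    ‖∑ u ∈ Ico (0 : ℤ) Y, ∑ v ∈ Ico (0 : ℤ) Y,
      unitExp (diagForm c (momentCurve k u) (momentCurve k v))‖ ^ (4 * (11 * k ^ 2) ^ 2) ≤
    Real.exp (8 * (11 * (k : ℝ) ^ 2) ^ 2 * Real.log Y +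
      (1 / 1000 * (k * (k + 1)) - 1 / 4 * ∑ i ∈ G, ((i.1 + 1 : ℕ) : ℝ)) * Real.log Y +
      4062 * (k : ℝ) ^ 3 * Real.log k + 2 * k * Real.log (33 * (k : ℝ) ^ 2) +
      k * Real.log (3 + Real.log (11 * (k : ℝ) ^ 2 * (Y : ℝ) ^ k))) := by
  have hY1 : (1 : ℝ) ≤ Y := by exact_mod_cast hY
  have hk0 : (0 : ℝ) < k := by exact_mod_cast (by omega : 0 < k)
  have hs : 1 ≤ 11 * k ^ 2 := Nat.one_le_iff_ne_zero.2 (by positivity)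
  set lam := Real.log Y with hlam
  have hlam0 : 0 ≤ lam := Real.log_nonneg hY1
  set Λ := Real.log (3 + Real.log (11 * (k : ℝ) ^ 2 * (Y : ℝ) ^ k)) with hΛ
  have hΛ0 : 0 ≤ Λ := by
    refine Real.log_nonneg ?_
    have : (1 : ℝ) ≤ 11 * (k : ℝ) ^ 2 * (Y : ℝ) ^ k := by
      exact_mod_cast Nat.one_le_iff_ne_zero.2 (by positivity : 11 * k ^ 2 * Y ^ k ≠ 0)
    linarith [Real.log_nonneg this]
  have hJ := vinogradovCount_le hk hY
  have hJ' : (vinogradovCount (Fin (11 * k ^ 2)) k Y : ℝ) ≤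
      Real.exp (2031 * (k : ℝ) ^ 3 * Real.log k +
        (22 * (k : ℝ) ^ 2 - 999 / 1000 * ((k : ℝ) * (k + 1) / 2)) * lam) := by
    refine hJ.trans (le_of_eq ?_)
    rw [Real.exp_add, ← Real.rpow_natCast, Real.rpow_def_of_pos hk0,
      Real.rpow_def_of_pos (by linarith), ← hlam]
    push_cast
    ring_nf
  have hW : ∀ i : Fin k, linearPart (c i) (11 * k ^ 2 * Y ^ (i.1 + 1)) ≤
      Real.exp (2 * Real.log (33 * (k : ℝ) ^ 2) + 2 * (i.1 + 1 : ℕ) * lam +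
        if i ∈ G then -(1 / 4 * ((i.1 + 1 : ℕ) : ℝ)) * lam + Λ else 0) := by
    intro i
    split_ifs with hi
    · refine (linearPart_le_exp_of_small hs i.2 hY (h1 i hi) (h2 i hi)).trans ?_
      rw [Real.exp_le_exp]
      have : 0 ≤ Real.log (33 * (k : ℝ) ^ 2) := Real.log_nonneg (by
        exact_mod_cast Nat.one_le_iff_ne_zero.2 (by positivity : 33 * k ^ 2 ≠ 0))
      push_cast
      rw [← hlam, ← hΛ]
      linarith
    · refine (linearPart_le_exp _ hs hY).trans ?_
      rw [Real.exp_le_exp]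
      push_cast
      rw [← hlam]
      have : (3 : ℝ) * (11 * (k : ℝ) ^ 2) = 33 * (k : ℝ) ^ 2 := by ring
      rw [this]
      linarith
  have htri : ∑ i : Fin k, ((i.1 + 1 : ℕ) : ℝ) = k * (k + 1) / 2 := by
    rw [Fin.sum_univ_eq_sum_range (fun i => ((i + 1 : ℕ) : ℝ))]
    clear_value Λ lam
    clear * -
    induction k with
    | zero => simp
    | succ n ih => rw [sum_range_succ, ih]; push_cast; ring
  have hprod : ∏ i, linearPart (c i) (11 * k ^ 2 * Y ^ (i.1 + 1)) ≤
      Real.exp (2 * k * Real.log (33 * (k : ℝ) ^ 2) + k * (k + 1) * lam -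
        1 / 4 * (∑ i ∈ G, ((i.1 + 1 : ℕ) : ℝ)) * lam + k * Λ) := by
    refine (prod_le_prod (fun i _ => linearPart_nonneg _ _) fun i _ => hW i).trans ?_
    rw [← Real.exp_sum, Real.exp_le_exp, sum_add_distrib, sum_add_distrib, sum_const, card_univ,
      Fintype.card_fin, ← sum_mul, ← mul_sum, htri, sum_ite_mem, univ_inter, sum_add_distrib,
      ← sum_mul, sum_neg_distrib, ← mul_sum, sum_const, nsmul_eq_mul, nsmul_eq_mul]
    have : (#G : ℝ) * Λ ≤ k * Λ := by
      refine mul_le_mul_of_nonneg_right ?_ hΛ0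
      have := card_le_univ G
      rw [Fintype.card_fin] at this
      exact_mod_cast this
    linarith
  refine (norm_bilinear_sum_pow_le (by omega) Y c).trans ?_
  have hYpow : (Y : ℝ) ^ (8 * (11 * k ^ 2) ^ 2 - 4 * (11 * k ^ 2)) =
      Real.exp ((8 * (11 * (k : ℝ) ^ 2) ^ 2 - 4 * (11 * (k : ℝ) ^ 2)) * lam) := by
    rw [← Real.rpow_natCast, Real.rpow_def_of_pos (by linarith), ← hlam, mul_comm, Nat.cast_sub]
    · push_cast
      ring_nf
    · nlinarith
  calc _ ≤ Real.exp ((8 * (11 * (k : ℝ) ^ 2) ^ 2 - 4 * (11 * (k : ℝ) ^ 2)) * lam) *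
        (Real.exp (2031 * (k : ℝ) ^ 3 * Real.log k +
        (22 * (k : ℝ) ^ 2 - 999 / 1000 * ((k : ℝ) * (k + 1) / 2)) * lam)) ^ 2 *
        Real.exp (2 * k * Real.log (33 * (k : ℝ) ^ 2) + k * (k + 1) * lam -
        1 / 4 * (∑ i ∈ G, ((i.1 + 1 : ℕ) : ℝ)) * lam + k * Λ) := by
        rw [hYpow]
        gcongr
        exact prod_nonneg fun i _ => linearPart_nonneg _ _
    _ = _ := by
        rw [← Real.exp_nat_mul, ← Real.exp_add, ← Real.exp_add]
        congr 1
        push_cast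
        ring

/-- A Vinogradov-type bound for bilinear exponential sums with a polynomial phase, assuming
many coefficients lie in an intermediate range. -/
lemma norm_bilinear_sum_le {k : ℕ} (hk : 6 ≤ k) {Y : ℕ} (hY : 1 ≤ Y) (c : Fin k → ℝ)
    (G : Finset (Fin k))
    (h1 : ∀ i ∈ G, |c i| * ((11 * k ^ 2 : ℕ) * (Y : ℝ) ^ (i.1 + 1)) ≤ 1 / 4)
    (h2 : ∀ i ∈ G, Real.exp (-(7 / 4 * (i.1 + 1 : ℕ) * Real.log Y)) ≤ |c i|)
    (h3 : (k : ℝ) ^ 2 / 50 ≤ ∑ i ∈ G, ((i.1 + 1 : ℕ) : ℝ)) :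
    ‖∑ u ∈ Ico (0 : ℤ) Y, ∑ v ∈ Ico (0 : ℤ) Y,
      unitExp (diagForm c (momentCurve k u) (momentCurve k v))‖ ≤
    (Y : ℝ) ^ 2 * (Real.exp 11 * (1 + Real.log Y) *
      Real.exp (-(7 / 10 ^ 6 * Real.log Y / (k : ℝ) ^ 2))) := by
  have hY1 : (1 : ℝ) ≤ Y := by exact_mod_cast hY
  have hk6 : (6 : ℝ) ≤ k := by exact_mod_cast hk
  have hk0 : (0 : ℝ) < k := by linarith
  have hlam0 : 0 ≤ Real.log Y := Real.log_nonneg hY1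
  have hmain := norm_bilinear_sum_le_exp (by omega) hY c G h1 h2
  set lam := Real.log Y with hlam
  have hlogk : Real.log k ≤ k := (Real.log_le_sub_one_of_pos hk0).trans (by linarith)
  have hlogs : Real.log (33 * (k : ℝ) ^ 2) ≤ 33 * (k : ℝ) ^ 2 :=
    (Real.log_le_sub_one_of_pos (by positivity)).trans (by linarith)
  have hΛ : Real.log (3 + Real.log (11 * (k : ℝ) ^ 2 * (Y : ℝ) ^ k)) ≤
      12 * (k : ℝ) ^ 2 + Real.log (1 + lam) := by
    have e1 : Real.log (11 * (k : ℝ) ^ 2 * (Y : ℝ) ^ k) =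
        Real.log (11 * (k : ℝ) ^ 2) + k * lam := by
      rw [Real.log_mul (by positivity) (by positivity), Real.log_pow]
    have e2 : Real.log (11 * (k : ℝ) ^ 2) ≤ 11 * (k : ℝ) ^ 2 - 1 :=
      Real.log_le_sub_one_of_pos (by positivity)
    have e3 : 0 ≤ Real.log (11 * (k : ℝ) ^ 2) := Real.log_nonneg (by nlinarith)
    rw [e1]
    have e4 : 3 + (Real.log (11 * (k : ℝ) ^ 2) + k * lam) ≤ (12 * (k : ℝ) ^ 2) * (1 + lam) := by
      nlinarith [mul_nonneg hk0.le hlam0, mul_nonneg (mul_nonneg hk0.le hk0.le) hlam0]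
    have e5 : 0 ≤ k * lam := mul_nonneg hk0.le hlam0
    refine (Real.log_le_log (by linarith) e4).trans ?_
    rw [Real.log_mul (by positivity) (by positivity)]
    gcongr
    exact (Real.log_le_sub_one_of_pos (by positivity)).trans (by linarith)
  have hL0 : 0 ≤ Real.log (1 + lam) := Real.log_nonneg (by linarith)
  have hrhs : (Y : ℝ) ^ 2 * (Real.exp 11 * (1 + lam) *
      Real.exp (-(7 / 10 ^ 6 * lam / (k : ℝ) ^ 2))) =
      Real.exp (2 * lam + 11 + Real.log (1 + lam) - 7 / 10 ^ 6 * lam / (k : ℝ) ^ 2) := by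
    rw [Real.exp_sub, Real.exp_add, Real.exp_add, Real.exp_log (by positivity), two_mul,
      Real.exp_add, hlam, Real.exp_log (by linarith), Real.exp_neg]
    ring
  rw [hrhs]
  have hn : 4 * (11 * k ^ 2) ^ 2 ≠ 0 := by positivity
  refine le_of_pow_le_pow_left₀ hn (Real.exp_pos _).le (hmain.trans ?_)
  rw [← Real.exp_nat_mul, Real.exp_le_exp]
  push_cast
  have e6 : 4 * (11 * (k : ℝ) ^ 2) ^ 2 *
      (2 * lam + 11 + Real.log (1 + lam) - 7 / 10 ^ 6 * lam / (k : ℝ) ^ 2) =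
      8 * (11 * (k : ℝ) ^ 2) ^ 2 * lam + 484 * 11 * (k : ℝ) ^ 4 + 484 * (k : ℝ) ^ 4 *
        Real.log (1 + lam) - 484 * 7 / 10 ^ 6 * (k : ℝ) ^ 2 * lam := by
    field_simp
    ring
  rw [e6]
  have g1 : (1 / 1000 * (k * (k + 1)) - 1 / 4 * ∑ i ∈ G, ((i.1 + 1 : ℕ) : ℝ)) * lam ≤
      -(484 * 7 / 10 ^ 6 * (k : ℝ) ^ 2) * lam := by
    refine mul_le_mul_of_nonneg_right ?_ hlam0
    nlinarith
  have g2 : 4062 * (k : ℝ) ^ 3 * Real.log k ≤ 4062 * (k : ℝ) ^ 4 := by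
    have := mul_le_mul_of_nonneg_left hlogk (by positivity : 0 ≤ 4062 * (k : ℝ) ^ 3)
    linarith [this, (by ring : 4062 * (k : ℝ) ^ 3 * k = 4062 * (k : ℝ) ^ 4)]
  have hk34 : 6 * (k : ℝ) ^ 3 ≤ (k : ℝ) ^ 4 := by
    have := mul_le_mul_of_nonneg_right hk6 (by positivity : 0 ≤ (k : ℝ) ^ 3)
    linarith [this, (by ring : (k : ℝ) * (k : ℝ) ^ 3 = (k : ℝ) ^ 4)]
  have g3 : 2 * k * Real.log (33 * (k : ℝ) ^ 2) ≤ 66 * (k : ℝ) ^ 3 := by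
    have := mul_le_mul_of_nonneg_left hlogs (by positivity : 0 ≤ 2 * (k : ℝ))
    linarith [this, (by ring : 2 * (k : ℝ) * (33 * (k : ℝ) ^ 2) = 66 * (k : ℝ) ^ 3)]
  have g4 : k * Real.log (3 + Real.log (11 * (k : ℝ) ^ 2 * (Y : ℝ) ^ k)) ≤
      12 * (k : ℝ) ^ 3 + k * Real.log (1 + lam) := by
    have := mul_le_mul_of_nonneg_left hΛ hk0.le
    linarith [this, (by ring : (k : ℝ) * (12 * (k : ℝ) ^ 2 + Real.log (1 + lam)) =
      12 * (k : ℝ) ^ 3 + k * Real.log (1 + lam))]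
  have g5 : k * Real.log (1 + lam) ≤ 484 * (k : ℝ) ^ 4 * Real.log (1 + lam) := by
    refine mul_le_mul_of_nonneg_right ?_ hL0
    nlinarith [pow_le_pow_right₀ (by linarith : (1 : ℝ) ≤ k) (by norm_num : 1 ≤ 4)]
  have hk3 : 0 ≤ (k : ℝ) ^ 3 := by positivity
  push_cast at g1
  linarith

/-! ### Exponential sums with two-term phases -/

lemma abs_one_div_one_add_pow_sub_sum_le {z : ℝ} (hz0 : 0 ≤ z) (hz : z ≤ 1 / 4) (ρ k : ℕ) :
    |1 / (1 + z) ^ (ρ + 1) - ∑ n ∈ range (k + 1), ((n + ρ).choose ρ : ℝ) * (-z) ^ n| ≤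
      2 ^ (ρ + 1) * (2 * z) ^ (k + 1) := by
  have hs := hasSum_choose_mul_geometric_of_norm_lt_one (𝕜 := ℝ) ρ (r := -z) (by
    rw [norm_neg, Real.norm_of_nonneg hz0]; linarith)
  rw [sub_neg_eq_add] at hs
  have htail := (hasSum_nat_add_iff' (k + 1)).2 hs
  have hgeo : HasSum (fun n : ℕ => 2 ^ ρ * (2 * z) ^ (k + 1) * (2 * z) ^ n)
      (2 ^ ρ * (2 * z) ^ (k + 1) * (1 - 2 * z)⁻¹) :=
    (hasSum_geometric_of_lt_one (by positivity) (by linarith)).mul_left _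
  have hbound : ∀ n : ℕ, ‖((n + (k + 1) + ρ).choose ρ : ℝ) * (-z) ^ (n + (k + 1))‖ ≤
      2 ^ ρ * (2 * z) ^ (k + 1) * (2 * z) ^ n := by
    intro n
    rw [norm_mul, norm_pow, norm_neg, Real.norm_of_nonneg hz0, Real.norm_natCast]
    have h1 : ((n + (k + 1) + ρ).choose ρ : ℝ) ≤ 2 ^ (n + (k + 1) + ρ) := by
      exact_mod_cast Nat.choose_le_two_pow _ _
    calc _ ≤ 2 ^ (n + (k + 1) + ρ) * z ^ (n + (k + 1)) := by gcongr
      _ = _ := by rw [mul_pow, mul_pow]; ring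
  have h2 := htail.norm_le_of_bounded hgeo hbound
  rw [Real.norm_eq_abs] at h2
  refine h2.trans ?_
  have h3 : (1 - 2 * z)⁻¹ ≤ 2 := by
    rw [inv_le_comm₀ (by linarith) (by norm_num)]
    linarith
  calc _ ≤ 2 ^ ρ * (2 * z) ^ (k + 1) * 2 := by gcongr
    _ = _ := by ring

/-- The Taylor coefficients of `h ↦ a / (y + h) ^ (ρ + 1)` at `0`. -/
noncomputable def negPowCoeff (a : ℝ) (ρ : ℕ) (y : ℝ) (n : ℕ) : ℝ :=
  a / y ^ (ρ + 1) * (n + ρ).choose ρ * (-(1 / y)) ^ n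

lemma abs_negPow_sub_sum_le (a : ℝ) {y h : ℝ} (hy : 0 < y) (h0 : 0 ≤ h) (hh : h ≤ y / 4)
    (ρ k : ℕ) :
    |a / (y + h) ^ (ρ + 1) - ∑ n ∈ range (k + 1), negPowCoeff a ρ y n * h ^ n| ≤
      |a| / y ^ (ρ + 1) * (2 ^ (ρ + 1) * (2 * (h / y)) ^ (k + 1)) := by
  have h1 : a / (y + h) ^ (ρ + 1) = a / y ^ (ρ + 1) * (1 / (1 + h / y) ^ (ρ + 1)) := by
    have : y + h = y * (1 + h / y) := by field_simp
    rw [this, mul_pow, div_mul_div_comm, mul_one]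
  have h2 : ∀ n, negPowCoeff a ρ y n * h ^ n =
      a / y ^ (ρ + 1) * (((n + ρ).choose ρ : ℝ) * (-(h / y)) ^ n) := by
    intro n
    unfold negPowCoeff
    have : (-(1 / y)) ^ n * h ^ n = (-(h / y)) ^ n := by
      rw [← mul_pow]
      congr 1
      ring
    rw [← this]
    ring
  simp_rw [h1, h2]
  rw [← mul_sum, ← mul_sub, abs_mul, abs_div, abs_of_pos (by positivity : 0 < y ^ (ρ + 1))]
  gcongr
  exact abs_one_div_one_add_pow_sub_sum_le (by positivity) (by rw [div_le_iff₀ hy]; linarith) _ _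

lemma abs_negPowCoeff_le (a : ℝ) {Q y : ℝ} (hQ : 0 < Q) (hy : Q ≤ y) (ρ n : ℕ) :
    |negPowCoeff a ρ y n| ≤ |a| / Q ^ (ρ + 1) * 2 ^ (n + ρ) / Q ^ n := by
  have hy0 : 0 < y := hQ.trans_le hy
  have h1 : ((n + ρ).choose ρ : ℝ) ≤ 2 ^ (n + ρ) := by exact_mod_cast Nat.choose_le_two_pow _ _
  unfold negPowCoeff
  rw [abs_mul, abs_mul, abs_pow, abs_neg, abs_div, abs_div, abs_one,
    abs_of_pos (by positivity : 0 < y ^ (ρ + 1)), abs_of_pos hy0, Nat.abs_cast, div_pow, one_pow,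
    div_eq_mul_one_div _ (Q ^ n)]
  gcongr

lemma le_abs_negPowCoeff (a : ℝ) {Q y : ℝ} (hQ : 0 < Q) (hy : Q ≤ y) (hy2 : y ≤ 2 * Q) (ρ n : ℕ) :
    |a| / Q ^ (ρ + 1) / 2 ^ (n + ρ + 1) / Q ^ n ≤ |negPowCoeff a ρ y n| := by
  have hy0 : 0 < y := hQ.trans_le hy
  have h1 : (1 : ℝ) ≤ (n + ρ).choose ρ := by
    exact_mod_cast Nat.choose_pos (Nat.le_add_left _ _)
  unfold negPowCoeff
  rw [abs_mul, abs_mul, abs_pow, abs_neg, abs_div, abs_div, abs_one,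
    abs_of_pos (by positivity : 0 < y ^ (ρ + 1)), abs_of_pos hy0, Nat.abs_cast, div_pow, one_pow]
  calc |a| / Q ^ (ρ + 1) / 2 ^ (n + ρ + 1) / Q ^ n
      = |a| / (2 * Q) ^ (ρ + 1) * 1 * (1 / (2 * Q) ^ n) := by
        rw [mul_pow, mul_pow]
        field_simp
        ring
    _ ≤ _ := by gcongr

lemma diagForm_momentCurve (k : ℕ) (c : Fin k → ℝ) (u v : ℤ) :
    diagForm c (momentCurve k u) (momentCurve k v) =
      ∑ i : Fin k, c i * ((u : ℝ) * v) ^ (i.1 + 1) := by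
  rw [diagForm_apply]
  refine sum_congr rfl fun i _ => ?_
  simp only [momentCurve]
  push_cast
  rw [mul_pow, mul_assoc]

/-- The phase `a / y ^ (ρ + 1) + b / y ^ (σ + 1)`. -/
noncomputable def twoTermPhase (a b : ℝ) (ρ σ : ℕ) (y : ℝ) : ℝ :=
  a / y ^ (ρ + 1) + b / y ^ (σ + 1)

lemma abs_twoTermPhase_sub_le (a b : ℝ) {y h : ℝ} (hy : 0 < y) (h0 : 0 ≤ h) (hh : h ≤ y / 4)
    (ρ σ k : ℕ) :
    |twoTermPhase a b ρ σ (y + h) - (twoTermPhase a b ρ σ y + ∑ i : Fin k,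
      (negPowCoeff a ρ y (i.1 + 1) + negPowCoeff b σ y (i.1 + 1)) * h ^ (i.1 + 1))| ≤
      (|a| / y ^ (ρ + 1) * 2 ^ (ρ + 1) + |b| / y ^ (σ + 1) * 2 ^ (σ + 1)) *
        (2 * (h / y)) ^ (k + 1) := by
  have ha := abs_negPow_sub_sum_le a hy h0 hh ρ k
  have hb := abs_negPow_sub_sum_le b hy h0 hh σ k
  have h1 : twoTermPhase a b ρ σ (y + h) - (twoTermPhase a b ρ σ y + ∑ i : Fin k,
      (negPowCoeff a ρ y (i.1 + 1) + negPowCoeff b σ y (i.1 + 1)) * h ^ (i.1 + 1)) =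
      (a / (y + h) ^ (ρ + 1) - ∑ n ∈ range (k + 1), negPowCoeff a ρ y n * h ^ n) +
      (b / (y + h) ^ (σ + 1) - ∑ n ∈ range (k + 1), negPowCoeff b σ y n * h ^ n) := by
    rw [sum_range_succ' _ k, sum_range_succ' _ k, Fin.sum_univ_eq_sum_range
      (fun i => (negPowCoeff a ρ y (i + 1) + negPowCoeff b σ y (i + 1)) * h ^ (i + 1))]
    simp_rw [add_mul]
    rw [sum_add_distrib]
    simp only [twoTermPhase, negPowCoeff, zero_add, Nat.choose_self, pow_zero, Nat.cast_one,
      mul_one]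
    ring
  rw [h1]
  refine (abs_add_le _ _).trans ((add_le_add ha hb).trans (le_of_eq ?_))
  ring

lemma norm_bilinear_twoTermPhase_le (a b : ℝ) {Q y : ℝ} (hQ : 0 < Q) (hy : Q ≤ y) {Y : ℕ}
    (hY : (Y : ℝ) ^ 2 ≤ Q / 4) (ρ σ k : ℕ) :
    ‖∑ u ∈ Ico (0 : ℤ) Y, ∑ v ∈ Ico (0 : ℤ) Y, unitExp (twoTermPhase a b ρ σ (y + u * v))‖ ≤
      ‖∑ u ∈ Ico (0 : ℤ) Y, ∑ v ∈ Ico (0 : ℤ) Y, unitExp (diagForm (fun i : Fin k =>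
        negPowCoeff a ρ y (i.1 + 1) + negPowCoeff b σ y (i.1 + 1))
        (momentCurve k u) (momentCurve k v))‖ +
      (Y : ℝ) ^ 2 * (2 * Real.pi * ((|a| / Q ^ (ρ + 1) * 2 ^ (ρ + 1) +
        |b| / Q ^ (σ + 1) * 2 ^ (σ + 1)) * (2 * ((Y : ℝ) ^ 2 / Q)) ^ (k + 1))) := by
  set c : Fin k → ℝ := fun i => negPowCoeff a ρ y (i.1 + 1) + negPowCoeff b σ y (i.1 + 1) with hc
  set E : ℝ := 2 * Real.pi * ((|a| / Q ^ (ρ + 1) * 2 ^ (ρ + 1) +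
        |b| / Q ^ (σ + 1) * 2 ^ (σ + 1)) * (2 * ((Y : ℝ) ^ 2 / Q)) ^ (k + 1)) with hE
  have hy0 : 0 < y := hQ.trans_le hy
  have hterm : ∀ u ∈ Ico (0 : ℤ) Y, ∀ v ∈ Ico (0 : ℤ) Y,
      ‖unitExp (twoTermPhase a b ρ σ (y + u * v)) - unitExp (twoTermPhase a b ρ σ y) *
        unitExp (diagForm c (momentCurve k u) (momentCurve k v))‖ ≤ E := by
    intro u hu v hv
    rw [mem_Ico] at hu hv
    have hu0 : (0 : ℝ) ≤ u := by exact_mod_cast hu.1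
    have hv0 : (0 : ℝ) ≤ v := by exact_mod_cast hv.1
    have hu1 : (u : ℝ) ≤ Y := by exact_mod_cast hu.2.le
    have hv1 : (v : ℝ) ≤ Y := by exact_mod_cast hv.2.le
    have huv : (u : ℝ) * v ≤ (Y : ℝ) ^ 2 := by rw [sq]; gcongr
    rw [← unitExp_add, diagForm_momentCurve]
    refine (norm_unitExp_sub_unitExp_le _ _).trans ?_
    rw [hE]
    refine mul_le_mul_of_nonneg_left ?_ (by positivity)
    refine (abs_twoTermPhase_sub_le a b hy0 (mul_nonneg hu0 hv0) (by linarith) ρ σ k).trans ?_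
    gcongr
  have hsplit : ∑ u ∈ Ico (0 : ℤ) Y, ∑ v ∈ Ico (0 : ℤ) Y,
      unitExp (twoTermPhase a b ρ σ (y + u * v)) =
      unitExp (twoTermPhase a b ρ σ y) * (∑ u ∈ Ico (0 : ℤ) Y, ∑ v ∈ Ico (0 : ℤ) Y,
        unitExp (diagForm c (momentCurve k u) (momentCurve k v))) +
      ∑ u ∈ Ico (0 : ℤ) Y, ∑ v ∈ Ico (0 : ℤ) Y, (unitExp (twoTermPhase a b ρ σ (y + u * v)) -
        unitExp (twoTermPhase a b ρ σ y) *
        unitExp (diagForm c (momentCurve k u) (momentCurve k v))) := by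
    simp_rw [mul_sum, ← sum_add_distrib]
    simp
  rw [hsplit]
  refine (norm_add_le _ _).trans (add_le_add ?_ ?_)
  · rw [norm_mul, norm_unitExp, one_mul]
  · refine (norm_sum_le_of_le _ fun u hu => norm_sum_le_of_le _ fun v hv =>
      hterm u hu v hv).trans (le_of_eq ?_)
    simp only [sum_const, Int.card_Ico, sub_zero, Int.toNat_natCast, nsmul_eq_mul]
    ring

lemma sum_Ioc_sub_shift (f : ℕ → ℂ) {A B : ℕ} (hAB : A ≤ B) (h : ℕ) :
    ∑ n ∈ Ioc A B, (f (n + h) - f (n + 1 + h)) = f (A + 1 + h) - f (B + 1 + h) := by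
  induction B, hAB using Nat.le_induction with
  | base => simp
  | succ B hAB ih =>
    rw [← insert_Ioc_right_eq_Ioc_add_one (by omega), sum_insert (by simp), ih]
    ring

lemma norm_sum_Ioc_sub_sum_shift_le (f : ℕ → ℂ) (hf : ∀ n, ‖f n‖ ≤ 1) (A B h : ℕ) :
    ‖∑ n ∈ Ioc A B, f n - ∑ n ∈ Ioc A B, f (n + h)‖ ≤ 2 * h := by
  induction h with
  | zero => simp
  | succ h ih =>
    have h1 : ‖∑ n ∈ Ioc A B, f (n + h) - ∑ n ∈ Ioc A B, f (n + (h + 1))‖ ≤ 2 := by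
      rcases le_total B A with hBA | hAB
      · simp [Ioc_eq_empty_of_le hBA]
      · have : ∀ n, f (n + (h + 1)) = f (n + 1 + h) := fun n => by congr 1; ring
        simp_rw [this]
        have e := sum_Ioc_sub_shift f hAB h
        rw [← sum_sub_distrib, e]
        refine (norm_sub_le _ _).trans ?_
        linarith [hf (A + 1 + h), hf (B + 1 + h)]
    calc _ = ‖(∑ n ∈ Ioc A B, f n - ∑ n ∈ Ioc A B, f (n + h)) +
          (∑ n ∈ Ioc A B, f (n + h) - ∑ n ∈ Ioc A B, f (n + (h + 1)))‖ := by
          rw [sub_add_sub_cancel]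
      _ ≤ 2 * h + 2 := (norm_add_le _ _).trans (add_le_add ih h1)
      _ = _ := by push_cast; ring

lemma norm_sum_Ioc_le_of_bilinear (g : ℝ → ℂ) (hg : ∀ x, ‖g x‖ ≤ 1) (A B : ℕ) {Y : ℕ}
    (hY : 1 ≤ Y) {D : ℝ} (hD : ∀ n ∈ Ioc A B,
      ‖∑ u ∈ Ico (0 : ℤ) Y, ∑ v ∈ Ico (0 : ℤ) Y, g (n + u * v)‖ ≤ (Y : ℝ) ^ 2 * D) :
    ‖∑ n ∈ Ioc A B, g n‖ ≤ #(Ioc A B) * D + 2 * (Y : ℝ) ^ 2 := by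
  have hY0 : (0 : ℝ) < Y := by exact_mod_cast hY
  set S := ∑ n ∈ Ioc A B, g n with hS
  have h1 : ∀ u ∈ Ico (0 : ℤ) Y, ∀ v ∈ Ico (0 : ℤ) Y,
      ‖S - ∑ n ∈ Ioc A B, g (n + u * v)‖ ≤ 2 * (Y : ℝ) ^ 2 := by
    intro u hu v hv
    rw [mem_Ico] at hu hv
    lift u to ℕ using hu.1
    lift v to ℕ using hv.1
    have hu1 : (u : ℝ) ≤ Y := by exact_mod_cast hu.2.le
    have hv1 : (v : ℝ) ≤ Y := by exact_mod_cast hv.2.le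
    have := norm_sum_Ioc_sub_sum_shift_le (fun n => g n) (fun n => hg n) A B (u * v)
    push_cast at this ⊢
    refine this.trans ?_
    rw [sq]
    gcongr
  have h2 : (Y : ℂ) ^ 2 * S = ∑ n ∈ Ioc A B, ∑ u ∈ Ico (0 : ℤ) Y, ∑ v ∈ Ico (0 : ℤ) Y,
      g (n + u * v) + ∑ u ∈ Ico (0 : ℤ) Y, ∑ v ∈ Ico (0 : ℤ) Y,
        (S - ∑ n ∈ Ioc A B, g (n + u * v)) := by
    have e1 : ∑ n ∈ Ioc A B, ∑ u ∈ Ico (0 : ℤ) Y, ∑ v ∈ Ico (0 : ℤ) Y, g (n + u * v) =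
        ∑ u ∈ Ico (0 : ℤ) Y, ∑ v ∈ Ico (0 : ℤ) Y, ∑ n ∈ Ioc A B, g (n + u * v) := by
      rw [sum_comm]
      exact sum_congr rfl fun u _ => sum_comm
    rw [e1]
    simp only [sum_sub_distrib, sum_const, Int.card_Ico, sub_zero, Int.toNat_natCast, nsmul_eq_mul]
    ring
  have h3 : (Y : ℝ) ^ 2 * ‖S‖ ≤ (Y : ℝ) ^ 2 * (#(Ioc A B) * D + 2 * (Y : ℝ) ^ 2) := by
    have : (Y : ℝ) ^ 2 * ‖S‖ = ‖(Y : ℂ) ^ 2 * S‖ := by simp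
    rw [this, h2]
    refine (norm_add_le _ _).trans ?_
    have e2 := norm_sum_le_of_le (Ioc A B) hD
    have e3 := norm_sum_le_of_le (Ico (0 : ℤ) Y) fun u hu =>
      norm_sum_le_of_le (Ico (0 : ℤ) Y) fun v hv => h1 u hu v hv
    simp only [sum_const, Int.card_Ico, sub_zero, Int.toNat_natCast, nsmul_eq_mul] at e2 e3
    nlinarith
  exact le_of_mul_le_mul_left h3 (by positivity)

lemma two_pow_le_exp (n : ℕ) : (2 : ℝ) ^ n ≤ Real.exp n := by
  rw [← Real.exp_one_pow]
  gcongr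
  linarith [Real.add_one_le_exp 1]

lemma natCast_le_exp (n : ℕ) : (n : ℝ) ≤ Real.exp n := by
  linarith [Real.add_one_le_exp (n : ℝ)]

lemma sq_div_le_sum_filter {A : ℝ} {k : ℕ} (hA : 9 / 10 ≤ A) (hk1 : 5 * A + 1 ≤ k)
    (hk2 : (k : ℝ) ≤ 5 * A + 2) :
    (k : ℝ) ^ 2 / 50 ≤ ∑ i : Fin k with 7 / 4 * A ≤ ((i.1 + 1 : ℕ) : ℝ) ∧
      ((i.1 + 1 : ℕ) : ℝ) ≤ 16 / 5 * A, ((i.1 + 1 : ℕ) : ℝ) := by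
  set G : Finset (Fin k) := {i : Fin k | 7 / 4 * A ≤ ((i.1 + 1 : ℕ) : ℝ) ∧
      ((i.1 + 1 : ℕ) : ℝ) ≤ 16 / 5 * A} with hG
  have hA0 : 0 < A := by linarith
  set n0 := ⌈7 / 4 * A⌉₊
  set n1 := ⌊16 / 5 * A⌋₊
  have hn0 : (n0 : ℝ) < 7 / 4 * A + 1 := Nat.ceil_lt_add_one (by positivity)
  have hn1 : 16 / 5 * A < n1 + 1 := Nat.lt_floor_add_one _
  have hle : n0 ≤ n1 := by
    rw [Nat.le_floor_iff (by positivity)]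
    linarith
  have hcard : #(Icc n0 n1) ≤ #G := by
    refine card_le_card_of_surjOn (fun i : Fin k => i.1 + 1) fun n hn => ?_
    rw [coe_Icc, Set.mem_Icc] at hn
    have h1 : 7 / 4 * A ≤ n := (Nat.le_ceil _).trans (by exact_mod_cast hn.1)
    have h2 : (n : ℝ) ≤ 16 / 5 * A := by
      rw [← Nat.le_floor_iff (by positivity)]; exact hn.2
    have hnpos : 0 < n := by
      have : (0 : ℝ) < n := by linarith
      exact_mod_cast this
    have hnk : n ≤ k := by
      have : (n : ℝ) ≤ k := by linarith
      exact_mod_cast this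
    refine ⟨⟨n - 1, by omega⟩, ?_, by simp; omega⟩
    rw [hG, mem_coe, mem_filter]
    have : n - 1 + 1 = n := by omega
    simp only [this]
    exact ⟨mem_univ _, h1, h2⟩
  have hGc : 29 / 40 * A ≤ (#G : ℝ) := by
    have h1 : ((n1 + 1 - n0 : ℕ) : ℝ) ≤ #G := by
      rw [Nat.card_Icc] at hcard
      exact_mod_cast hcard
    rw [Nat.cast_sub (by omega)] at h1
    push_cast at h1
    have h2 : (1 : ℝ) ≤ #G := by
      have : (n0 : ℝ) ≤ n1 := by exact_mod_cast hle
      linarith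
    rcases le_total (29 / 20 * A) 2 with h | h <;> linarith
  calc (k : ℝ) ^ 2 / 50 ≤ 29 / 40 * A * (7 / 4 * A) := by nlinarith
    _ ≤ #G * (7 / 4 * A) := by gcongr
    _ = ∑ i ∈ G, 7 / 4 * A := by rw [sum_const, nsmul_eq_mul]
    _ ≤ _ := sum_le_sum fun i hi => (mem_filter.1 hi).2.1

lemma abs_negPowCoeff_add_le {Q y a b l t : ℝ} {ρ σ : ℕ} (hQ : Q = Real.exp l)
    (ha : |a| / Q ^ (ρ + 1) ≤ Real.exp t) (hb : |b| / Q ^ (σ + 1) ≤ Real.exp t) (hy : Q ≤ y)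
    (m : ℕ) :
    |negPowCoeff a ρ y m + negPowCoeff b σ y m| ≤ Real.exp (t - m * l + (m + ρ + σ + 1)) := by
  have hQ0 : 0 < Q := hQ ▸ Real.exp_pos l
  have hQn : Q ^ m = Real.exp (m * l) := by rw [hQ, Real.exp_nat_mul]
  have key : ∀ (c : ℝ) (τ : ℕ), |c| / Q ^ (τ + 1) ≤ Real.exp t → τ ≤ ρ + σ →
      |negPowCoeff c τ y m| ≤ Real.exp (t - m * l + (m + ρ + σ)) := by
    intro c τ hc hτ
    have hτ' : (τ : ℝ) ≤ ρ + σ := by exact_mod_cast hτ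
    refine (abs_negPowCoeff_le c hQ0 hy τ m).trans ?_
    calc _ ≤ Real.exp t * Real.exp ((m + τ : ℕ) : ℝ) / Q ^ m := by
          gcongr
          exact two_pow_le_exp _
      _ = Real.exp (t - m * l + ((m + τ : ℕ) : ℝ)) := by
          rw [hQn, ← Real.exp_add, ← Real.exp_sub]; ring_nf
      _ ≤ _ := Real.exp_le_exp.2 (by push_cast; linarith)
  refine (abs_add_le _ _).trans ((add_le_add (key a ρ ha (by omega)) (key b σ hb (by omega))).trans
    ?_)
  have : t - m * l + (m + ρ + σ + 1 : ℝ) = t - m * l + (m + ρ + σ) + 1 := by ring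
  rw [this, Real.exp_add _ 1]
  nlinarith [Real.exp_pos (t - m * l + (m + ρ + σ)), Real.add_one_le_exp 1]

lemma le_abs_negPowCoeff_add {Q y a b l t : ℝ} {ρ σ m : ℕ} (hQ : Q = Real.exp l)
    (ha : |a| / Q ^ (ρ + 1) = Real.exp t) (hb : |b| / Q ^ (σ + 1) ≤ Real.exp (t - l / 2))
    (hy : Q ≤ y) (hy2 : y ≤ 2 * Q) (hm : 2 * m + ρ + σ + 2 ≤ l / 2) :
    Real.exp (t - m * l - (m + ρ + 2)) ≤ |negPowCoeff a ρ y m + negPowCoeff b σ y m| := by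
  have hQ0 : 0 < Q := hQ ▸ Real.exp_pos l
  have hQn : Q ^ m = Real.exp (m * l) := by rw [hQ, Real.exp_nat_mul]
  have d1 : 2 * Real.exp (t - m * l - (m + ρ + 2)) ≤ |negPowCoeff a ρ y m| := by
    refine le_trans ?_ (le_abs_negPowCoeff a hQ0 hy hy2 ρ m)
    rw [ha, hQn]
    have e0 : (2 : ℝ) ^ (m + ρ + 1) * 2 ≤ Real.exp (m + ρ + 2) := by
      have := two_pow_le_exp (m + ρ + 2)
      push_cast at this
      rwa [← pow_succ]
    rw [Real.exp_sub, Real.exp_sub, div_div (Real.exp t), div_div (Real.exp t), mul_div_assoc',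
      div_le_div_iff₀ (by positivity) (by positivity)]
    have := mul_le_mul_of_nonneg_left e0 (by positivity : 0 ≤ Real.exp t * Real.exp (m * l))
    linarith
  have d2 : |negPowCoeff b σ y m| ≤ Real.exp (t - m * l - (m + ρ + 2)) := by
    refine (abs_negPowCoeff_le b hQ0 hy σ m).trans ?_
    calc _ ≤ Real.exp (t - l / 2) * Real.exp ((m + σ : ℕ) : ℝ) / Real.exp (m * l) := by
          rw [hQn]
          gcongr
          exact two_pow_le_exp _
      _ = Real.exp (t - l / 2 + ((m + σ : ℕ) : ℝ) - m * l) := by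
          rw [Real.exp_sub _ (m * l), Real.exp_add]
      _ ≤ _ := Real.exp_le_exp.2 (by push_cast; linarith)
  have := abs_sub_abs_le_abs_sub (negPowCoeff a ρ y m) (-negPowCoeff b σ y m)
  rw [sub_neg_eq_add, abs_neg] at this
  linarith

lemma taylor_error_le_exp {Q a b l t : ℝ} {ρ σ k Y : ℕ} (hQ : Q = Real.exp l)
    (ha : |a| / Q ^ (ρ + 1) ≤ Real.exp t) (hb : |b| / Q ^ (σ + 1) ≤ Real.exp t)
    (hY : (Y : ℝ) ^ 2 / Q ≤ Real.exp (-(l / 5)))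
    (hk : t + (ρ + σ + k + 13) + l / 10 ≤ ((k : ℝ) + 1) * (l / 5)) :
    2 * Real.pi * ((|a| / Q ^ (ρ + 1) * 2 ^ (ρ + 1) +
        |b| / Q ^ (σ + 1) * 2 ^ (σ + 1)) * (2 * ((Y : ℝ) ^ 2 / Q)) ^ (k + 1)) ≤
      Real.exp (-(l / 10)) := by
  have hQ0 : 0 < Q := hQ ▸ Real.exp_pos l
  have e1 : (2 * ((Y : ℝ) ^ 2 / Q)) ^ (k + 1) ≤ Real.exp (((k + 1 : ℕ) : ℝ) * (1 - l / 5)) := by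
    rw [Real.exp_nat_mul]
    refine pow_le_pow_left₀ (by positivity) ?_ _
    rw [sub_eq_add_neg, Real.exp_add]
    have := Real.add_one_le_exp 1
    refine mul_le_mul (by linarith) hY (by positivity) (Real.exp_pos _).le
  have e2 : |a| / Q ^ (ρ + 1) * 2 ^ (ρ + 1) + |b| / Q ^ (σ + 1) * 2 ^ (σ + 1) ≤
      Real.exp (t + (ρ + σ + 2)) := by
    have f1 := two_pow_le_exp (ρ + σ + 2)
    have f2 : (2 : ℝ) ^ (ρ + 1) ≤ 2 ^ (ρ + σ + 1) := by
      gcongr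
      · norm_num
      · omega
    have f3 : (2 : ℝ) ^ (σ + 1) ≤ 2 ^ (ρ + σ + 1) := by
      gcongr
      · norm_num
      · omega
    calc _ ≤ Real.exp t * 2 ^ (ρ + σ + 1) + Real.exp t * 2 ^ (ρ + σ + 1) := by gcongr
      _ = Real.exp t * 2 ^ (ρ + σ + 2) := by ring
      _ ≤ Real.exp t * Real.exp ((ρ + σ + 2 : ℕ) : ℝ) := by gcongr
      _ = _ := by rw [← Real.exp_add]; push_cast; rfl
  have e3 : 2 * Real.pi ≤ Real.exp 10 := by
    linarith [Real.pi_le_four, Real.add_one_le_exp 10]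
  calc _ ≤ Real.exp 10 * (Real.exp (t + (ρ + σ + 2)) *
        Real.exp (((k + 1 : ℕ) : ℝ) * (1 - l / 5))) := by gcongr
    _ = Real.exp (10 + (t + (ρ + σ + 2) + ((k + 1 : ℕ) : ℝ) * (1 - l / 5))) := by
        rw [← Real.exp_add, ← Real.exp_add]
    _ ≤ _ := Real.exp_le_exp.2 (by push_cast; nlinarith)

set_option maxHeartbeats 600000 in
/-- Exponential sums with phase `a / y ^ (ρ + 1) + b / y ^ (σ + 1)` over short dyadic ranges. -/
lemma norm_sum_twoTermPhase_le {Q : ℕ} {a b t : ℝ} {ρ σ k : ℕ} (hQ : 1 ≤ Q)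
    (ha : |a| / (Q : ℝ) ^ (ρ + 1) = Real.exp t)
    (hb : |b| / (Q : ℝ) ^ (σ + 1) ≤ Real.exp (t - Real.log Q / 2))
    (ht : 9 / 10 * Real.log Q ≤ t) (hk1 : 5 * t + Real.log Q ≤ k * Real.log Q)
    (hk2 : k * Real.log Q ≤ 5 * t + 2 * Real.log Q)
    (hsmall : ρ + σ + 10 * k + 50 ≤ Real.log Q / 1000) {A B : ℕ} (hA : Q ≤ A) (hB : B ≤ 2 * Q) :
    ‖∑ n ∈ Ioc A B, unitExp (twoTermPhase a b ρ σ n)‖ ≤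
      Q * (Real.exp 11 * (1 + Real.log Q) * Real.exp (-(2 / 10 ^ 6 * Real.log Q / (k : ℝ) ^ 2)) +
        3 * Real.exp (-(Real.log Q / 10))) := by
  have hQ0 : (0 : ℝ) < Q := by exact_mod_cast hQ
  set l := Real.log Q with hl
  have hQe : (Q : ℝ) = Real.exp l := (Real.exp_log hQ0).symm
  have hρ0 : (0 : ℝ) ≤ ρ := Nat.cast_nonneg _
  have hσ0 : (0 : ℝ) ≤ σ := Nat.cast_nonneg _
  have hk0 : (0 : ℝ) ≤ k := Nat.cast_nonneg _
  have hl1 : 50000 ≤ l := by linarith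
  have hlpos : 0 < l := by linarith
  have hk6 : 6 ≤ k := by
    have : (5 : ℝ) < k := by
      by_contra! h
      nlinarith
    exact_mod_cast this
  have hk6' : (6 : ℝ) ≤ k := by exact_mod_cast hk6
  set Y := ⌊Real.exp (2 / 5 * l)⌋₊ with hYdef
  have hYle : (Y : ℝ) ≤ Real.exp (2 / 5 * l) := Nat.floor_le (Real.exp_pos _).le
  have hYbig : (2 : ℝ) ≤ Real.exp (2 / 5 * l) := by
    linarith [Real.add_one_le_exp (2 / 5 * l)]
  have hYge : Real.exp (2 / 5 * l - 1) ≤ Y := by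
    have h1 := Nat.lt_floor_add_one (Real.exp (2 / 5 * l))
    rw [Real.exp_sub, div_le_iff₀ (Real.exp_pos _)]
    have h2 : (1 : ℝ) ≤ Y := by
      have : 1 ≤ Y := Nat.le_floor (by push_cast; linarith)
      exact_mod_cast this
    have h3 := Real.add_one_le_exp 1
    nlinarith
  have hY1 : 1 ≤ Y := Nat.le_floor (by push_cast; linarith)
  have hY0 : (0 : ℝ) < Y := by exact_mod_cast hY1
  have hlogY1 : Real.log Y ≤ 2 / 5 * l := by
    rw [← Real.log_exp (2 / 5 * l)]
    exact Real.log_le_log hY0 hYle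
  have hlogY2 : 2 / 5 * l - 1 ≤ Real.log Y := by
    rw [← Real.log_exp (2 / 5 * l - 1)]
    exact Real.log_le_log (Real.exp_pos _) hYge
  have hY2 : (Y : ℝ) ^ 2 ≤ Real.exp (4 / 5 * l) := by
    calc (Y : ℝ) ^ 2 ≤ Real.exp (2 / 5 * l) ^ 2 := by gcongr
      _ = _ := by rw [← Real.exp_nat_mul]; congr 1; push_cast; ring
  have hexp4 : (4 : ℝ) ≤ Real.exp (l / 5) := by linarith [Real.add_one_le_exp (l / 5)]
  have hsplitQ : Real.exp l = Real.exp (4 / 5 * l) * Real.exp (l / 5) := by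
    rw [← Real.exp_add]; ring_nf
  have hYQ : (Y : ℝ) ^ 2 ≤ Q / 4 := by
    rw [hQe, hsplitQ]
    nlinarith [Real.exp_pos (4 / 5 * l)]
  have hYdivQ : (Y : ℝ) ^ 2 / Q ≤ Real.exp (-(l / 5)) := by
    rw [div_le_iff₀ hQ0, hQe, ← Real.exp_add]
    refine hY2.trans (le_of_eq ?_)
    ring_nf
  have hb' : |b| / (Q : ℝ) ^ (σ + 1) ≤ Real.exp t :=
    hb.trans (Real.exp_le_exp.2 (by linarith))
  set main := Real.exp 11 * (1 + l) * Real.exp (-(2 / 10 ^ 6 * l / (k : ℝ) ^ 2)) with hmain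
  have hmain0 : 0 ≤ main := by positivity
  have hD : ∀ n ∈ Ioc A B, ‖∑ u ∈ Ico (0 : ℤ) Y, ∑ v ∈ Ico (0 : ℤ) Y,
      unitExp (twoTermPhase a b ρ σ (n + u * v))‖ ≤
      (Y : ℝ) ^ 2 * (main + Real.exp (-(l / 10))) := by
    intro n hn
    rw [mem_Ioc] at hn
    have hQn1 : (Q : ℝ) ≤ n := by exact_mod_cast (hA.trans hn.1.le)
    have hQn2 : (n : ℝ) ≤ 2 * Q := by exact_mod_cast (hn.2.trans hB)
    refine (norm_bilinear_twoTermPhase_le a b hQ0 hQn1 hYQ ρ σ k).trans ?_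
    rw [mul_add]
    refine add_le_add ?_ ?_
    · set G : Finset (Fin k) := {i : Fin k | 7 / 4 * (t / l) ≤ ((i.1 + 1 : ℕ) : ℝ) ∧
        ((i.1 + 1 : ℕ) : ℝ) ≤ 16 / 5 * (t / l)} with hG
      have hGi : ∀ i ∈ G, 7 / 4 * t ≤ ((i.1 + 1 : ℕ) : ℝ) * l ∧
          ((i.1 + 1 : ℕ) : ℝ) * l ≤ 16 / 5 * t ∧ ((i.1 + 1 : ℕ) : ℝ) ≤ k := by
        intro i hi
        rw [hG, mem_filter] at hi
        obtain ⟨-, h1, h2⟩ := hi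
        refine ⟨?_, ?_, by exact_mod_cast i.2⟩
        · rwa [← mul_div_assoc, div_le_iff₀ hlpos] at h1
        · rwa [← mul_div_assoc, le_div_iff₀ hlpos] at h2
      refine (norm_bilinear_sum_le hk6 hY1 _ G ?_ ?_ ?_).trans ?_
      · intro i hi
        obtain ⟨g1, g2, g3⟩ := hGi i hi
        generalize i.1 + 1 = m at g1 g2 g3 ⊢
        have c3 := abs_negPowCoeff_add_le hQe ha.le hb' hQn1 m
        have c4 : ((11 * k ^ 2 : ℕ) : ℝ) ≤ Real.exp (2 * k + 10) := by
          push_cast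
          have e1 := natCast_le_exp k
          have e2 : (11 : ℝ) ≤ Real.exp 10 := by linarith [Real.add_one_le_exp 10]
          rw [Real.exp_add, two_mul, Real.exp_add, mul_comm]
          have : (k : ℝ) ^ 2 ≤ Real.exp k * Real.exp k := by rw [sq]; gcongr
          gcongr
        have c5 : (Y : ℝ) ^ m ≤ Real.exp (2 / 5 * (m * l)) := by
          calc (Y : ℝ) ^ m ≤ Real.exp (2 / 5 * l) ^ m := by gcongr
            _ = _ := by rw [← Real.exp_nat_mul]; ring_nf
        calc _ ≤ Real.exp (t - m * l + (m + ρ + σ + 1)) *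
              (Real.exp (2 * k + 10) * Real.exp (2 / 5 * (m * l))) := by gcongr
          _ = Real.exp (t - m * l + (m + ρ + σ + 1) + (2 * k + 10 + 2 / 5 * (m * l))) := by
              rw [← Real.exp_add, ← Real.exp_add]
          _ ≤ Real.exp (-3) := Real.exp_le_exp.2 (by linarith)
          _ ≤ 1 / 4 := by
              rw [Real.exp_neg, ← one_div]
              exact one_div_le_one_div_of_le (by norm_num) (by linarith [Real.add_one_le_exp 3])
      · intro i hi
        obtain ⟨g1, g2, g3⟩ := hGi i hi
        generalize i.1 + 1 = m at g1 g2 g3 ⊢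
        have d3 := le_abs_negPowCoeff_add (m := m) hQe ha hb hQn1 hQn2 (by linarith)
        refine le_trans (Real.exp_le_exp.2 ?_) d3
        have e4 : (m : ℝ) * (2 / 5 * l - 1) ≤ m * Real.log Y := by gcongr
        nlinarith
      · exact sq_div_le_sum_filter (by rwa [le_div_iff₀ hlpos])
          (by rw [← mul_div_assoc, ← le_sub_iff_add_le, div_le_iff₀ hlpos]; linarith)
          (by rw [← mul_div_assoc, ← sub_le_iff_le_add, le_div_iff₀ hlpos]; linarith)
      · refine mul_le_mul_of_nonneg_left ?_ (by positivity)
        have g1 : 2 / 10 ^ 6 * l ≤ 7 / 10 ^ 6 * Real.log Y := by linarith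
        have g2 : 2 / 10 ^ 6 * l / (k : ℝ) ^ 2 ≤ 7 / 10 ^ 6 * Real.log Y / (k : ℝ) ^ 2 :=
          div_le_div_of_nonneg_right g1 (by positivity)
        rw [hmain]
        exact mul_le_mul (mul_le_mul_of_nonneg_left (by linarith) (Real.exp_pos _).le)
          (Real.exp_le_exp.2 (neg_le_neg g2)) (Real.exp_pos _).le (by positivity)
    · refine mul_le_mul_of_nonneg_left ?_ (by positivity)
      exact taylor_error_le_exp hQe ha.le hb' hYdivQ (by linarith)
  have hfin := norm_sum_Ioc_le_of_bilinear (fun x => unitExp (twoTermPhase a b ρ σ x))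
    (fun x => (norm_unitExp _).le) A B hY1 hD
  refine hfin.trans ?_
  have hcard : (#(Ioc A B) : ℝ) ≤ Q := by
    rw [Nat.card_Ioc]
    exact_mod_cast (by omega : B - A ≤ Q)
  have hYQ' : (Y : ℝ) ^ 2 ≤ Q * Real.exp (-(l / 10)) := by
    rw [hQe, ← Real.exp_add]
    exact hY2.trans (Real.exp_le_exp.2 (by linarith))
  calc _ ≤ Q * (main + Real.exp (-(l / 10))) + 2 * (Q * Real.exp (-(l / 10))) := by gcongr
    _ = _ := by ring

lemma tendsto_pow_mul_exp_neg_mul_rpow {c δ : ℝ} (hc : 0 < c) (hδ : 0 < δ) (n : ℕ) :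
    Filter.Tendsto (fun x : ℝ => x ^ n * Real.exp (-(c * x ^ δ))) Filter.atTop (nhds 0) := by
  have h := (tendsto_rpow_mul_exp_neg_mul_atTop_nhds_zero (n / δ) c hc).comp
    (tendsto_rpow_atTop hδ)
  refine h.congr' ?_
  filter_upwards [Filter.eventually_ge_atTop 0] with x hx
  simp only [Function.comp]
  rw [← Real.rpow_mul hx, mul_div_cancel₀ _ hδ.ne', Real.rpow_natCast, neg_mul]

lemma eventually_rpow_add_le {α : ℝ} (hα : α < 1) (C D : ℝ) {c : ℝ} (hc : 0 < c) :
    ∀ᶠ x : ℝ in Filter.atTop, C * x ^ α + D ≤ c * x := by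
  have h1 := (tendsto_rpow_neg_atTop (by linarith : 0 < 1 - α)).const_mul C
  rw [mul_zero] at h1
  filter_upwards [h1.eventually_le_const (half_pos hc), Filter.eventually_ge_atTop (2 * D / c),
    Filter.eventually_gt_atTop 0] with x h1 h2 h3
  have h4 : x ^ α = x ^ (-(1 - α)) * x := by
    rw [← Real.rpow_add_one h3.ne']
    ring_nf
  rw [div_le_iff₀ hc] at h2
  rw [h4, ← mul_assoc]
  nlinarith [mul_le_mul_of_nonneg_right h1 h3.le]

lemma eventually_mainTerm_le {δ : ℝ} (hδ : 0 < δ) (B : ℕ) :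
    ∀ᶠ l : ℝ in Filter.atTop, Real.exp 11 * (1 + l) * Real.exp (-(2 / 10 ^ 6 / 49 * l ^ (2 * δ))) +
      3 * Real.exp (-(l / 10)) ≤ 1 / l ^ B := by
  have h1 := (tendsto_pow_mul_exp_neg_mul_rpow (by norm_num : (0 : ℝ) < 2 / 10 ^ 6 / 49)
    (by linarith : 0 < 2 * δ) (B + 1)).const_mul (2 * Real.exp 11)
  have h2 := (tendsto_pow_mul_exp_neg_mul_rpow (by norm_num : (0 : ℝ) < 1 / 10) one_pos
    B).const_mul 3
  rw [mul_zero] at h1 h2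
  filter_upwards [h1.eventually_le_const (by norm_num : (0 : ℝ) < 1 / 2),
    h2.eventually_le_const (by norm_num : (0 : ℝ) < 1 / 2), Filter.eventually_ge_atTop 1]
    with l h1 h2 h3
  have hl : 0 < l := by linarith
  rw [le_div_iff₀ (by positivity), add_mul]
  rw [Real.rpow_one] at h2
  have e1 : Real.exp 11 * (1 + l) * Real.exp (-(2 / 10 ^ 6 / 49 * l ^ (2 * δ))) * l ^ B ≤
      2 * Real.exp 11 * (l ^ (B + 1) * Real.exp (-(2 / 10 ^ 6 / 49 * l ^ (2 * δ)))) := by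
    have : 2 * Real.exp 11 * (l ^ (B + 1) * Real.exp (-(2 / 10 ^ 6 / 49 * l ^ (2 * δ)))) =
        Real.exp 11 * (l + l) * Real.exp (-(2 / 10 ^ 6 / 49 * l ^ (2 * δ))) * l ^ B := by ring
    rw [this]
    gcongr
  have e2 : 3 * Real.exp (-(l / 10)) * l ^ B = 3 * (l ^ B * Real.exp (-(1 / 10 * l))) := by
    rw [show l / 10 = 1 / 10 * l by ring]
    ring
  linarith

/-- Saving of an arbitrary power of the logarithm for sums with phase
`a / y ^ (ρ + 1) + b / y ^ (σ + 1)`, in the range `log T ≤ (log Q) ^ (3 / 2 - δ)`. -/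
theorem exists_norm_sum_twoTermPhase_le {δ : ℝ} (hδ : 0 < δ) (hδ' : δ ≤ 1 / 2) (N : ℕ) :
    ∃ Q₀ : ℕ, ∀ Q : ℕ, Q₀ ≤ Q → ∀ (a b : ℝ) (ρ σ : ℕ), a ≠ 0 →
      (Q : ℝ) ^ ((9 : ℝ) / 10) ≤ |a| / (Q : ℝ) ^ (ρ + 1) →
      Real.log (|a| / (Q : ℝ) ^ (ρ + 1)) ≤ Real.log Q ^ (3 / 2 - δ) →
      |b| / (Q : ℝ) ^ (σ + 1) ≤ |a| / (Q : ℝ) ^ (ρ + 1) / (Q : ℝ) ^ ((1 : ℝ) / 2) →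
      (ρ : ℝ) ≤ Real.log Q ^ ((3 : ℝ) / 4) → (σ : ℝ) ≤ Real.log Q ^ ((3 : ℝ) / 4) →
      ∀ A B : ℕ, Q ≤ A → B ≤ 2 * Q →
      ‖∑ n ∈ Ioc A B, unitExp (twoTermPhase a b ρ σ n)‖ ≤ Q / Real.log Q ^ N := by
  have hev : ∀ᶠ Q : ℕ in Filter.atTop,
      2 * Real.log Q ^ ((3 : ℝ) / 4) + 0 ≤ 1 / 4000 * Real.log Q ∧
      50 * Real.log Q ^ (1 / 2 - δ) + 70 ≤ 1 / 4000 * Real.log Q ∧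
      Real.exp 11 * (1 + Real.log Q) *
        Real.exp (-(2 / 10 ^ 6 / 49 * Real.log Q ^ (2 * δ))) +
      3 * Real.exp (-(Real.log Q / 10)) ≤ 1 / Real.log Q ^ N ∧ 1 ≤ Real.log Q :=
    (Real.tendsto_log_atTop.comp tendsto_natCast_atTop_atTop).eventually
      (((eventually_rpow_add_le (by norm_num) 2 0 (by norm_num)).and
      ((eventually_rpow_add_le (by linarith) 50 70 (by norm_num)).and
      ((eventually_mainTerm_le hδ N).and (Filter.eventually_ge_atTop 1)))))
  obtain ⟨Q₀, hQ₀⟩ := Filter.eventually_atTop.1 hev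
  refine ⟨Q₀ + 1, fun Q hQ a b ρ σ ha hT1 hT2 hb hρ hσ A B hA hB => ?_⟩
  obtain ⟨h1, h2, h3, h4⟩ := hQ₀ Q (by omega)
  have hQ1 : 1 ≤ Q := by omega
  have hQpos : (0 : ℝ) < Q := by exact_mod_cast hQ1
  set l := Real.log Q with hl
  have hlpos : 0 < l := by linarith
  have hTpos : 0 < |a| / (Q : ℝ) ^ (ρ + 1) := div_pos (abs_pos.2 ha) (by positivity)
  set t := Real.log (|a| / (Q : ℝ) ^ (ρ + 1)) with ht
  have hTe : |a| / (Q : ℝ) ^ (ρ + 1) = Real.exp t := (Real.exp_log hTpos).symm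
  have ht1 : 9 / 10 * l ≤ t := by
    have := Real.log_le_log (by positivity) hT1
    rwa [Real.log_rpow hQpos] at this
  have ht0 : 0 ≤ t := le_trans (by positivity) ht1
  have hx0 : 0 ≤ l ^ (1 / 2 - δ) := by positivity
  have htl : t / l ≤ l ^ (1 / 2 - δ) := by
    rw [div_le_iff₀ hlpos, ← Real.rpow_add_one hlpos.ne']
    refine hT2.trans (le_of_eq ?_)
    congr 1
    ring
  set k := ⌈5 * (t / l)⌉₊ + 1 with hk
  have hk1 : 5 * (t / l) + 1 ≤ k := by
    rw [hk]; push_cast; gcongr; exact Nat.le_ceil _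
  have hk2 : (k : ℝ) ≤ 5 * (t / l) + 2 := by
    rw [hk]; push_cast
    linarith [Nat.ceil_lt_add_one (by positivity : 0 ≤ 5 * (t / l))]
  have htl' : t / l * l = t := by field_simp
  have hk0 : (0 : ℝ) < k := lt_of_lt_of_le (by positivity) hk1
  refine (norm_sum_twoTermPhase_le (k := k) hQ1 hTe ?_ ht1 ?_ ?_ ?_ hA hB).trans ?_
  · refine hb.trans (le_of_eq ?_)
    rw [hTe, Real.exp_sub, Real.rpow_def_of_pos hQpos, ← hl]
    ring_nf
  · nlinarith [mul_le_mul_of_nonneg_right hk1 hlpos.le]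
  · nlinarith [mul_le_mul_of_nonneg_right hk2 hlpos.le]
  · linarith
  · rw [← hl, div_eq_mul_one_div (Q : ℝ)]
    refine mul_le_mul_of_nonneg_left (le_trans ?_ h3) hQpos.le
    gcongr
    have hone : 1 ≤ l ^ (1 / 2 - δ) := Real.one_le_rpow h4 (by linarith)
    have hk7 : (k : ℝ) ≤ 7 * l ^ (1 / 2 - δ) := by linarith
    have hk49 : (k : ℝ) ^ 2 ≤ 49 * (l ^ (1 / 2 - δ)) ^ 2 := by
      calc (k : ℝ) ^ 2 ≤ (7 * l ^ (1 / 2 - δ)) ^ 2 := by gcongr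
        _ = _ := by ring
    have hll : l ^ (2 * δ) * (l ^ (1 / 2 - δ)) ^ 2 = l := by
      rw [← Real.rpow_natCast, ← Real.rpow_mul hlpos.le, ← Real.rpow_add hlpos]
      have : 2 * δ + (1 / 2 - δ) * ((2 : ℕ) : ℝ) = 1 := by push_cast; ring
      rw [this, Real.rpow_one]
    rw [le_div_iff₀ (by positivity)]
    have h0 : 0 ≤ l ^ (2 * δ) := by positivity
    nlinarith [mul_le_mul_of_nonneg_left hk49 h0]

/-! ### Vaughan's identity and sums over primes -/

lemma sum_Ioc_mul_eq_by_parts (w : ℕ → ℝ) (f : ℕ → ℂ) {A B : ℕ} (hAB : A < B) :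
    ∑ n ∈ Ioc A B, (w n : ℂ) * f n = w B * ∑ n ∈ Ioc A B, f n -
      ∑ n ∈ Ico (A + 1) B, ((w (n + 1) - w n : ℝ) : ℂ) * ∑ j ∈ Ioc A n, f j := by
  induction B, hAB using Nat.le_induction with
  | base => simp
  | succ B hAB ih =>
    have hA : A < B := hAB
    rw [← insert_Ioc_right_eq_Ioc_add_one (by omega), sum_insert (by simp), sum_insert (by simp),
      ih, ← insert_Ico_right_eq_Ico_add_one (by omega), sum_insert (by simp)]
    push_cast
    ring

lemma norm_sum_Ioc_mul_le_of_variation (w : ℕ → ℝ) (f : ℕ → ℂ) {A B : ℕ} {X V : ℝ} (hX0 : 0 ≤ X)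
    (hX : ∀ C, A ≤ C → C ≤ B → ‖∑ n ∈ Ioc A C, f n‖ ≤ X)
    (hV : |w B| + ∑ n ∈ Ico (A + 1) B, |w (n + 1) - w n| ≤ V) :
    ‖∑ n ∈ Ioc A B, (w n : ℂ) * f n‖ ≤ V * X := by
  rcases le_or_gt B A with hBA | hAB
  · rw [Ioc_eq_empty_of_le hBA, sum_empty, norm_zero]
    have hV0 : 0 ≤ V := le_trans (by positivity) hV
    positivity
  rw [sum_Ioc_mul_eq_by_parts w f hAB]
  refine (norm_sub_le _ _).trans ?_
  have h1 : ‖(w B : ℂ) * ∑ n ∈ Ioc A B, f n‖ ≤ |w B| * X := by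
    rw [norm_mul, Complex.norm_real, Real.norm_eq_abs]
    gcongr
    exact hX B hAB.le le_rfl
  have h2 : ‖∑ n ∈ Ico (A + 1) B, ((w (n + 1) - w n : ℝ) : ℂ) * ∑ j ∈ Ioc A n, f j‖ ≤
      (∑ n ∈ Ico (A + 1) B, |w (n + 1) - w n|) * X := by
    rw [sum_mul]
    refine norm_sum_le_of_le _ fun n hn => ?_
    rw [mem_Ico] at hn
    rw [norm_mul, Complex.norm_real, Real.norm_eq_abs]
    gcongr
    exact hX n (by omega) (by omega)
  calc _ ≤ (|w B| + ∑ n ∈ Ico (A + 1) B, |w (n + 1) - w n|) * X := by rw [add_mul]; gcongr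
    _ ≤ _ := by gcongr

lemma norm_sum_Ioc_log_mul_le (f : ℕ → ℂ) {A B : ℕ} {X : ℝ}
    (hX : ∀ C, C ≤ B → ‖∑ n ∈ Ioc A C, f n‖ ≤ X) :
    ‖∑ n ∈ Ioc A B, (Real.log n : ℂ) * f n‖ ≤ 2 * Real.log B * X := by
  have hX0 : 0 ≤ X := (norm_nonneg _).trans (hX 0 (Nat.zero_le _))
  rcases le_or_gt B A with hBA | hAB
  · rw [Ioc_eq_empty_of_le hBA, sum_empty, norm_zero]
    have := Real.log_natCast_nonneg B
    positivity
  refine norm_sum_Ioc_mul_le_of_variation (fun n => Real.log n) f hX0 (fun C _ hC => hX C hC) ?_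
  have hmono : ∀ n ∈ Ico (A + 1) B, |Real.log (n + 1 : ℕ) - Real.log n| =
      Real.log (n + 1 : ℕ) - Real.log n := by
    intro n hn
    rw [mem_Ico] at hn
    refine abs_of_nonneg (sub_nonneg.2 (Real.log_le_log ?_ ?_))
    · exact_mod_cast (by omega : 0 < n)
    · push_cast; linarith
  rw [sum_congr rfl hmono, sum_Ico_sub (fun n : ℕ => Real.log n) (by omega),
    abs_of_nonneg (Real.log_natCast_nonneg B)]
  have := Real.log_natCast_nonneg (A + 1)
  linarith

lemma sum_Ioc_arithmeticFunction_mul (f g : ArithmeticFunction ℝ) (h : ℕ → ℂ) (A B : ℕ) :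
    ∑ n ∈ Ioc A B, ((f * g) n : ℂ) * h n =
      ∑ d ∈ Ioc 0 B, (f d : ℂ) * ∑ m ∈ Ioc (A / d) (B / d), (g m : ℂ) * h (d * m) := by
  have h1 : ∀ n ∈ Ioc A B, ((f * g) n : ℂ) * h n =
      ∑ x ∈ (Ioc 0 B ×ˢ Ioc 0 B) with x.1 * x.2 = n, (f x.1 : ℂ) *
        ((g x.2 : ℂ) * h (x.1 * x.2)) := by
    intro n hn
    rw [mem_Ioc] at hn
    rw [ArithmeticFunction.mul_apply,
      Nat.divisorsAntidiagonal_eq_prod_filter_of_le (by omega) hn.2]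
    push_cast
    rw [sum_mul]
    refine sum_congr rfl fun x hx => ?_
    rw [(mem_filter.1 hx).2, mul_assoc]
  rw [sum_congr rfl h1, sum_fiberwise_eq_sum_filter, sum_filter, sum_product]
  refine sum_congr rfl fun d hd => ?_
  rw [mem_Ioc] at hd
  rw [mul_sum, ← sum_filter]
  refine sum_congr ?_ fun _ _ => rfl
  ext m
  rw [mem_filter, mem_Ioc, mem_Ioc, mem_Ioc, Nat.div_lt_iff_lt_mul hd.1,
    Nat.le_div_iff_mul_le hd.1, mul_comm m d]
  constructor
  · exact fun h => h.2
  · intro h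
    refine ⟨⟨?_, ?_⟩, h⟩
    · rcases Nat.eq_zero_or_pos m with rfl | hm
      · omega
      · exact hm
    · exact (Nat.le_mul_of_pos_left m hd.1).trans h.2

/-- The restriction of an arithmetic function to `[1, U]`. -/
def truncate (f : ArithmeticFunction ℝ) (U : ℕ) : ArithmeticFunction ℝ :=
  ⟨fun n => if n ≤ U then f n else 0, by simp⟩

lemma truncate_apply (f : ArithmeticFunction ℝ) (U n : ℕ) :
    truncate f U n = if n ≤ U then f n else 0 := rfl

section

open ArithmeticFunction ArithmeticFunction.zeta
  ArithmeticFunction.Moebius in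
/-- Vaughan's identity. -/
lemma vonMangoldt_eq_vaughan (U V : ℕ) : (Λ : ArithmeticFunction ℝ) = truncate Λ V +
    truncate μ U * log - truncate μ U * truncate Λ V * (ζ : ArithmeticFunction ℝ) +
    ((μ : ArithmeticFunction ℝ) - truncate μ U) *
      ((Λ - truncate Λ V) * (ζ : ArithmeticFunction ℝ)) := by
  have h1 : (Λ : ArithmeticFunction ℝ) * (ζ : ArithmeticFunction ℝ) = log := vonMangoldt_mul_zeta
  have h2 : (μ : ArithmeticFunction ℝ) * (ζ : ArithmeticFunction ℝ) = 1 := by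
    exact_mod_cast coe_moebius_mul_coe_zeta (R := ℝ)
  have h3 : ((μ : ArithmeticFunction ℝ) - truncate μ U) *
      ((Λ - truncate Λ V) * (ζ : ArithmeticFunction ℝ)) =
      (μ : ArithmeticFunction ℝ) * (ζ : ArithmeticFunction ℝ) * Λ -
      truncate μ U * (Λ * (ζ : ArithmeticFunction ℝ)) -
      (μ : ArithmeticFunction ℝ) * (ζ : ArithmeticFunction ℝ) * truncate Λ V +
      truncate μ U * truncate Λ V * (ζ : ArithmeticFunction ℝ) := by ring
  rw [h3, h1, h2]
  ring

end

lemma norm_sq_sum_bilinear_le {ι κ : Type*} [DecidableEq κ] (s : Finset ι) (t : Finset κ)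
    (α : ι → ℂ) (β : κ → ℂ) (φ : ι → κ → ℂ) {G W : ℝ} (hα : ∀ i ∈ s, ‖α i‖ ≤ 1)
    (hβ : ∀ k ∈ t, ‖β k‖ ≤ G) (hφ : ∀ i ∈ s, ∀ k ∈ t, ‖φ i k‖ ≤ 1)
    (hW : ∀ k ∈ t, ∀ l ∈ t, k ≠ l → ‖∑ i ∈ s, φ i k * starRingEnd ℂ (φ i l)‖ ≤ W) (hW0 : 0 ≤ W) :
    ‖∑ i ∈ s, α i * ∑ k ∈ t, β k * φ i k‖ ^ 2 ≤ #s * G ^ 2 * (#t * #s + (#t : ℝ) ^ 2 * W) := by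
  have h1 : ‖∑ i ∈ s, α i * ∑ k ∈ t, β k * φ i k‖ ^ 2 ≤
      #s * ∑ i ∈ s, ‖∑ k ∈ t, β k * φ i k‖ ^ 2 := by
    refine le_trans (pow_le_pow_left₀ (norm_nonneg _) (norm_sum_le_of_le s
      (f := fun i => α i * ∑ k ∈ t, β k * φ i k) (n := fun i => ‖∑ k ∈ t, β k * φ i k‖) ?_) 2)
      sq_sum_le_card_mul_sum_sq
    intro i hi
    rw [norm_mul]
    exact mul_le_of_le_one_left (norm_nonneg _) (hα i hi)
  have h2 : ((∑ i ∈ s, ‖∑ k ∈ t, β k * φ i k‖ ^ 2 : ℝ) : ℂ) =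
      ∑ k ∈ t, ∑ l ∈ t, β k * starRingEnd ℂ (β l) * ∑ i ∈ s, φ i k * starRingEnd ℂ (φ i l) := by
    push_cast
    simp_rw [mul_sum]
    have : ∀ k ∈ t, ∑ l ∈ t, ∑ i ∈ s, β k * starRingEnd ℂ (β l) * (φ i k * starRingEnd ℂ (φ i l)) =
        ∑ i ∈ s, ∑ l ∈ t, β k * starRingEnd ℂ (β l) * (φ i k * starRingEnd ℂ (φ i l)) :=
      fun k _ => sum_comm
    rw [sum_congr rfl this, sum_comm]
    refine sum_congr rfl fun i _ => ?_
    rw [← Complex.mul_conj', map_sum, sum_mul_sum]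
    refine sum_congr rfl fun k _ => sum_congr rfl fun l _ => ?_
    rw [map_mul]
    ring
  have h3 : ∑ i ∈ s, ‖∑ k ∈ t, β k * φ i k‖ ^ 2 ≤
      ∑ k ∈ t, ∑ l ∈ t, G ^ 2 * ((if k = l then (#s : ℝ) else 0) + W) := by
    have h0 : 0 ≤ ∑ i ∈ s, ‖∑ k ∈ t, β k * φ i k‖ ^ 2 := by positivity
    rw [← abs_of_nonneg h0, ← Real.norm_eq_abs, ← Complex.norm_real, h2]
    refine norm_sum_le_of_le t fun k hk => norm_sum_le_of_le t fun l hl => ?_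
    rw [norm_mul, norm_mul, RCLike.norm_conj, sq]
    have hG : 0 ≤ G := (norm_nonneg _).trans (hβ k hk)
    gcongr
    · exact hβ k hk
    · exact hβ l hl
    · split_ifs with h
      · refine le_add_of_le_of_nonneg ?_ hW0
        refine (norm_sum_le_of_le s (n := fun _ => (1 : ℝ)) fun i hi => ?_).trans (by simp)
        rw [norm_mul, RCLike.norm_conj]
        exact mul_le_one₀ (hφ i hi k hk) (norm_nonneg _) (hφ i hi l hl)
      · rw [zero_add]
        exact hW k hk l hl h
  calc _ ≤ _ := h1
    _ ≤ #s * ∑ k ∈ t, ∑ l ∈ t, G ^ 2 * ((if k = l then (#s : ℝ) else 0) + W) := by gcongr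
    _ = _ := by
      simp_rw [← mul_sum, sum_add_distrib, sum_ite_eq]
      rw [sum_ite_mem]
      simp only [inter_self, sum_const, nsmul_eq_mul]
      ring

/-- A dyadic block of a bilinear sum over the hyperbolic region `A < d m ≤ B`. -/
lemma norm_sq_dyadic_block_le (h : ℕ → ℂ) (hh : ∀ n, ‖h n‖ ≤ 1) {A B U M : ℕ} (hM : 0 < M)
    (α β : ℕ → ℂ) {G W : ℝ} (hα : ∀ d, ‖α d‖ ≤ 1) (hβ : ∀ m ≤ B, ‖β m‖ ≤ G)
    (hβ0 : ∀ m ≤ U, β m = 0) (hW0 : 0 ≤ W)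
    (hW : ∀ k ∈ Ioc U (B / M), ∀ l ∈ Ioc U (B / M), k ≠ l → ∀ A' B', M ≤ A' → B' ≤ 2 * M →
      ‖∑ d ∈ Ioc A' B', h (d * k) * starRingEnd ℂ (h (d * l))‖ ≤ W) :
    ‖∑ d ∈ Ioc M (2 * M), α d * ∑ m ∈ Ioc (A / d) (B / d), β m * h (d * m)‖ ^ 2 ≤
      G ^ 2 * (B * M + (B : ℝ) ^ 2 * W / M) := by
  have hM' : (0 : ℝ) < M := by exact_mod_cast hM
  have hinner : ∀ d ∈ Ioc M (2 * M), ∑ m ∈ Ioc (A / d) (B / d), β m * h (d * m) =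
      ∑ m ∈ Ioc U (B / M), β m * (if A < d * m ∧ d * m ≤ B then h (d * m) else 0) := by
    intro d hd
    rw [mem_Ioc] at hd
    have hd0 : 0 < d := by omega
    have hiff : ∀ m, m ∈ Ioc (A / d) (B / d) ↔ A < d * m ∧ d * m ≤ B := by
      intro m
      rw [mem_Ioc, Nat.div_lt_iff_lt_mul hd0, Nat.le_div_iff_mul_le hd0, mul_comm]
    have e1 : ∑ m ∈ Ioc (A / d) (B / d), β m * h (d * m) =
        ∑ m ∈ Ioc 0 (B / M), β m * (if A < d * m ∧ d * m ≤ B then h (d * m) else 0) := by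
      have : ∀ m ∈ Ioc (A / d) (B / d), β m * h (d * m) =
          β m * (if A < d * m ∧ d * m ≤ B then h (d * m) else 0) := fun m hm => by
        rw [if_pos ((hiff m).1 hm)]
      rw [sum_congr rfl this]
      refine sum_subset ?_ ?_
      · intro m hm
        rw [mem_Ioc] at hm ⊢
        exact ⟨(Nat.zero_le _).trans_lt hm.1, hm.2.trans (Nat.div_le_div_left hd.1.le hM)⟩
      · intro m _ hm
        rw [hiff] at hm
        rw [if_neg hm, mul_zero]
    rw [e1]
    symm
    refine sum_subset (Ioc_subset_Ioc_left (Nat.zero_le _)) ?_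
    intro m hm hm'
    rw [mem_Ioc] at hm hm'
    rw [hβ0 m (by omega), zero_mul]
  rw [sum_congr rfl fun d hd => by rw [hinner d hd]]
  have key := norm_sq_sum_bilinear_le (Ioc M (2 * M)) (Ioc U (B / M)) α β
    (fun d m => if A < d * m ∧ d * m ≤ B then h (d * m) else 0) (G := G) (W := W)
    (fun d _ => hα d)
    (fun m hm => hβ m (by rw [mem_Ioc] at hm; exact hm.2.trans (Nat.div_le_self _ _)))
    (fun d _ m _ => by split_ifs; exacts [hh _, by simp]) ?_ hW0
  · refine key.trans ?_
    have c1 : (#(Ioc M (2 * M)) : ℝ) = M := by rw [Nat.card_Ioc]; congr 1; omega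
    have c2 : (#(Ioc U (B / M)) : ℝ) ≤ B / M := by
      rw [Nat.card_Ioc]
      exact (Nat.cast_le.2 (Nat.sub_le _ _)).trans Nat.cast_div_le
    rw [c1]
    calc (M : ℝ) * G ^ 2 * (#(Ioc U (B / M)) * M + (#(Ioc U (B / M)) : ℝ) ^ 2 * W)
        ≤ (M : ℝ) * G ^ 2 * (B / M * M + (B / M : ℝ) ^ 2 * W) := by gcongr
      _ = _ := by field_simp
  · intro k hk l hl hkl
    have hk0 : 0 < k := by rw [mem_Ioc] at hk; omega
    have hl0 : 0 < l := by rw [mem_Ioc] at hl; omega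
    have : ∑ d ∈ Ioc M (2 * M), (if A < d * k ∧ d * k ≤ B then h (d * k) else 0) *
        starRingEnd ℂ (if A < d * l ∧ d * l ≤ B then h (d * l) else 0) =
        ∑ d ∈ Ioc (max M (max (A / k) (A / l))) (min (2 * M) (min (B / k) (B / l))),
          h (d * k) * starRingEnd ℂ (h (d * l)) := by
      have e : Ioc (max M (max (A / k) (A / l))) (min (2 * M) (min (B / k) (B / l))) =
          (Ioc M (2 * M)).filter fun d =>
            (A < d * k ∧ d * k ≤ B) ∧ (A < d * l ∧ d * l ≤ B) := by
        ext d
        simp only [mem_filter, mem_Ioc, max_lt_iff, le_min_iff, Nat.div_lt_iff_lt_mul hk0,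
          Nat.div_lt_iff_lt_mul hl0, Nat.le_div_iff_mul_le hk0, Nat.le_div_iff_mul_le hl0]
        tauto
      rw [e, sum_filter]
      refine sum_congr rfl fun d _ => ?_
      by_cases h1 : A < d * k ∧ d * k ≤ B <;> by_cases h2 : A < d * l ∧ d * l ≤ B <;> simp [h1, h2]
    rw [this]
    exact hW k hk l hl hkl _ _ (le_max_left _ _) (min_le_left _ _)

lemma abs_moebius_le_one_real (d : ℕ) : |(ArithmeticFunction.moebius d : ℝ)| ≤ 1 := by
  exact_mod_cast ArithmeticFunction.abs_moebius_le_one (n := d)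

lemma abs_truncate_moebius_le_one (U d : ℕ) :
    |truncate (ArithmeticFunction.moebius : ArithmeticFunction ℝ) U d| ≤ 1 := by
  rw [truncate_apply]
  split_ifs
  · exact abs_moebius_le_one_real d
  · simp

lemma abs_sub_truncate_moebius_le_one (U d : ℕ) :
    |((ArithmeticFunction.moebius : ArithmeticFunction ℝ) -
      truncate (ArithmeticFunction.moebius : ArithmeticFunction ℝ) U) d| ≤ 1 := by
  rw [sub_eq_add_neg, ArithmeticFunction.add_apply, ArithmeticFunction.neg_apply, truncate_apply]
  split_ifs
  · simp
  · simpa using abs_moebius_le_one_real d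

lemma truncate_vonMangoldt_nonneg (U d : ℕ) : 0 ≤ truncate ArithmeticFunction.vonMangoldt U d := by
  rw [truncate_apply]
  split_ifs
  · exact ArithmeticFunction.vonMangoldt_nonneg
  · exact le_rfl

lemma abs_truncate_moebius_mul_truncate_vonMangoldt_le (U d : ℕ) :
    |(truncate (ArithmeticFunction.moebius : ArithmeticFunction ℝ) U *
      truncate ArithmeticFunction.vonMangoldt U) d| ≤ Real.log d := by
  rw [ArithmeticFunction.mul_apply, ← ArithmeticFunction.vonMangoldt_sum,
    ← Nat.sum_divisorsAntidiagonal' (fun _ m => ArithmeticFunction.vonMangoldt m)]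
  refine (abs_sum_le_sum_abs _ _).trans (sum_le_sum fun x _ => ?_)
  rw [abs_mul, abs_of_nonneg (truncate_vonMangoldt_nonneg U _)]
  refine (mul_le_of_le_one_left (truncate_vonMangoldt_nonneg U _)
    (abs_truncate_moebius_le_one U _)).trans ?_
  rw [truncate_apply]
  split_ifs
  · exact le_rfl
  · exact ArithmeticFunction.vonMangoldt_nonneg

lemma truncate_mul_truncate_eq_zero (f g : ArithmeticFunction ℝ) {U d : ℕ} (hd : U ^ 2 < d) :
    (truncate f U * truncate g U) d = 0 := by
  rw [ArithmeticFunction.mul_apply]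
  refine sum_eq_zero fun x hx => ?_
  rw [Nat.mem_divisorsAntidiagonal] at hx
  rw [truncate_apply, truncate_apply]
  split_ifs with h1 h2
  · exfalso
    have := Nat.mul_le_mul h1 h2
    rw [← sq] at this
    omega
  all_goals simp

lemma vonMangoldt_sub_truncate_nonneg (U m : ℕ) :
    0 ≤ (ArithmeticFunction.vonMangoldt - truncate ArithmeticFunction.vonMangoldt U) m := by
  rw [sub_eq_add_neg, ArithmeticFunction.add_apply, ArithmeticFunction.neg_apply, truncate_apply]
  split_ifs
  · simp
  · simp

lemma abs_vonMangoldt_sub_truncate_mul_zeta_le (U m : ℕ) :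
    |((ArithmeticFunction.vonMangoldt - truncate ArithmeticFunction.vonMangoldt U) *
      (ArithmeticFunction.zeta : ArithmeticFunction ℝ)) m| ≤ Real.log m := by
  rw [ArithmeticFunction.coe_mul_zeta_apply, ← ArithmeticFunction.vonMangoldt_sum,
    abs_of_nonneg (sum_nonneg fun i _ => vonMangoldt_sub_truncate_nonneg U i)]
  refine sum_le_sum fun i _ => ?_
  rw [sub_eq_add_neg, ArithmeticFunction.add_apply, ArithmeticFunction.neg_apply]
  linarith [truncate_vonMangoldt_nonneg U i]

lemma vonMangoldt_sub_truncate_mul_zeta_eq_zero {U m : ℕ} (hm : m ≤ U) :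
    ((ArithmeticFunction.vonMangoldt - truncate ArithmeticFunction.vonMangoldt U) *
      (ArithmeticFunction.zeta : ArithmeticFunction ℝ)) m = 0 := by
  rw [ArithmeticFunction.coe_mul_zeta_apply]
  refine sum_eq_zero fun i hi => ?_
  have := Nat.divisor_le hi
  rw [sub_eq_add_neg, ArithmeticFunction.add_apply, ArithmeticFunction.neg_apply, truncate_apply,
    if_pos (by omega)]
  simp

lemma sum_Ioc_eq_sum_dyadic (f : ℕ → ℂ) (U J : ℕ) :
    ∑ d ∈ Ioc U (2 ^ J * U), f d =
      ∑ j ∈ range J, ∑ d ∈ Ioc (2 ^ j * U) (2 * (2 ^ j * U)), f d := by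
  induction J with
  | zero => simp
  | succ J ih =>
    rw [sum_range_succ, ← ih, ← mul_assoc, ← pow_succ']
    refine (sum_Ioc_consecutive f ?_ ?_).symm
    · exact Nat.le_mul_of_pos_left U (by positivity)
    · exact Nat.mul_le_mul_right U (Nat.pow_le_pow_right (by norm_num) (by omega))

lemma sum_Ioc_inv_le (M : ℕ) : ∑ d ∈ Ioc 0 M, (1 : ℝ) / d ≤ 1 + Real.log M := by
  refine le_of_eq_of_le ?_ (sum_range_inv_le M)
  induction M with
  | zero => simp
  | succ M ih =>
    rw [sum_range_succ, ← ih, ← insert_Ioc_right_eq_Ioc_add_one (Nat.zero_le _),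
      sum_insert (by simp), add_comm]
    push_cast
    rfl

section

variable (h : ℕ → ℂ) {A B U : ℕ} {η : ℝ}

lemma norm_sum_typeI_log_le (hUB : U ^ 2 ≤ B) (f : ArithmeticFunction ℝ)
    (hf : ∀ d, |f d| ≤ 1) (hf0 : ∀ d, U ^ 2 < d → f d = 0)
    (hI : ∀ d ∈ Ioc 0 (U ^ 2), ∀ C, C ≤ B / d → ‖∑ m ∈ Ioc (A / d) C, h (d * m)‖ ≤ B / d * η) :
    ‖∑ n ∈ Ioc A B, ((f * ArithmeticFunction.log) n : ℂ) * h n‖ ≤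
      2 * Real.log B * B * η * ∑ d ∈ Ioc 0 (U ^ 2), (1 : ℝ) / d := by
  rw [sum_Ioc_arithmeticFunction_mul, ← sum_subset (Ioc_subset_Ioc_right hUB), mul_sum]
  · refine norm_sum_le_of_le _ fun d hd => ?_
    have hI' : ∀ C, C ≤ B / d → ‖∑ m ∈ Ioc (A / d) C, h (d * m)‖ ≤ B / d * η := hI d hd
    rw [norm_mul, Complex.norm_real]
    refine (mul_le_of_le_one_left (norm_nonneg _) (hf d)).trans ?_
    refine (norm_sum_Ioc_log_mul_le (fun m => h (d * m)) hI').trans ?_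
    have h1 : Real.log (B / d : ℕ) ≤ Real.log B := by
      rcases Nat.eq_zero_or_pos (B / d) with h0 | h0
      · rw [h0, Nat.cast_zero, Real.log_zero]
        exact Real.log_natCast_nonneg B
      · exact Real.log_le_log (by exact_mod_cast h0) (by exact_mod_cast Nat.div_le_self B d)
    calc 2 * Real.log (B / d : ℕ) * (B / d * η) ≤ 2 * Real.log B * (B / d * η) := by
          have h0 := (norm_nonneg _).trans (hI' 0 (Nat.zero_le _))
          gcongr
      _ = _ := by ring
  · intro d hd' hd
    rw [mem_Ioc] at hd hd'
    rw [hf0 d (by omega), Complex.ofReal_zero, zero_mul]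

lemma norm_sum_typeI_le (hUB : U ^ 2 ≤ B) (f : ArithmeticFunction ℝ)
    (hf : ∀ d, |f d| ≤ Real.log d) (hf0 : ∀ d, U ^ 2 < d → f d = 0)
    (hI : ∀ d ∈ Ioc 0 (U ^ 2), ∀ C, C ≤ B / d → ‖∑ m ∈ Ioc (A / d) C, h (d * m)‖ ≤ B / d * η) :
    ‖∑ n ∈ Ioc A B, ((f * (ArithmeticFunction.zeta : ArithmeticFunction ℝ)) n : ℂ) * h n‖ ≤
      Real.log B * B * η * ∑ d ∈ Ioc 0 (U ^ 2), (1 : ℝ) / d := by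
  rw [sum_Ioc_arithmeticFunction_mul, ← sum_subset (Ioc_subset_Ioc_right hUB), mul_sum]
  · refine norm_sum_le_of_le _ fun d hd => ?_
    have hd' := mem_Ioc.1 hd
    have hz : ∑ m ∈ Ioc (A / d) (B / d),
        (((ArithmeticFunction.zeta : ArithmeticFunction ℝ) m : ℝ) : ℂ) * h (d * m) =
        ∑ m ∈ Ioc (A / d) (B / d), h (d * m) := by
      refine sum_congr rfl fun m hm => ?_
      rw [ArithmeticFunction.natCoe_apply, ArithmeticFunction.zeta_apply_ne
        ((Nat.zero_le _).trans_lt (mem_Ioc.1 hm).1).ne']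
      simp
    rw [hz, norm_mul, Complex.norm_real, Real.norm_eq_abs]
    have h1 : Real.log d ≤ Real.log B :=
      Real.log_le_log (by exact_mod_cast hd'.1) (by exact_mod_cast hd'.2.trans hUB)
    calc |f d| * ‖∑ m ∈ Ioc (A / d) (B / d), h (d * m)‖ ≤ Real.log B * (B / d * η) :=
          mul_le_mul ((hf d).trans h1) (hI d hd _ le_rfl) (norm_nonneg _)
            (Real.log_natCast_nonneg B)
      _ = _ := by ring
  · intro d hd' hd
    rw [mem_Ioc] at hd hd'
    rw [hf0 d (by omega), Complex.ofReal_zero, zero_mul]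

lemma norm_sum_typeII_le (hh : ∀ n, ‖h n‖ ≤ 1) (hU : 0 < U) (hB : 3 ≤ B) (hη : 1 / (U : ℝ) ≤ η)
    (f g : ArithmeticFunction ℝ) (hf : ∀ d, |f d| ≤ 1) (hf0 : ∀ d ≤ U, f d = 0)
    (hg : ∀ d, |g d| ≤ Real.log d) (hg0 : ∀ d ≤ U, g d = 0)
    (hII : ∀ M, U ≤ M → M * U ≤ B → ∀ k ∈ Ioc U (B / M), ∀ l ∈ Ioc U (B / M), k ≠ l →
      ∀ A' B', M ≤ A' → B' ≤ 2 * M →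
      ‖∑ d ∈ Ioc A' B', h (d * k) * starRingEnd ℂ (h (d * l))‖ ≤ M * η) :
    ‖∑ n ∈ Ioc A B, ((f * g) n : ℂ) * h n‖ ≤ 6 * Real.log B ^ 2 * B * √η := by
  set J := Nat.log 2 B + 1 with hJ
  have hlog : 1 ≤ Real.log B := by
    have : Real.log 3 ≤ Real.log B := Real.log_le_log (by norm_num) (by exact_mod_cast hB)
    linarith [Real.log_three_gt_d9]
  have hη0 : 0 ≤ η := le_trans (by positivity) hη
  have hJB : B < 2 ^ J := Nat.lt_pow_succ_log_self (by norm_num) B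
  have hJle : (J : ℝ) ≤ 3 * Real.log B := by
    have h1 : ((2 ^ Nat.log 2 B : ℕ) : ℝ) ≤ B := by
      exact_mod_cast Nat.pow_log_le_self 2 (by omega)
    have h2 := Real.log_le_log (by positivity) h1
    push_cast at h2
    rw [Real.log_pow] at h2
    rw [hJ]
    push_cast
    nlinarith [Real.log_two_gt_d9, (Nat.log 2 B).cast_nonneg (α := ℝ)]
  have hsum : ∑ n ∈ Ioc A B, ((f * g) n : ℂ) * h n = ∑ j ∈ range J,
      ∑ d ∈ Ioc (2 ^ j * U) (2 * (2 ^ j * U)),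
        (f d : ℂ) * ∑ m ∈ Ioc (A / d) (B / d), (g m : ℂ) * h (d * m) := by
    rw [sum_Ioc_arithmeticFunction_mul, ← sum_Ioc_eq_sum_dyadic]
    have hB2 : B ≤ 2 ^ J * U := hJB.le.trans (Nat.le_mul_of_pos_right _ hU)
    rw [sum_subset (Ioc_subset_Ioc_right hB2)]
    · symm
      refine sum_subset (Ioc_subset_Ioc_left (Nat.zero_le U)) fun d hd hd' => ?_
      rw [mem_Ioc] at hd hd'
      rw [hf0 d (by omega), Complex.ofReal_zero, zero_mul]
    · intro d hd hd'
      rw [mem_Ioc] at hd hd'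
      rw [Nat.div_eq_of_lt (by omega : B < d), Ioc_eq_empty_of_le (Nat.zero_le _), sum_empty,
        mul_zero]
  rw [hsum]
  have hblock : ∀ j ∈ range J, ‖∑ d ∈ Ioc (2 ^ j * U) (2 * (2 ^ j * U)),
      (f d : ℂ) * ∑ m ∈ Ioc (A / d) (B / d), (g m : ℂ) * h (d * m)‖ ≤
      2 * Real.log B * B * √η := by
    intro j _
    set M := 2 ^ j * U with hMdef
    have hUM : U ≤ M := Nat.le_mul_of_pos_left U (by positivity)
    have hM0 : 0 < M := hU.trans_le hUM
    by_cases hMB : M * U ≤ B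
    · have key := norm_sq_dyadic_block_le h hh (A := A) (B := B) (U := U) hM0 (fun d => (f d : ℂ))
        (fun m => (g m : ℂ)) (G := Real.log B) (W := M * η)
        (fun d => by rw [Complex.norm_real]; exact hf d)
        (fun m hm => ?_) (fun m hm => by rw [hg0 m hm, Complex.ofReal_zero]) (by positivity)
        (hII M hUM hMB)
      · refine (pow_le_pow_iff_left₀ (norm_nonneg _) (by positivity) two_ne_zero).1 (key.trans ?_)
        have hM' : (0 : ℝ) < M := by exact_mod_cast hM0
        have hU' : (0 : ℝ) < U := by exact_mod_cast hU
        have h1 : (M : ℝ) ≤ B * η := by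
          have : (M : ℝ) * U ≤ B := by exact_mod_cast hMB
          calc (M : ℝ) ≤ B / U := (le_div_iff₀ hU').2 this
            _ = B * (1 / U) := by ring
            _ ≤ B * η := by gcongr
        rw [mul_pow _ (√η), Real.sq_sqrt hη0]
        calc Real.log B ^ 2 * (B * M + (B : ℝ) ^ 2 * (M * η) / M)
            ≤ Real.log B ^ 2 * (B * (B * η) + (B : ℝ) ^ 2 * (M * η) / M) := by gcongr
          _ = 2 * (Real.log B ^ 2 * B ^ 2 * η) := by field_simp; ring
          _ ≤ 4 * (Real.log B ^ 2 * B ^ 2 * η) := by gcongr; norm_num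
          _ = _ := by ring
      · rw [Complex.norm_real]
        refine (hg m).trans ?_
        rcases Nat.eq_zero_or_pos m with rfl | h0
        · simpa using Real.log_natCast_nonneg B
        · exact Real.log_le_log (by exact_mod_cast h0) (by exact_mod_cast hm)
    · rw [sum_eq_zero, norm_zero]
      · positivity
      · intro d hd
        rw [mem_Ioc] at hd
        rw [sum_eq_zero, mul_zero]
        intro m hm
        rw [mem_Ioc, Nat.le_div_iff_mul_le (by omega)] at hm
        rw [hg0 m, Complex.ofReal_zero, zero_mul]
        by_contra hmU
        have : U * M ≤ m * d := Nat.mul_le_mul (by omega) hd.1.le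
        rw [mul_comm] at this
        omega
  refine (norm_sum_le_of_le _ hblock).trans ?_
  rw [sum_const, card_range, nsmul_eq_mul]
  calc (J : ℝ) * (2 * Real.log B * B * √η) ≤ 3 * Real.log B * (2 * Real.log B * B * √η) := by
        gcongr
    _ = _ := by ring

/-- Vaughan's estimate for sums over prime powers in terms of type I and type II information. -/
theorem norm_sum_vonMangoldt_mul_le (hh : ∀ n, ‖h n‖ ≤ 1) (hU : 0 < U)
    (hUA : U ≤ A) (hUB : U ^ 2 ≤ B) (hB : 3 ≤ B) (hη : 1 / (U : ℝ) ≤ η) (hη1 : η ≤ 1)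
    (hI : ∀ d ∈ Ioc 0 (U ^ 2), ∀ C, C ≤ B / d → ‖∑ m ∈ Ioc (A / d) C, h (d * m)‖ ≤ B / d * η)
    (hII : ∀ M, U ≤ M → M * U ≤ B → ∀ k ∈ Ioc U (B / M), ∀ l ∈ Ioc U (B / M), k ≠ l →
      ∀ A' B', M ≤ A' → B' ≤ 2 * M →
      ‖∑ d ∈ Ioc A' B', h (d * k) * starRingEnd ℂ (h (d * l))‖ ≤ M * η) :
    ‖∑ n ∈ Ioc A B, (ArithmeticFunction.vonMangoldt n : ℂ) * h n‖ ≤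
      12 * Real.log B ^ 2 * B * √η := by
  have hη0 : 0 ≤ η := le_trans (by positivity) hη
  have hdec : ∑ n ∈ Ioc A B, (ArithmeticFunction.vonMangoldt n : ℂ) * h n =
      ∑ n ∈ Ioc A B, ((truncate (ArithmeticFunction.moebius : ArithmeticFunction ℝ) U *
        ArithmeticFunction.log) n : ℂ) * h n -
      ∑ n ∈ Ioc A B, ((truncate (ArithmeticFunction.moebius : ArithmeticFunction ℝ) U *
        truncate ArithmeticFunction.vonMangoldt U *
        (ArithmeticFunction.zeta : ArithmeticFunction ℝ)) n : ℂ) * h n +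
      ∑ n ∈ Ioc A B, ((((ArithmeticFunction.moebius : ArithmeticFunction ℝ) -
        truncate (ArithmeticFunction.moebius : ArithmeticFunction ℝ) U) *
        ((ArithmeticFunction.vonMangoldt - truncate ArithmeticFunction.vonMangoldt U) *
        (ArithmeticFunction.zeta : ArithmeticFunction ℝ))) n : ℂ) * h n := by
    rw [← sum_sub_distrib, ← sum_add_distrib]
    refine sum_congr rfl fun n hn => ?_
    rw [mem_Ioc] at hn
    conv_lhs => rw [vonMangoldt_eq_vaughan U U]
    rw [ArithmeticFunction.add_apply, sub_eq_add_neg, ArithmeticFunction.add_apply,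
      ArithmeticFunction.add_apply, ArithmeticFunction.neg_apply, truncate_apply,
      if_neg (by omega)]
    push_cast
    ring
  have hUU : U ≤ U ^ 2 := Nat.le_self_pow (by norm_num) U
  have hlog : 1 ≤ Real.log B := by
    have : Real.log 3 ≤ Real.log B := Real.log_le_log (by norm_num) (by exact_mod_cast hB)
    linarith [Real.log_three_gt_d9]
  have hsum : ∑ d ∈ Ioc 0 (U ^ 2), (1 : ℝ) / d ≤ 2 * Real.log B := by
    refine (sum_Ioc_inv_le _).trans ?_
    have : Real.log (U ^ 2 : ℕ) ≤ Real.log B :=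
      Real.log_le_log (by exact_mod_cast pow_pos hU 2) (by exact_mod_cast hUB)
    linarith
  have h1 := norm_sum_typeI_log_le h hUB _ (abs_truncate_moebius_le_one U)
    (fun d hd => by rw [truncate_apply, if_neg (by omega)]) hI
  have h2 := norm_sum_typeI_le h hUB _ (abs_truncate_moebius_mul_truncate_vonMangoldt_le U)
    (fun d hd => truncate_mul_truncate_eq_zero _ _ hd) hI
  have h3 := norm_sum_typeII_le h (A := A) hh hU hB hη _ _ (abs_sub_truncate_moebius_le_one U)
    (fun d hd => by
      rw [sub_eq_add_neg, ArithmeticFunction.add_apply, ArithmeticFunction.neg_apply,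
        truncate_apply, if_pos hd, add_neg_cancel])
    (abs_vonMangoldt_sub_truncate_mul_zeta_le U)
    (fun d hd => vonMangoldt_sub_truncate_mul_zeta_eq_zero hd) hII
  have hηs : η ≤ √η := Real.le_sqrt_of_sq_le (by nlinarith)
  rw [hdec]
  refine (norm_add_le _ _).trans ((add_le_add ((norm_sub_le _ _).trans (add_le_add h1 h2))
    h3).trans ?_)
  calc _ = 3 * Real.log B * B * η * ∑ d ∈ Ioc 0 (U ^ 2), (1 : ℝ) / d +
        6 * Real.log B ^ 2 * B * √η := by ring
    _ ≤ 3 * Real.log B * B * √η * (2 * Real.log B) + 6 * Real.log B ^ 2 * B * √η := by gcongr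
    _ = _ := by ring

end

lemma eventually_log_pow_le_rpow (N : ℕ) {c : ℝ} (hc : 0 < c) :
    ∀ᶠ P : ℕ in Filter.atTop, Real.log P ^ N ≤ (P : ℝ) ^ c := by
  have h := (isLittleO_log_rpow_rpow_atTop (N : ℝ) hc).bound (c := 1) one_pos
  have h2 := tendsto_natCast_atTop_atTop (R := ℝ) |>.eventually h
  filter_upwards [h2] with P hP
  rw [one_mul, Real.rpow_natCast, Real.norm_eq_abs, Real.norm_eq_abs,
    abs_of_nonneg (Real.rpow_nonneg P.cast_nonneg _)] at hP
  exact (le_abs_self _).trans hP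

lemma eventually_le_log_natCast (C : ℝ) : ∀ᶠ P : ℕ in Filter.atTop, C ≤ Real.log P :=
  (Real.tendsto_log_atTop.comp tendsto_natCast_atTop_atTop).eventually_ge_atTop C

lemma eventually_le_log_natCast_rpow (C : ℝ) {c : ℝ} (hc : 0 < c) :
    ∀ᶠ P : ℕ in Filter.atTop, C ≤ Real.log P ^ c :=
  ((tendsto_rpow_atTop hc).comp
    (Real.tendsto_log_atTop.comp tendsto_natCast_atTop_atTop)).eventually_ge_atTop C

/-- Cancellation on intervals of length `M`, where `M` is at least a small power of `P`, with
all parameters measured in terms of `P`. -/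
lemma eventually_norm_sum_twoTermPhase_le {δ : ℝ} (hδ : 0 < δ) (hδ' : δ ≤ 1 / 2) (N : ℕ) :
    ∀ᶠ P : ℕ in Filter.atTop, ∀ (M : ℕ) (a b : ℝ) (σ : ℕ), (P : ℝ) ^ ((1 : ℝ) / 4) ≤ M → M ≤ P →
      P ≤ |a| / M → Real.log (|a| / M) ≤ Real.log P ^ (3 / 2 - δ) →
      |b| / (M : ℝ) ^ (σ + 1) ≤ |a| / M / (P : ℝ) ^ ((1 : ℝ) / 2) →
      σ ≤ Real.log P ^ ((1 : ℝ) / 2) → ∀ A B : ℕ, M ≤ A → B ≤ 2 * M →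
      ‖∑ n ∈ Ioc A B, unitExp (twoTermPhase a b 0 σ n)‖ ≤ M / Real.log P ^ N := by
  obtain ⟨Q₀, hQ₀⟩ := exists_norm_sum_twoTermPhase_le (δ := δ / 2) (by linarith) (by linarith)
    (N + 1)
  have hQ := ((tendsto_rpow_atTop (show (0 : ℝ) < 1 / 4 by norm_num)).comp
    (tendsto_natCast_atTop_atTop (R := ℝ))).eventually_ge_atTop (Q₀ : ℝ)
  filter_upwards [hQ, eventually_le_log_natCast (4 ^ (N + 1)),
    eventually_le_log_natCast_rpow (4 ^ (3 / 2 - δ / 2)) (show 0 < δ / 2 by linarith),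
    eventually_le_log_natCast_rpow (4 ^ ((3 : ℝ) / 4)) (show (0 : ℝ) < 1 / 4 by norm_num)]
    with P h1 h2 h3 h4 M a b σ hM hMP ha hla hb hσ A B hA hB
  have hl1 : 1 ≤ Real.log P := le_trans (one_le_pow₀ (by norm_num)) h2
  have hl0 : 0 < Real.log P := by linarith
  have hP0 : (0 : ℝ) < P := by
    by_contra h
    rw [le_antisymm (not_lt.1 h) P.cast_nonneg, Real.log_zero] at hl0
    exact lt_irrefl _ hl0
  have hP1 : (1 : ℝ) ≤ P := by
    have : 0 < P := by exact_mod_cast hP0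
    exact_mod_cast this
  have hM1 : (1 : ℝ) ≤ M := (Real.one_le_rpow hP1 (by norm_num)).trans hM
  have hM0 : (0 : ℝ) < M := by linarith
  have hMP' : (M : ℝ) ≤ P := by exact_mod_cast hMP
  have hlM : Real.log P / 4 ≤ Real.log M := by
    have := Real.log_le_log (by positivity) hM
    rw [Real.log_rpow hP0] at this
    linarith
  have ha0 : a ≠ 0 := by
    rintro rfl
    rw [abs_zero, zero_div] at ha
    linarith
  refine (hQ₀ M (by exact_mod_cast h1.trans hM) a b 0 σ ha0 ?_ ?_ ?_ ?_ ?_ A B hA hB).trans ?_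
  · rw [zero_add, pow_one]
    refine le_trans ?_ (hMP'.trans ha)
    calc (M : ℝ) ^ ((9 : ℝ) / 10) ≤ (M : ℝ) ^ (1 : ℝ) :=
          Real.rpow_le_rpow_of_exponent_le hM1 (by norm_num)
      _ = M := Real.rpow_one _
  · rw [zero_add, pow_one]
    refine hla.trans ?_
    calc Real.log P ^ (3 / 2 - δ) = Real.log P ^ (3 / 2 - δ / 2) / Real.log P ^ (δ / 2) := by
          rw [← Real.rpow_sub hl0]; ring_nf
      _ ≤ Real.log P ^ (3 / 2 - δ / 2) / 4 ^ (3 / 2 - δ / 2) := by gcongr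
      _ = (Real.log P / 4) ^ (3 / 2 - δ / 2) := by rw [Real.div_rpow hl0.le (by norm_num)]
      _ ≤ _ := Real.rpow_le_rpow (by positivity) hlM (by linarith)
  · rw [zero_add, pow_one]
    refine hb.trans ?_
    gcongr
  · rw [Nat.cast_zero]
    exact Real.rpow_nonneg (le_trans (by positivity) hlM) _
  · refine hσ.trans ?_
    calc Real.log P ^ ((1 : ℝ) / 2) = Real.log P ^ ((3 : ℝ) / 4) / Real.log P ^ ((1 : ℝ) / 4) := by
          rw [← Real.rpow_sub hl0]; norm_num
      _ ≤ Real.log P ^ ((3 : ℝ) / 4) / 4 ^ ((3 : ℝ) / 4) := by gcongr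
      _ = (Real.log P / 4) ^ ((3 : ℝ) / 4) := by rw [Real.div_rpow hl0.le (by norm_num)]
      _ ≤ _ := Real.rpow_le_rpow (by positivity) hlM (by norm_num)
  · gcongr
    calc Real.log P ^ N = Real.log P ^ N * 4 ^ (N + 1) / 4 ^ (N + 1) := by field_simp
      _ ≤ Real.log P ^ N * Real.log P / 4 ^ (N + 1) := by gcongr
      _ = (Real.log P / 4) ^ (N + 1) := by rw [div_pow, ← pow_succ]
      _ ≤ _ := by gcongr

lemma pow_sub_pow_le_mul_sub {x y : ℝ} (hy : 0 ≤ y) (hxy : y ≤ x) (n : ℕ) :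
    x ^ (n + 1) - y ^ (n + 1) ≤ (n + 1) * x ^ n * (x - y) := by
  induction n with
  | zero => simp
  | succ n ih =>
    have h1 : y ^ (n + 1) ≤ x ^ (n + 1) := by gcongr
    have h2 := mul_le_mul_of_nonneg_left ih (hy.trans hxy)
    have h3 := mul_le_mul_of_nonneg_right h1 (sub_nonneg.2 hxy)
    push_cast
    calc x ^ (n + 1 + 1) - y ^ (n + 1 + 1) =
        x * (x ^ (n + 1) - y ^ (n + 1)) + y ^ (n + 1) * (x - y) := by ring
      _ ≤ x * ((n + 1) * x ^ n * (x - y)) + x ^ (n + 1) * (x - y) := add_le_add h2 h3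
      _ = _ := by ring

/-- The shape of the differenced phase in a type II sum. -/
lemma twoTermPhase_mul_sub (a b : ℝ) (σ k l d : ℕ) :
    twoTermPhase a b 0 σ (d * k : ℕ) - twoTermPhase a b 0 σ (d * l : ℕ) =
      twoTermPhase (a * (1 / k - 1 / l)) (b * (1 / (k : ℝ) ^ (σ + 1) - 1 / (l : ℝ) ^ (σ + 1)))
        0 σ d := by
  unfold twoTermPhase
  push_cast
  simp only [mul_pow, div_eq_mul_inv, mul_inv, one_mul, pow_one]
  ring

lemma abs_one_div_pow_sub_le {U k l : ℕ} (hU : 0 < U) (hk : U ≤ k) (hl : U ≤ l) (σ : ℕ) :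
    |1 / (k : ℝ) ^ (σ + 1) - 1 / (l : ℝ) ^ (σ + 1)| ≤
      (σ + 1) * (1 / (U : ℝ)) ^ σ * |1 / (k : ℝ) - 1 / l| := by
  wlog hkl : k ≤ l generalizing k l
  · rw [abs_sub_comm, abs_sub_comm (1 / (k : ℝ))]
    exact this hl hk (by omega)
  have hU' : (0 : ℝ) < U := by exact_mod_cast hU
  have hk' : (U : ℝ) ≤ k := by exact_mod_cast hk
  have hk0 : (0 : ℝ) < k := hU'.trans_le hk'
  have hl0 : (0 : ℝ) < l := hk0.trans_le (by exact_mod_cast hkl)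
  have h1 : 1 / (l : ℝ) ≤ 1 / k := one_div_le_one_div_of_le hk0 (by exact_mod_cast hkl)
  have h2 : (1 / (l : ℝ)) ^ (σ + 1) ≤ (1 / (k : ℝ)) ^ (σ + 1) := by gcongr
  rw [← one_div_pow, ← one_div_pow, abs_of_nonneg (sub_nonneg.2 h2),
    abs_of_nonneg (sub_nonneg.2 h1)]
  refine (pow_sub_pow_le_mul_sub (by positivity) h1 σ).trans ?_
  have h3 := sub_nonneg.2 h1
  gcongr

/-- Parameters of Vaughan's identity for sums over `(P, 2 * P]`. -/
lemma eventually_exists_cutoff : ∀ᶠ P : ℕ in Filter.atTop, ∃ U : ℕ, 0 < U ∧ U ^ 3 ≤ P ∧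
    (P : ℝ) ^ ((3 : ℝ) / 10) ≤ U := by
  have h := ((tendsto_rpow_atTop (show (0 : ℝ) < 1 / 30 by norm_num)).comp
    (tendsto_natCast_atTop_atTop (R := ℝ))).eventually_ge_atTop 2
  filter_upwards [h, Filter.eventually_ge_atTop 1] with P hP hP1
  simp only [Function.comp] at hP
  have hP1' : (1 : ℝ) ≤ P := by exact_mod_cast hP1
  have hP0 : (0 : ℝ) < P := by linarith
  have h30 : 1 ≤ (P : ℝ) ^ ((3 : ℝ) / 10) := Real.one_le_rpow hP1' (by norm_num)
  have h13 : 2 * (P : ℝ) ^ ((3 : ℝ) / 10) ≤ (P : ℝ) ^ ((1 : ℝ) / 3) := by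
    have : (P : ℝ) ^ ((1 : ℝ) / 3) = (P : ℝ) ^ ((1 : ℝ) / 30) * (P : ℝ) ^ ((3 : ℝ) / 10) := by
      rw [← Real.rpow_add hP0]; norm_num
    rw [this]
    gcongr
  have hfl := Nat.lt_floor_add_one ((P : ℝ) ^ ((1 : ℝ) / 3))
  have hU : (P : ℝ) ^ ((3 : ℝ) / 10) ≤ ⌊(P : ℝ) ^ ((1 : ℝ) / 3)⌋₊ := by linarith
  refine ⟨⌊(P : ℝ) ^ ((1 : ℝ) / 3)⌋₊, ?_, ?_, hU⟩
  · have : (0 : ℝ) < ⌊(P : ℝ) ^ ((1 : ℝ) / 3)⌋₊ := by linarith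
    exact_mod_cast this
  · have h1 : ((⌊(P : ℝ) ^ ((1 : ℝ) / 3)⌋₊ : ℝ)) ^ 3 ≤ ((P : ℝ) ^ ((1 : ℝ) / 3)) ^ 3 := by
      gcongr
      exact Nat.floor_le (by positivity)
    rw [← Real.rpow_natCast (_ ^ _) 3, ← Real.rpow_mul hP0.le] at h1
    norm_num at h1
    exact_mod_cast h1

lemma twoTermPhase_mul (a b : ℝ) (σ d m : ℕ) :
    twoTermPhase a b 0 σ (d * m : ℕ) = twoTermPhase (a / d) (b / (d : ℝ) ^ (σ + 1)) 0 σ m := by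
  unfold twoTermPhase
  push_cast
  simp only [mul_pow, div_eq_mul_inv, mul_inv, mul_assoc, pow_one]

lemma eventually_norm_typeI_sum_le {δ : ℝ} (hδ : 0 < δ) (hδ' : δ ≤ 1 / 2) (N κ : ℕ) :
    ∀ᶠ P : ℕ in Filter.atTop, ∀ (U : ℕ), U ^ 3 ≤ P → (P : ℝ) ^ ((3 : ℝ) / 10) ≤ U →
      ∀ (a b : ℝ) (σ : ℕ), 1 ≤ σ → (P : ℝ) ^ 10 ≤ |a| → Real.log |a| ≤ Real.log P ^ (3 / 2 - δ) →
      |b| ≤ |a| * Real.log P ^ κ → σ ≤ Real.log P ^ ((1 : ℝ) / 2) →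
      ∀ A B : ℕ, P ≤ A → B ≤ 2 * P → ∀ d ∈ Ioc 0 (U ^ 2), ∀ C ≤ B / d,
      ‖∑ m ∈ Ioc (A / d) C, unitExp (twoTermPhase a b 0 σ (d * m : ℕ))‖ ≤
        P / d * (2 / Real.log P ^ N) := by
  filter_upwards [eventually_norm_sum_twoTermPhase_le hδ hδ' N,
    eventually_log_pow_le_rpow N (show (0 : ℝ) < 3 / 10 by norm_num),
    eventually_log_pow_le_rpow (κ + 1) (show (0 : ℝ) < 1 / 2 by norm_num),
    eventually_le_log_natCast 2, Filter.eventually_ge_atTop 1]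
    with P hP hN hκ hl hP1 U hU3 hU a b σ hσ1 ha hla hb hσ A B hA hB d hd C hC
  rw [mem_Ioc] at hd
  have hd0 : (0 : ℝ) < d := by exact_mod_cast hd.1
  have hP1' : (1 : ℝ) ≤ P := by exact_mod_cast hP1
  have hl0 : 0 < Real.log P := by linarith
  set M := P / d with hM
  have hUM : U ≤ M := by
    rw [hM, Nat.le_div_iff_mul_le hd.1]
    calc U * d ≤ U * U ^ 2 := Nat.mul_le_mul_left U hd.2
      _ = U ^ 3 := by ring
      _ ≤ P := hU3
  have hU1 : (1 : ℝ) ≤ U := (Real.one_le_rpow hP1' (by norm_num)).trans hU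
  have hUM' : (U : ℝ) ≤ M := by exact_mod_cast hUM
  have hM1 : (1 : ℝ) ≤ M := hU1.trans hUM'
  have hM0 : (0 : ℝ) < M := by linarith
  have hd1 : (1 : ℝ) ≤ d := by exact_mod_cast hd.1
  have hMPd : (M : ℝ) ≤ P / d := Nat.cast_div_le
  have hdM : (d : ℝ) * M ≤ P := by rwa [le_div_iff₀ hd0, mul_comm] at hMPd
  have hPdM : (P : ℝ) ≤ 2 * (d * M) := by
    have h1 : P < d * (M + 1) := Nat.lt_mul_div_succ P hd.1
    have h2 : (P : ℝ) < d * (M + 1) := by exact_mod_cast h1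
    nlinarith
  have hdM1 : 1 ≤ (d : ℝ) * M := by nlinarith
  have ha0 : 0 < |a| := lt_of_lt_of_le (by positivity) ha
  have hrw : ∀ E, ∑ m ∈ Ioc (A / d) E, unitExp (twoTermPhase a b 0 σ (d * m : ℕ)) =
      ∑ m ∈ Ioc (A / d) E, unitExp (twoTermPhase (a / d) (b / (d : ℝ) ^ (σ + 1)) 0 σ m) :=
    fun E => sum_congr rfl fun m _ => by rw [twoTermPhase_mul]
  have key : ∀ E, E ≤ 2 * M →
      ‖∑ m ∈ Ioc (A / d) E, unitExp (twoTermPhase a b 0 σ (d * m : ℕ))‖ ≤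
        M / Real.log P ^ N := by
    intro E hE
    rw [hrw]
    refine hP M (a / d) (b / (d : ℝ) ^ (σ + 1)) σ ?_ (Nat.div_le_self P d) ?_ ?_ ?_ hσ (A / d) E
      (Nat.div_le_div_right hA) hE
    · exact (Real.rpow_le_rpow_of_exponent_le hP1' (by norm_num)).trans (hU.trans hUM')
    · rw [abs_div, Nat.abs_cast, div_div, le_div_iff₀ (by positivity)]
      refine le_trans ?_ ha
      calc (P : ℝ) * (d * M) ≤ P * P := by gcongr
        _ = (P : ℝ) ^ 2 := by ring
        _ ≤ (P : ℝ) ^ 10 := pow_le_pow_right₀ hP1' (by norm_num)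
    · refine le_trans (Real.log_le_log ?_ ?_) hla
      · rw [abs_div, Nat.abs_cast]; positivity
      · rw [abs_div, Nat.abs_cast, div_div]
        exact div_le_self (abs_nonneg a) hdM1
    · rw [abs_div, abs_div, abs_pow, Nat.abs_cast, div_div, ← mul_pow, div_div, div_div]
      have h1 : (d : ℝ) * M ≤ (d * M : ℝ) ^ σ := le_self_pow₀ hdM1 (by omega)
      have h2 : Real.log P ^ κ * (P : ℝ) ^ ((1 : ℝ) / 2) ≤ d * M := by
        have h3 : Real.log P ^ κ * 2 ≤ (P : ℝ) ^ ((1 : ℝ) / 2) :=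
          le_trans (by rw [pow_succ]; gcongr) hκ
        have h4 : (P : ℝ) ^ ((1 : ℝ) / 2) * (P : ℝ) ^ ((1 : ℝ) / 2) = P := by
          rw [← Real.rpow_add (by linarith)]; norm_num
        nlinarith [Real.rpow_nonneg P.cast_nonneg ((1 : ℝ) / 2)]
      rw [div_le_div_iff₀ (by positivity) (by positivity)]
      calc |b| * (d * (M * (P : ℝ) ^ ((1 : ℝ) / 2)))
          ≤ |a| * Real.log P ^ κ * (d * (M * (P : ℝ) ^ ((1 : ℝ) / 2))) := by gcongr
        _ = |a| * (d * M * (Real.log P ^ κ * (P : ℝ) ^ ((1 : ℝ) / 2))) := by ring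
        _ ≤ |a| * (d * M * (d * M : ℝ) ^ σ) := by gcongr; exact h2.trans h1
        _ = _ := by ring
  have hone : 1 ≤ (P : ℝ) / d / Real.log P ^ N := by
    rw [one_le_div (by positivity)]
    linarith
  have hfin : (M : ℝ) / Real.log P ^ N + 1 ≤ P / d * (2 / Real.log P ^ N) := by
    have : (M : ℝ) / Real.log P ^ N ≤ P / d / Real.log P ^ N := by gcongr
    calc (M : ℝ) / Real.log P ^ N + 1 ≤ P / d / Real.log P ^ N + P / d / Real.log P ^ N :=
          add_le_add this hone
      _ = _ := by ring
  refine le_trans ?_ hfin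
  have hC2 : C ≤ 2 * M + 1 := by
    have h1 : B / d ≤ 2 * P / d := Nat.div_le_div_right hB
    have h2 : 2 * P / d < 2 * M + 2 := by
      rw [Nat.div_lt_iff_lt_mul hd.1]
      have := Nat.lt_mul_div_succ P hd.1
      rw [← hM] at this
      nlinarith
    omega
  rcases Nat.lt_or_ge (2 * M) C with h | h
  · obtain rfl : C = 2 * M + 1 := by omega
    rcases Nat.lt_or_ge (2 * M) (A / d) with h' | h'
    · rw [Ioc_eq_empty_of_le (by omega), sum_empty, norm_zero]
      positivity
    · rw [sum_Ioc_succ_top h']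
      refine (norm_add_le _ _).trans (add_le_add (key _ le_rfl) ?_)
      rw [norm_unitExp]
  · exact (key C h).trans (by linarith)

lemma one_div_mul_le_abs_one_div_sub {k l : ℕ} (hk : 0 < k) (hl : 0 < l) (hkl : k ≠ l) :
    1 / ((k : ℝ) * l) ≤ |1 / (k : ℝ) - 1 / l| := by
  have hk' : (0 : ℝ) < k := by exact_mod_cast hk
  have hl' : (0 : ℝ) < l := by exact_mod_cast hl
  have h1 : (1 : ℝ) ≤ |(l : ℝ) - k| := by
    have : (1 : ℤ) ≤ |(l : ℤ) - k| := Int.one_le_abs (by omega)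
    exact_mod_cast this
  rw [div_sub_div _ _ hk'.ne' hl'.ne', one_mul, mul_one, abs_div, abs_of_pos (mul_pos hk' hl')]
  gcongr

lemma eventually_norm_typeII_sum_le {δ : ℝ} (hδ : 0 < δ) (hδ' : δ ≤ 1 / 2) (N κ : ℕ) :
    ∀ᶠ P : ℕ in Filter.atTop, ∀ (U : ℕ), 0 < U → (P : ℝ) ^ ((3 : ℝ) / 10) ≤ U →
      ∀ (a b : ℝ) (σ : ℕ), 1 ≤ σ → (P : ℝ) ^ 10 ≤ |a| → Real.log |a| ≤ Real.log P ^ (3 / 2 - δ) →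
      |b| ≤ |a| * Real.log P ^ κ → σ ≤ Real.log P ^ ((1 : ℝ) / 2) →
      ∀ B : ℕ, B ≤ 2 * P → ∀ M, U ≤ M → M * U ≤ B → ∀ k ∈ Ioc U (B / M), ∀ l ∈ Ioc U (B / M),
      k ≠ l → ∀ A' B', M ≤ A' → B' ≤ 2 * M →
      ‖∑ d ∈ Ioc A' B', unitExp (twoTermPhase a b 0 σ (d * k : ℕ)) *
        starRingEnd ℂ (unitExp (twoTermPhase a b 0 σ (d * l : ℕ)))‖ ≤ M * (2 / Real.log P ^ N) := by
  filter_upwards [eventually_norm_sum_twoTermPhase_le hδ hδ' N,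
    eventually_log_pow_le_rpow 1 (show (0 : ℝ) < 3 / 10 by norm_num),
    eventually_log_pow_le_rpow (κ + 2) (show (0 : ℝ) < 1 / 10 by norm_num),
    eventually_le_log_natCast 2, Filter.eventually_ge_atTop 4]
    with P hP hN hκ hl2 hP4 U hU0 hU a b σ hσ1 ha hla hb hσ B hB M hUM hMB k hk l hl hkl
      A' B' hA' hB'
  rw [mem_Ioc] at hk hl
  have hP1' : (1 : ℝ) ≤ P := by exact_mod_cast (by omega : 1 ≤ P)
  have hP4' : (4 : ℝ) ≤ P := by exact_mod_cast hP4
  have hP0 : (0 : ℝ) < P := by linarith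
  have hl0 : 0 < Real.log P := by linarith
  have hUM' : (U : ℝ) ≤ M := by exact_mod_cast hUM
  have hU2 : (2 : ℝ) ≤ U := by rw [pow_one] at hN; linarith
  have hU0' : (0 : ℝ) < U := by linarith
  have hM0 : (0 : ℝ) < M := by linarith
  have hM1 : (1 : ℝ) ≤ M := by linarith
  have hMP : M ≤ P := by
    have : 2 ≤ U := by exact_mod_cast hU2
    nlinarith
  have ha0 : 0 < |a| := lt_of_lt_of_le (by positivity) ha
  have hrw : ∀ d ∈ Ioc A' B', unitExp (twoTermPhase a b 0 σ (d * k : ℕ)) *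
      starRingEnd ℂ (unitExp (twoTermPhase a b 0 σ (d * l : ℕ))) =
      unitExp (twoTermPhase (a * (1 / k - 1 / l))
        (b * (1 / (k : ℝ) ^ (σ + 1) - 1 / (l : ℝ) ^ (σ + 1))) 0 σ d) := fun d _ => by
    rw [conj_unitExp, ← unitExp_add, ← sub_eq_add_neg, twoTermPhase_mul_sub]
  rw [sum_congr rfl hrw]
  have hx := one_div_mul_le_abs_one_div_sub (by omega : 0 < k) (by omega : 0 < l) hkl
  set x := |1 / (k : ℝ) - 1 / l| with hxdef
  have hk0 : (0 : ℝ) < k := by exact_mod_cast (by omega : 0 < k)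
  have hl0' : (0 : ℝ) < l := by exact_mod_cast (by omega : 0 < l)
  have hx0 : 0 < x := lt_of_lt_of_le (by positivity) hx
  have hx1 : x ≤ 1 := by
    have h1 : (1 : ℝ) / k ≤ 1 := by
      rw [div_le_one hk0]; exact_mod_cast (by omega : 1 ≤ k)
    have h2 : (1 : ℝ) / l ≤ 1 := by
      rw [div_le_one hl0']; exact_mod_cast (by omega : 1 ≤ l)
    have h3 : 0 < (1 : ℝ) / k := by positivity
    have h4 : 0 < (1 : ℝ) / l := by positivity
    rw [hxdef, abs_le]
    constructor <;> linarith
  have hkP : (k : ℝ) ≤ 2 * P := by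
    exact_mod_cast hk.2.trans ((Nat.div_le_self _ _).trans hB)
  have hlM : (l : ℝ) * M ≤ 2 * P := by
    have h1 : l * M ≤ B := (Nat.le_div_iff_mul_le (by omega)).1 hl.2
    exact_mod_cast h1.trans hB
  refine (hP M _ _ σ ?_ hMP ?_ ?_ ?_ hσ A' B' hA' hB').trans ?_
  · exact (Real.rpow_le_rpow_of_exponent_le hP1' (by norm_num)).trans (hU.trans hUM')
  · rw [abs_mul, ← hxdef, le_div_iff₀ hM0]
    calc (P : ℝ) * M ≤ P * M * ((2 * P / k) * (2 * P / (l * M))) := by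
          refine le_mul_of_one_le_right (by positivity) (one_le_mul_of_one_le_of_one_le ?_ ?_)
          · rwa [one_le_div hk0]
          · rwa [one_le_div (by positivity)]
      _ = 4 * (P : ℝ) ^ 3 * (1 / (k * l)) := by field_simp; ring
      _ ≤ P * (P : ℝ) ^ 3 * (1 / (k * l)) := by gcongr
      _ = (P : ℝ) ^ 4 * (1 / (k * l)) := by ring
      _ ≤ (P : ℝ) ^ 10 * (1 / (k * l)) := by
        gcongr
        norm_num
      _ ≤ |a| * x := by gcongr
  · refine le_trans (Real.log_le_log ?_ ?_) hla
    · rw [abs_mul, ← hxdef]; positivity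
    · rw [abs_mul, ← hxdef]
      calc |a| * x / M ≤ |a| * x := div_le_self (by positivity) hM1
        _ ≤ |a| := mul_le_of_le_one_right ha0.le hx1
  · rw [abs_mul, abs_mul, ← hxdef]
    have h1 := abs_one_div_pow_sub_le hU0 hk.1.le hl.1.le σ
    rw [← hxdef] at h1
    have hσ' : (σ : ℝ) + 1 ≤ Real.log P ^ 2 := by
      have : Real.log P ^ ((1 : ℝ) / 2) ≤ Real.log P := by
        conv_rhs => rw [← Real.rpow_one (Real.log P)]
        exact Real.rpow_le_rpow_of_exponent_le (by linarith) (by norm_num)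
      nlinarith
    have hUM1 : 1 ≤ (U : ℝ) * M := by nlinarith
    have h2 : (U : ℝ) * M ≤ (U * M : ℝ) ^ σ := le_self_pow₀ hUM1 (by omega)
    have h3 : Real.log P ^ κ * (σ + 1) * (P : ℝ) ^ ((1 : ℝ) / 2) ≤ (U * M : ℝ) ^ σ := by
      calc Real.log P ^ κ * (σ + 1) * (P : ℝ) ^ ((1 : ℝ) / 2)
          ≤ Real.log P ^ κ * Real.log P ^ 2 * (P : ℝ) ^ ((1 : ℝ) / 2) := by gcongr
        _ = Real.log P ^ (κ + 2) * (P : ℝ) ^ ((1 : ℝ) / 2) := by rw [pow_add]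
        _ ≤ (P : ℝ) ^ ((1 : ℝ) / 10) * (P : ℝ) ^ ((1 : ℝ) / 2) := by gcongr
        _ = (P : ℝ) ^ ((3 : ℝ) / 10) * (P : ℝ) ^ ((3 : ℝ) / 10) := by
          rw [← Real.rpow_add hP0, ← Real.rpow_add hP0]; norm_num
        _ ≤ U * M := by gcongr; exact hU.trans hUM'
        _ ≤ _ := h2
    rw [div_div, div_le_div_iff₀ (by positivity) (by positivity)]
    calc |b| * |1 / (k : ℝ) ^ (σ + 1) - 1 / (l : ℝ) ^ (σ + 1)| * (M * (P : ℝ) ^ ((1 : ℝ) / 2))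
        ≤ (|a| * Real.log P ^ κ) * ((σ + 1) * (1 / (U : ℝ)) ^ σ * x) *
          (M * (P : ℝ) ^ ((1 : ℝ) / 2)) := by gcongr
      _ = |a| * x * M * (1 / (U : ℝ)) ^ σ *
          (Real.log P ^ κ * (σ + 1) * (P : ℝ) ^ ((1 : ℝ) / 2)) := by ring
      _ ≤ |a| * x * M * (1 / (U : ℝ)) ^ σ * (U * M : ℝ) ^ σ := by gcongr
      _ = |a| * x * (M * ((1 / (U : ℝ)) * (U * M)) ^ σ) := by rw [mul_pow]; ring
      _ = |a| * x * (M * (M : ℝ) ^ σ) := by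
        rw [← mul_assoc (1 / (U : ℝ)), one_div, inv_mul_cancel₀ hU0'.ne', one_mul]
      _ = _ := by ring
  · rw [← mul_div_assoc]
    gcongr
    linarith

lemma eventually_norm_sum_vonMangoldt_twoTermPhase_le {δ : ℝ} (hδ : 0 < δ) (hδ' : δ ≤ 1 / 2)
    (N κ : ℕ) : ∀ᶠ P : ℕ in Filter.atTop, ∀ (a b : ℝ) (σ : ℕ), 1 ≤ σ → (P : ℝ) ^ 10 ≤ |a| →
      Real.log |a| ≤ Real.log P ^ (3 / 2 - δ) → |b| ≤ |a| * Real.log P ^ κ →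
      σ ≤ Real.log P ^ ((1 : ℝ) / 2) → ∀ A B : ℕ, P ≤ A → B ≤ 2 * P →
      ‖∑ n ∈ Ioc A B, (ArithmeticFunction.vonMangoldt n : ℂ) * unitExp (twoTermPhase a b 0 σ n)‖ ≤
        P / Real.log P ^ N := by
  filter_upwards [eventually_norm_typeI_sum_le hδ hδ' (2 * (N + 4)) κ,
    eventually_norm_typeII_sum_le hδ hδ' (2 * (N + 4)) κ, eventually_exists_cutoff,
    eventually_log_pow_le_rpow (2 * (N + 4)) (show (0 : ℝ) < 3 / 10 by norm_num),
    eventually_le_log_natCast 136, Filter.eventually_ge_atTop 3]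
    with P hI hII hcut hN hl hP3 a b σ hσ1 ha hla hb hσ A B hA hB
  obtain ⟨U, hU0, hU3, hU⟩ := hcut
  have hl0 : 0 < Real.log P := by linarith
  have hP0 : (0 : ℝ) < P := by exact_mod_cast (by omega : 0 < P)
  rcases le_or_gt B A with hBA | hAB
  · rw [Ioc_eq_empty_of_le hBA, sum_empty, norm_zero]
    positivity
  have hPB : P ≤ B := by omega
  have hPB' : (P : ℝ) ≤ B := by exact_mod_cast hPB
  have hUU : U ≤ U ^ 3 := Nat.le_self_pow (by norm_num) U
  have hUU2 : U ^ 2 ≤ U ^ 3 := Nat.pow_le_pow_right hU0 (by norm_num)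
  have hpow : 1 ≤ Real.log P ^ (2 * (N + 4)) := one_le_pow₀ (by linarith)
  set η : ℝ := 2 / Real.log P ^ (2 * (N + 4)) with hη
  have hη1 : η ≤ 1 := by
    rw [hη, div_le_one (by positivity)]
    calc (2 : ℝ) ≤ Real.log P := by linarith
      _ ≤ _ := le_self_pow₀ (by linarith) (by omega)
  have hη2 : 1 / (U : ℝ) ≤ η := by
    rw [hη]
    exact div_le_div₀ (by norm_num) (by norm_num) (by positivity) (hN.trans hU)
  have key := norm_sum_vonMangoldt_mul_le (fun n => unitExp (twoTermPhase a b 0 σ n))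
    (fun n => (norm_unitExp _).le) hU0 (A := A) (B := B) (by omega) (by omega) (by omega) hη2 hη1
    (fun d hd C hC => (hI U hU3 hU a b σ hσ1 ha hla hb hσ A B hA hB d hd C hC).trans (by gcongr))
    (fun M hUM hMB k hk l hl hkl A' B' hA' hB' =>
      hII U hU0 hU a b σ hσ1 ha hla hb hσ B hB M hUM hMB k hk l hl hkl A' B' hA' hB')
  refine key.trans ?_
  have hB' : (B : ℝ) ≤ 2 * P := by exact_mod_cast hB
  have hlB : Real.log B ≤ 2 * Real.log P := by
    have h1 := Real.log_le_log (hP0.trans_le hPB') hB'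
    rw [Real.log_mul (by norm_num) hP0.ne'] at h1
    linarith [Real.log_two_lt_d9]
  have hlB0 : 0 ≤ Real.log B := Real.log_natCast_nonneg B
  have hsq : √η ≤ 2 / Real.log P ^ (N + 4) := by
    refine Real.sqrt_le_iff.2 ⟨by positivity, ?_⟩
    rw [hη, div_pow, ← pow_mul, mul_comm (N + 4) 2]
    gcongr
    norm_num
  calc 12 * Real.log B ^ 2 * B * √η
      ≤ 12 * (2 * Real.log P) ^ 2 * (2 * P) * (2 / Real.log P ^ (N + 4)) := by gcongr
    _ = 192 / Real.log P ^ 2 * (P / Real.log P ^ N) := by field_simp; ring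
    _ ≤ 1 * (P / Real.log P ^ N) := by
      gcongr
      rw [div_le_one (by positivity)]
      nlinarith
    _ = _ := one_mul _

lemma sum_vonMangoldt_not_prime_le {A B : ℕ} (hB : 1 ≤ B) :
    ∑ n ∈ Ioc A B with ¬ n.Prime, ArithmeticFunction.vonMangoldt n ≤
      2 * √B * Real.log B := by
  refine le_trans ?_ (Chebyshev.psi_sub_theta_le (x := B) (by exact_mod_cast hB))
  rw [Chebyshev.psi_sub_theta_eq_sum_not_prime, Nat.floor_natCast]
  exact sum_le_sum_of_subset_of_nonneg
    (filter_subset_filter _ (Ioc_subset_Ioc_left (Nat.zero_le _)))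
    fun _ _ _ => ArithmeticFunction.vonMangoldt_nonneg

theorem eventually_norm_sum_prime_twoTermPhase_le {δ : ℝ} (hδ : 0 < δ) (hδ' : δ ≤ 1 / 2)
    (N κ : ℕ) : ∀ᶠ P : ℕ in Filter.atTop, ∀ (a b : ℝ) (σ : ℕ), 1 ≤ σ → (P : ℝ) ^ 10 ≤ |a| →
      Real.log |a| ≤ Real.log P ^ (3 / 2 - δ) → |b| ≤ |a| * Real.log P ^ κ →
      σ ≤ Real.log P ^ ((1 : ℝ) / 2) → ∀ A B : ℕ, P ≤ A → B ≤ 2 * P →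
      ‖∑ p ∈ Ioc A B with p.Prime, (Real.log p : ℂ) * unitExp (twoTermPhase a b 0 σ p)‖ ≤
        P / Real.log P ^ N := by
  filter_upwards [eventually_norm_sum_vonMangoldt_twoTermPhase_le hδ hδ' (N + 1) κ,
    eventually_log_pow_le_rpow (N + 2) (show (0 : ℝ) < 1 / 2 by norm_num),
    eventually_le_log_natCast 10, Filter.eventually_ge_atTop 1]
    with P hP hN hl hP1 a b σ hσ1 ha hla hb hσ A B hA hB
  have hl0 : 0 < Real.log P := by linarith
  have hP0 : (0 : ℝ) < P := by exact_mod_cast hP1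
  rcases le_or_gt B A with hBA | hAB
  · rw [Ioc_eq_empty_of_le hBA, filter_empty, sum_empty, norm_zero]
    positivity
  have hB' : (B : ℝ) ≤ 2 * P := by exact_mod_cast hB
  have hPB' : (P : ℝ) ≤ B := by exact_mod_cast hA.trans hAB.le
  have hlB : Real.log B ≤ 2 * Real.log P := by
    have h1 := Real.log_le_log (hP0.trans_le hPB') hB'
    rw [Real.log_mul (by norm_num) hP0.ne'] at h1
    linarith [Real.log_two_lt_d9]
  have hsplit : ∑ p ∈ Ioc A B with p.Prime, (Real.log p : ℂ) * unitExp (twoTermPhase a b 0 σ p) =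
      ∑ n ∈ Ioc A B, (ArithmeticFunction.vonMangoldt n : ℂ) * unitExp (twoTermPhase a b 0 σ n) -
      ∑ n ∈ Ioc A B with ¬ n.Prime,
        (ArithmeticFunction.vonMangoldt n : ℂ) * unitExp (twoTermPhase a b 0 σ n) := by
    rw [← sum_filter_add_sum_filter_not (Ioc A B) Nat.Prime, add_sub_cancel_right]
    refine sum_congr rfl fun p hp => ?_
    rw [ArithmeticFunction.vonMangoldt_apply_prime (mem_filter.1 hp).2]
  have h2 : ‖∑ n ∈ Ioc A B with ¬ n.Prime,
      (ArithmeticFunction.vonMangoldt n : ℂ) * unitExp (twoTermPhase a b 0 σ n)‖ ≤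
      2 * √B * Real.log B := by
    refine (norm_sum_le_of_le _ fun n _ => ?_).trans
      (sum_vonMangoldt_not_prime_le (A := A) (by omega))
    rw [norm_mul, norm_unitExp, mul_one, Complex.norm_real, Real.norm_eq_abs,
      abs_of_nonneg ArithmeticFunction.vonMangoldt_nonneg]
  rw [hsplit]
  refine (norm_sub_le _ _).trans ((add_le_add (hP a b σ hσ1 ha hla hb hσ A B hA hB) h2).trans ?_)
  have hs : √(B : ℝ) ≤ 2 * (P : ℝ) ^ ((1 : ℝ) / 2) := by
    rw [Real.sqrt_le_iff]
    refine ⟨by positivity, ?_⟩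
    rw [mul_pow, ← Real.sqrt_eq_rpow, Real.sq_sqrt hP0.le]
    linarith
  have hPP : (P : ℝ) ^ ((1 : ℝ) / 2) * (P : ℝ) ^ ((1 : ℝ) / 2) = P := by
    rw [← Real.rpow_add hP0]; norm_num
  have h3 : 2 * √(B : ℝ) * Real.log B ≤ 8 * (P / Real.log P ^ (N + 1)) := by
    have : (P : ℝ) ^ ((1 : ℝ) / 2) * Real.log P ≤ P / Real.log P ^ (N + 1) := by
      rw [le_div_iff₀ (by positivity)]
      calc (P : ℝ) ^ ((1 : ℝ) / 2) * Real.log P * Real.log P ^ (N + 1)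
          = (P : ℝ) ^ ((1 : ℝ) / 2) * Real.log P ^ (N + 2) := by ring
        _ ≤ (P : ℝ) ^ ((1 : ℝ) / 2) * (P : ℝ) ^ ((1 : ℝ) / 2) := by gcongr
        _ = P := hPP
    calc 2 * √(B : ℝ) * Real.log B ≤ 2 * (2 * (P : ℝ) ^ ((1 : ℝ) / 2)) * (2 * Real.log P) := by
          gcongr
      _ = 8 * ((P : ℝ) ^ ((1 : ℝ) / 2) * Real.log P) := by ring
      _ ≤ _ := by gcongr
  calc (P : ℝ) / Real.log P ^ (N + 1) + 2 * √(B : ℝ) * Real.log B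
      ≤ 9 / Real.log P * (P / Real.log P ^ N) := by
        have : 9 / Real.log P * (P / Real.log P ^ N) = 9 * (P / Real.log P ^ (N + 1)) := by
          rw [pow_succ]; field_simp
        rw [this]; linarith
    _ ≤ 1 * (P / Real.log P ^ N) := by
      gcongr
      rw [div_le_one hl0]; linarith
    _ = _ := one_mul _

/-! ### The sawtooth function -/

/-- The periodized second Bernoulli polynomial. -/
noncomputable def bernoulliTwo (y : ℝ) : ℝ := Int.fract y ^ 2 - Int.fract y + 1 / 6

lemma hasSum_bernoulliTwo (y : ℝ) :
    HasSum (fun k : ℕ => Real.cos (2 * Real.pi * k * y) / (Real.pi ^ 2 * (k : ℝ) ^ 2))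
      (bernoulliTwo y) := by
  have h := (hasSum_one_div_nat_pow_mul_cos one_ne_zero (x := Int.fract y)
    ⟨Int.fract_nonneg y, (Int.fract_lt_one y).le⟩).mul_left (1 / Real.pi ^ 2)
  have hB : (Polynomial.map (algebraMap ℚ ℝ) (Polynomial.bernoulli (2 * 1))).eval (Int.fract y) =
      bernoulliTwo y := by
    rw [mul_one, Polynomial.bernoulli_def]
    simp [bernoulliTwo, sum_range_succ, Polynomial.eval_monomial, bernoulli_two]
    ring
  rw [hB] at h
  convert! h using 1
  · ext k
    have : Real.cos (2 * Real.pi * k * y) = Real.cos (2 * Real.pi * k * Int.fract y) := by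
      have e : 2 * Real.pi * k * y =
          2 * Real.pi * k * Int.fract y + ((k * ⌊y⌋ : ℤ) : ℝ) * (2 * Real.pi) := by
        conv_lhs => rw [← Int.fract_add_floor y]
        push_cast
        ring
      rw [e, Real.cos_add_int_mul_two_pi]
    rw [this]
    simp only [mul_one]
    ring
  · simp only [mul_one, Nat.factorial]
    field_simp
    norm_num

/-- A Lipschitz approximation of the sawtooth function `fract y - 1/2`. -/
noncomputable def smoothSawtooth (δ y : ℝ) : ℝ :=
  (bernoulliTwo (y + δ) - bernoulliTwo y) / (2 * δ)

lemma fract_add_of_lt {y h : ℝ} (hh : 0 ≤ h) (h1 : Int.fract y + h < 1) :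
    Int.fract (y + h) = Int.fract y + h := by
  rw [Int.fract_eq_iff]
  refine ⟨add_nonneg (Int.fract_nonneg y) hh, h1, ⌊y⌋, ?_⟩
  have := Int.fract_add_floor y
  linarith

lemma fract_add_of_ge {y h : ℝ} (hh : h < 1) (h1 : 1 ≤ Int.fract y + h) :
    Int.fract (y + h) = Int.fract y + h - 1 := by
  rw [Int.fract_eq_iff]
  refine ⟨by linarith, by linarith [Int.fract_lt_one y], ⌊y⌋ + 1, ?_⟩
  have := Int.fract_add_floor y
  push_cast
  linarith

lemma fract_sub_of_ge {y h : ℝ} (hh : 0 ≤ h) (h1 : h ≤ Int.fract y) :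
    Int.fract (y - h) = Int.fract y - h := by
  rw [Int.fract_eq_iff]
  refine ⟨by linarith, by linarith [Int.fract_lt_one y], ⌊y⌋, ?_⟩
  have := Int.fract_add_floor y
  linarith

lemma fract_sub_of_lt {y h : ℝ} (hh : h < 1) (h1 : Int.fract y < h) :
    Int.fract (y - h) = Int.fract y - h + 1 := by
  rw [Int.fract_eq_iff]
  refine ⟨by linarith [Int.fract_nonneg y], by linarith, ⌊y⌋ - 1, ?_⟩
  have := Int.fract_add_floor y
  push_cast
  linarith

lemma abs_fract_sub_smoothSawtooth_le {δ : ℝ} (hδ : 0 < δ) (hδ1 : δ < 1) (y : ℝ) :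
    |Int.fract y - 1 / 2 - smoothSawtooth δ y| ≤
      δ / 2 + if 1 - δ ≤ Int.fract y then 1 else 0 := by
  have h0 := Int.fract_nonneg y
  have h1 := Int.fract_lt_one y
  unfold smoothSawtooth bernoulliTwo
  split_ifs with h
  · rw [fract_add_of_ge hδ1 (by linarith)]
    set u := Int.fract y
    have e : u - 1 / 2 - ((u + δ - 1) ^ 2 - (u + δ - 1) + 1 / 6 - (u ^ 2 - u + 1 / 6)) / (2 * δ) =
        u - 1 / 2 - (1 - δ) * (2 * (1 - u) - δ) / (2 * δ) := by
      field_simp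
      ring
    rw [e]
    have h2 : |(1 - δ) * (2 * (1 - u) - δ) / (2 * δ)| ≤ 1 / 2 := by
      rw [abs_div, abs_of_pos (by positivity : 0 < 2 * δ), div_le_iff₀ (by positivity), abs_le]
      constructor <;> nlinarith
    have h3 : |u - 1 / 2| ≤ 1 / 2 := by
      rw [abs_le]
      constructor <;> linarith
    linarith [abs_sub (u - 1 / 2) ((1 - δ) * (2 * (1 - u) - δ) / (2 * δ))]
  · rw [fract_add_of_lt hδ.le (by linarith)]
    set u := Int.fract y
    have e : u - 1 / 2 - ((u + δ) ^ 2 - (u + δ) + 1 / 6 - (u ^ 2 - u + 1 / 6)) / (2 * δ) =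
        -(δ / 2) := by
      field_simp
      ring
    rw [e, abs_neg, abs_of_pos (by positivity), add_zero]

lemma hasSum_smoothSawtooth {δ : ℝ} (hδ : 0 < δ) (y : ℝ) :
    HasSum (fun k : ℕ => -(Real.sin (Real.pi * k * δ) / (Real.pi ^ 2 * (k : ℝ) ^ 2 * δ)) *
      Real.sin (2 * Real.pi * k * (y + δ / 2))) (smoothSawtooth δ y) := by
  have h := ((hasSum_bernoulliTwo (y + δ)).sub (hasSum_bernoulliTwo y)).div_const (2 * δ)
  convert! h using 1
  ext k
  have := Real.cos_sub_cos (2 * Real.pi * k * (y + δ)) (2 * Real.pi * k * y)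
  rw [← sub_div, this]
  have e1 : (2 * Real.pi * k * (y + δ) + 2 * Real.pi * k * y) / 2 =
    2 * Real.pi * k * (y + δ / 2) := by ring
  have e2 : (2 * Real.pi * k * (y + δ) - 2 * Real.pi * k * y) / 2 = Real.pi * k * δ := by ring
  rw [e1, e2]
  field_simp

lemma abs_sub_sum_Icc_le_of_hasSum {f : ℕ → ℝ} {S C : ℝ} (hf : HasSum f S) (h0 : f 0 = 0)
    (hC : ∀ k : ℕ, 1 ≤ k → |f k| ≤ C / (k : ℝ) ^ 2) {K : ℕ} (hK : 1 ≤ K) :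
    |S - ∑ k ∈ Icc 1 K, f k| ≤ C / K := by
  have hC0 : 0 ≤ C := by simpa using (abs_nonneg _).trans (hC 1 le_rfl)
  have ht := (hf.tendsto_sum_nat.sub_const (∑ k ∈ Icc 1 K, f k)).abs
  refine le_of_tendsto ht ?_
  filter_upwards [Filter.eventually_gt_atTop K] with M hM
  have e : ∑ k ∈ range M, f k - ∑ k ∈ Icc 1 K, f k = ∑ k ∈ Ioc K (M - 1), f k := by
    have h1 : range M = insert 0 (Icc 1 K ∪ Ioc K (M - 1)) := by
      ext k
      simp only [mem_range, mem_insert, mem_union, mem_Icc, mem_Ioc]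
      omega
    have h2 : Disjoint (Icc 1 K) (Ioc K (M - 1)) := by
      rw [disjoint_left]
      intro k
      simp only [mem_Icc, mem_Ioc]
      omega
    rw [h1, sum_insert (by simp), h0, sum_union h2]
    ring
  rw [e]
  have h1 : ∑ k ∈ Ioc K (M - 1), ((k : ℝ) ^ 2)⁻¹ ≤ (K : ℝ)⁻¹ := by
    refine (sum_Ioc_inv_sq_le_sub (by omega) (by omega)).trans ?_
    have : (0 : ℝ) ≤ ((M - 1 : ℕ) : ℝ)⁻¹ := by positivity
    linarith
  calc |∑ k ∈ Ioc K (M - 1), f k| ≤ ∑ k ∈ Ioc K (M - 1), |f k| := abs_sum_le_sum_abs _ _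
    _ ≤ ∑ k ∈ Ioc K (M - 1), C * ((k : ℝ) ^ 2)⁻¹ := sum_le_sum fun k hk => by
      rw [mem_Ioc] at hk
      rw [← div_eq_mul_inv]
      exact hC k (by omega)
    _ = C * ∑ k ∈ Ioc K (M - 1), ((k : ℝ) ^ 2)⁻¹ := (mul_sum _ _ _).symm
    _ ≤ C * (K : ℝ)⁻¹ := by gcongr
    _ = _ := (div_eq_mul_inv _ _).symm

lemma unitExp_eq_cos_add_sin (x : ℝ) :
    unitExp x = Real.cos (2 * Real.pi * x) + Real.sin (2 * Real.pi * x) * Complex.I := by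
  rw [unitExp, Complex.ofReal_cos, Complex.ofReal_sin, ← Complex.exp_mul_I]

lemma unitExp_re (x : ℝ) : (unitExp x).re = Real.cos (2 * Real.pi * x) := by
  rw [unitExp_eq_cos_add_sin]
  simp [-Complex.ofReal_cos, -Complex.ofReal_sin]

/-- A nonnegative function supported near the integers, with absolutely convergent
Fourier series. -/
noncomputable def periodicTent (h y : ℝ) : ℝ :=
  h ^ 2 - (bernoulliTwo (y + h) - 2 * bernoulliTwo y + bernoulliTwo (y - h)) / 2

lemma periodicTent_nonneg {h : ℝ} (hh : 0 < h) (hh1 : h ≤ 1 / 2) (y : ℝ) :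
    0 ≤ periodicTent h y := by
  unfold periodicTent bernoulliTwo
  rcases lt_or_ge (Int.fract y + h) 1 with h1 | h1
  · rcases lt_or_ge (Int.fract y) h with h2 | h2
    · rw [fract_add_of_lt hh.le h1, fract_sub_of_lt (by linarith) h2]
      nlinarith
    · rw [fract_add_of_lt hh.le h1, fract_sub_of_ge hh.le h2]
      nlinarith
  · rw [fract_add_of_ge (by linarith) h1, fract_sub_of_ge hh.le (by linarith)]
    nlinarith

lemma le_periodicTent {δ : ℝ} (hδ : 0 < δ) (hδ1 : δ ≤ 1 / 4) {y : ℝ}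
    (hy : 1 - δ ≤ Int.fract y) : δ ≤ periodicTent (2 * δ) y := by
  unfold periodicTent bernoulliTwo
  rw [fract_add_of_ge (by linarith) (by linarith),
    fract_sub_of_ge (by positivity) (by linarith)]
  nlinarith

lemma hasSum_periodicTent (h y : ℝ) :
    HasSum (fun k : ℕ => (1 - Real.cos (2 * Real.pi * k * h)) / (Real.pi ^ 2 * (k : ℝ) ^ 2) *
      Real.cos (2 * Real.pi * k * y)) (periodicTent h y - h ^ 2) := by
  have H := ((((hasSum_bernoulliTwo (y + h)).sub ((hasSum_bernoulliTwo y).mul_left 2)).add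
    (hasSum_bernoulliTwo (y - h))).div_const 2).neg
  convert! H using 1
  · ext k
    have e1 : Real.cos (2 * Real.pi * k * (y + h)) + Real.cos (2 * Real.pi * k * (y - h)) =
        2 * Real.cos (2 * Real.pi * k * y) * Real.cos (2 * Real.pi * k * h) := by
      rw [mul_add, mul_sub, Real.cos_add, Real.cos_sub]
      ring
    rcases eq_or_ne k 0 with rfl | hk
    · simp
    · field_simp
      linear_combination e1
  · rw [periodicTent]
    ring

lemma card_one_sub_le_fract_le {δ E : ℝ} (hδ : 0 < δ) (hδ1 : δ ≤ 1 / 4) {K : ℕ}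
    (hK : 1 ≤ K) (D : Finset ℕ) (y : ℕ → ℝ)
    (hE : ∀ k ∈ Icc 1 K, ‖∑ d ∈ D, unitExp (k * y d)‖ ≤ E) :
    δ * #{d ∈ D | 1 - δ ≤ Int.fract (y d)} ≤ 4 * δ ^ 2 * #D + K * E + #D / K := by
  set c : ℕ → ℝ := fun k =>
    (1 - Real.cos (2 * Real.pi * k * (2 * δ))) / (Real.pi ^ 2 * (k : ℝ) ^ 2) with hc
  have hpi : 2 ≤ Real.pi ^ 2 := by nlinarith [Real.pi_gt_three]
  have hcos : ∀ k : ℕ, |1 - Real.cos (2 * Real.pi * k * (2 * δ))| ≤ 2 := fun k => by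
    rw [abs_le]
    constructor <;> linarith [Real.cos_le_one (2 * Real.pi * k * (2 * δ)),
      Real.neg_one_le_cos (2 * Real.pi * k * (2 * δ))]
  have hc1 : ∀ k : ℕ, 1 ≤ k → |c k| ≤ 1 / (k : ℝ) ^ 2 := fun k hk => by
    have hk' : (0 : ℝ) < k := by exact_mod_cast hk
    rw [hc]
    simp only
    rw [abs_div, abs_of_pos (by positivity : 0 < Real.pi ^ 2 * (k : ℝ) ^ 2),
      div_le_div_iff₀ (by positivity) (by positivity)]
    nlinarith [hcos k, sq_nonneg (k : ℝ)]
  have hpt : ∀ d, |periodicTent (2 * δ) (y d) - (2 * δ) ^ 2 -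
      ∑ k ∈ Icc 1 K, c k * Real.cos (2 * Real.pi * k * y d)| ≤ 1 / (K : ℝ) := fun d => by
    refine abs_sub_sum_Icc_le_of_hasSum (hasSum_periodicTent (2 * δ) (y d)) (by simp)
      (fun k hk => ?_) hK
    rw [abs_mul]
    exact (mul_le_of_le_one_right (abs_nonneg _) (Real.abs_cos_le_one _)).trans (hc1 k hk)
  have h1 : δ * #{d ∈ D | 1 - δ ≤ Int.fract (y d)} ≤ ∑ d ∈ D, periodicTent (2 * δ) (y d) := by
    calc δ * #{d ∈ D | 1 - δ ≤ Int.fract (y d)}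
        = ∑ d ∈ D with 1 - δ ≤ Int.fract (y d), δ := by
          rw [sum_const, nsmul_eq_mul, mul_comm]
      _ ≤ ∑ d ∈ D with 1 - δ ≤ Int.fract (y d), periodicTent (2 * δ) (y d) :=
          sum_le_sum fun d hd => le_periodicTent hδ hδ1 (mem_filter.1 hd).2
      _ ≤ _ := sum_le_sum_of_subset_of_nonneg (filter_subset _ _) fun d _ _ =>
          periodicTent_nonneg (by positivity) (by linarith) _
  have h2 : ∑ d ∈ D, periodicTent (2 * δ) (y d) ≤ ∑ d ∈ D, ((2 * δ) ^ 2 + 1 / (K : ℝ) +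
      ∑ k ∈ Icc 1 K, c k * Real.cos (2 * Real.pi * k * y d)) :=
    sum_le_sum fun d _ => by linarith [(abs_le.1 (hpt d)).2]
  have h3 : ∑ d ∈ D, ∑ k ∈ Icc 1 K, c k * Real.cos (2 * Real.pi * k * y d) ≤ K * E := by
    rw [sum_comm]
    calc ∑ k ∈ Icc 1 K, ∑ d ∈ D, c k * Real.cos (2 * Real.pi * k * y d)
        ≤ ∑ k ∈ Icc 1 K, E := sum_le_sum fun k hk => by
          have hk1 := (mem_Icc.1 hk).1
          rw [← mul_sum]
          have e : ∑ d ∈ D, Real.cos (2 * Real.pi * k * y d) =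
              (∑ d ∈ D, unitExp (k * y d)).re := by
            rw [Complex.re_sum]
            refine sum_congr rfl fun d _ => ?_
            rw [unitExp_re, mul_assoc]
          have hck : |c k| ≤ 1 := (hc1 k hk1).trans (by
            rw [div_le_one (by positivity)]
            exact one_le_pow₀ (by exact_mod_cast hk1))
          calc c k * ∑ d ∈ D, Real.cos (2 * Real.pi * k * y d)
              ≤ |c k| * |∑ d ∈ D, Real.cos (2 * Real.pi * k * y d)| := by
                rw [← abs_mul]
                exact le_abs_self _
            _ ≤ 1 * E := by
                rw [e]
                gcongr
                exact (Complex.abs_re_le_norm _).trans (hE k hk)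
            _ = E := one_mul E
      _ = K * E := by simp
  rw [sum_add_distrib, sum_const, nsmul_eq_mul] at h2
  have h4 : (#D : ℝ) * ((2 * δ) ^ 2 + 1 / (K : ℝ)) = 4 * δ ^ 2 * #D + #D / K := by ring
  linarith

/-- The modulus of the `k`-th sine coefficient of `smoothSawtooth δ`. -/
noncomputable def sawtoothCoeff (δ : ℝ) (k : ℕ) : ℝ :=
  Real.sin (Real.pi * k * δ) / (Real.pi ^ 2 * (k : ℝ) ^ 2 * δ)

lemma abs_sawtoothCoeff_le {δ : ℝ} (hδ : 0 < δ) {k : ℕ} (hk : 1 ≤ k) :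
    |sawtoothCoeff δ k| ≤ 1 / (Real.pi * k) := by
  have hk' : (0 : ℝ) < k := by exact_mod_cast hk
  have hp := Real.pi_pos
  rw [sawtoothCoeff, abs_div, abs_of_pos (by positivity : 0 < Real.pi ^ 2 * (k : ℝ) ^ 2 * δ),
    div_le_div_iff₀ (by positivity) (by positivity)]
  have : |Real.sin (Real.pi * k * δ)| ≤ Real.pi * k * δ :=
    Real.abs_sin_le_abs.trans_eq (abs_of_pos (by positivity))
  calc _ ≤ Real.pi * k * δ * (Real.pi * k) := by gcongr
    _ = _ := by ring

lemma two_div_pi_sq_le_sawtoothCoeff_one {δ : ℝ} (hδ : 0 < δ) (hδ1 : δ ≤ 1 / 2) :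
    2 / Real.pi ^ 2 ≤ sawtoothCoeff δ 1 := by
  have hp := Real.pi_pos
  have h := Real.mul_le_sin (x := Real.pi * δ) (by positivity) (by nlinarith)
  have e : 2 / Real.pi * (Real.pi * δ) = 2 * δ := by field_simp
  rw [e] at h
  rw [sawtoothCoeff, Nat.cast_one, mul_one, div_le_div_iff₀ (by positivity) (by positivity)]
  nlinarith [sq_nonneg Real.pi]

lemma abs_smoothSawtooth_add_sum_le {δ : ℝ} (hδ : 0 < δ) {K : ℕ} (hK : 1 ≤ K) (y : ℝ) :
    |smoothSawtooth δ y + ∑ k ∈ Icc 1 K, sawtoothCoeff δ k *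
      Real.sin (2 * Real.pi * k * (y + δ / 2))| ≤ 1 / (δ * K) := by
  have hp : 1 ≤ Real.pi ^ 2 := by nlinarith [Real.pi_gt_three]
  have h := abs_sub_sum_Icc_le_of_hasSum (hasSum_smoothSawtooth hδ y) (C := 1 / δ) (by simp)
    (fun k hk => ?_) hK
  · simp only [neg_mul, sum_neg_distrib, sub_neg_eq_add] at h
    rwa [div_div] at h
  · have hk' : (0 : ℝ) < k := by exact_mod_cast hk
    rw [abs_mul, abs_neg]
    refine (mul_le_of_le_one_right (abs_nonneg _) (Real.abs_sin_le_one _)).trans ?_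
    rw [abs_div, abs_of_pos (by positivity : 0 < Real.pi ^ 2 * (k : ℝ) ^ 2 * δ), div_div,
      div_le_div_iff₀ (by positivity) (by positivity), one_mul]
    have := mul_le_mul (Real.abs_sin_le_one (Real.pi * k * δ)) (le_mul_of_one_le_left
      (by positivity : (0 : ℝ) ≤ δ * k ^ 2) hp) (by positivity) zero_le_one
    linarith

/-- Truncated Fourier expansion of the sawtooth function, averaged over a finite set. -/
lemma norm_sum_mul_fract_add_le {δ : ℝ} (hδ : 0 < δ) (hδ1 : δ < 1) {K : ℕ} (hK : 1 ≤ K)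
    (D : Finset ℕ) (g : ℕ → ℂ) (y : ℕ → ℝ) {G : ℝ} (hG0 : 0 ≤ G) (hG : ∀ d ∈ D, ‖g d‖ ≤ G) :
    ‖∑ d ∈ D, g d * ((Int.fract (y d) - 1 / 2 : ℝ) : ℂ) + ∑ k ∈ Icc 1 K,
      (sawtoothCoeff δ k : ℂ) *
        ∑ d ∈ D, g d * (Real.sin (2 * Real.pi * k * (y d + δ / 2)) : ℂ)‖ ≤
      G * (δ * #D + #{d ∈ D | 1 - δ ≤ Int.fract (y d)} + #D / (δ * K)) := by
  have e : ∑ d ∈ D, g d * ((Int.fract (y d) - 1 / 2 : ℝ) : ℂ) + ∑ k ∈ Icc 1 K,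
      (sawtoothCoeff δ k : ℂ) *
        ∑ d ∈ D, g d * (Real.sin (2 * Real.pi * k * (y d + δ / 2)) : ℂ) =
      ∑ d ∈ D, g d * ((Int.fract (y d) - 1 / 2 + ∑ k ∈ Icc 1 K, sawtoothCoeff δ k *
        Real.sin (2 * Real.pi * k * (y d + δ / 2)) : ℝ) : ℂ) := by
    simp_rw [mul_sum]
    rw [sum_comm, ← sum_add_distrib]
    refine sum_congr rfl fun d _ => ?_
    push_cast
    rw [mul_add, mul_sum]
    congr 1
    refine sum_congr rfl fun k _ => ?_
    ring
  rw [e]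
  calc _ ≤ ∑ d ∈ D, G * (δ + (if 1 - δ ≤ Int.fract (y d) then 1 else 0) + 1 / (δ * K)) := by
        refine (norm_sum_le _ _).trans (sum_le_sum fun d hd => ?_)
        rw [norm_mul, Complex.norm_real, Real.norm_eq_abs]
        refine mul_le_mul (hG d hd) ?_ (abs_nonneg _) hG0
        have h1 := abs_fract_sub_smoothSawtooth_le hδ hδ1 (y d)
        have h2 := abs_smoothSawtooth_add_sum_le hδ hK (y d)
        have h3 := abs_add_le (Int.fract (y d) - 1 / 2 - smoothSawtooth δ (y d))
          (smoothSawtooth δ (y d) + ∑ k ∈ Icc 1 K, sawtoothCoeff δ k *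
            Real.sin (2 * Real.pi * k * (y d + δ / 2)))
        rw [← add_assoc, sub_add_cancel] at h3
        linarith
    _ = _ := by
        rw [← mul_sum, sum_add_distrib, sum_add_distrib, sum_boole]
        simp only [sum_const, nsmul_eq_mul]
        ring

lemma ofReal_sin_two_pi_mul (x : ℝ) :
    (Real.sin (2 * Real.pi * x) : ℂ) = (unitExp x - unitExp (-x)) * (-Complex.I / 2) := by
  rw [unitExp_eq_cos_add_sin, unitExp_eq_cos_add_sin, mul_neg, Real.cos_neg, Real.sin_neg]
  push_cast
  linear_combination Complex.sin (2 * Real.pi * x) * Complex.I_mul_I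

lemma sum_mul_sin_eq (D : Finset ℕ) (g : ℕ → ℂ) (y : ℕ → ℝ) (k : ℕ) (η : ℝ) :
    ∑ d ∈ D, g d * (Real.sin (2 * Real.pi * k * (y d + η)) : ℂ) =
      (unitExp (k * η) * ∑ d ∈ D, g d * unitExp (k * y d) -
        unitExp (-(k * η)) * ∑ d ∈ D, g d * unitExp (-(k * y d))) * (-Complex.I / 2) := by
  rw [mul_sum, mul_sum, ← sum_sub_distrib, sum_mul]
  refine sum_congr rfl fun d _ => ?_
  rw [mul_assoc (2 * Real.pi), ofReal_sin_two_pi_mul, mul_add, neg_add, unitExp_add, unitExp_add]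
  ring

lemma norm_sum_mul_sin_le (D : Finset ℕ) (g : ℕ → ℂ) (y : ℕ → ℝ) (k : ℕ) (η : ℝ) :
    ‖∑ d ∈ D, g d * (Real.sin (2 * Real.pi * k * (y d + η)) : ℂ)‖ ≤
      (‖∑ d ∈ D, g d * unitExp (k * y d)‖ + ‖∑ d ∈ D, g d * unitExp (-(k * y d))‖) / 2 := by
  rw [sum_mul_sin_eq, norm_mul]
  have h := norm_sub_le (unitExp (k * η) * ∑ d ∈ D, g d * unitExp (k * y d))
    (unitExp (-(k * η)) * ∑ d ∈ D, g d * unitExp (-(k * y d)))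
  rw [norm_mul, norm_mul, norm_unitExp, norm_unitExp, one_mul, one_mul] at h
  have e : ‖-Complex.I / 2‖ = 1 / 2 := by simp
  rw [e]
  linarith

lemma sub_le_norm_sum_mul_sin (D : Finset ℕ) (g : ℕ → ℂ) (y : ℕ → ℝ) (k : ℕ) (η : ℝ) :
    (‖∑ d ∈ D, g d * unitExp (-(k * y d))‖ - ‖∑ d ∈ D, g d * unitExp (k * y d)‖) / 2 ≤
      ‖∑ d ∈ D, g d * (Real.sin (2 * Real.pi * k * (y d + η)) : ℂ)‖ := by
  rw [sum_mul_sin_eq, norm_mul]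
  have h := norm_sub_norm_le (unitExp (-(k * η)) * ∑ d ∈ D, g d * unitExp (-(k * y d)))
    (unitExp (k * η) * ∑ d ∈ D, g d * unitExp (k * y d))
  rw [norm_mul, norm_mul, norm_unitExp, norm_unitExp, one_mul, one_mul, norm_sub_rev] at h
  have e : ‖-Complex.I / 2‖ = 1 / 2 := by simp
  rw [e]
  linarith

lemma norm_sum_sawtoothCoeff_mul_le {δ : ℝ} (hδ : 0 < δ) (I : Finset ℕ) (hI : ∀ k ∈ I, 1 ≤ k)
    (D : Finset ℕ) (g : ℕ → ℂ) (y : ℕ → ℝ) (A : ℕ → ℝ) (hA : ∀ k ∈ I,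
      (‖∑ d ∈ D, g d * unitExp (k * y d)‖ + ‖∑ d ∈ D, g d * unitExp (-(k * y d))‖) / 2 ≤ A k) :
    ‖∑ k ∈ I, (sawtoothCoeff δ k : ℂ) *
      ∑ d ∈ D, g d * (Real.sin (2 * Real.pi * k * (y d + δ / 2)) : ℂ)‖ ≤
        ∑ k ∈ I, A k / (Real.pi * k) := by
  refine (norm_sum_le _ _).trans (sum_le_sum fun k hk => ?_)
  rw [norm_mul, Complex.norm_real, Real.norm_eq_abs, ← one_div_mul_eq_div (Real.pi * k) (A k)]
  exact mul_le_mul (abs_sawtoothCoeff_le hδ (hI k hk))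
    ((norm_sum_mul_sin_le D g y k _).trans (hA k hk)) (norm_nonneg _) (by positivity)

lemma norm_sum_mul_fract_le {δ : ℝ} (hδ : 0 < δ) (hδ1 : δ < 1) {K : ℕ} (hK : 1 ≤ K)
    (D : Finset ℕ) (g : ℕ → ℂ) (y : ℕ → ℝ) {G : ℝ} (hG0 : 0 ≤ G) (hG : ∀ d ∈ D, ‖g d‖ ≤ G)
    (A : ℕ → ℝ) (hA : ∀ k ∈ Icc 1 K,
      (‖∑ d ∈ D, g d * unitExp (k * y d)‖ + ‖∑ d ∈ D, g d * unitExp (-(k * y d))‖) / 2 ≤ A k) :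
    ‖∑ d ∈ D, g d * ((Int.fract (y d) - 1 / 2 : ℝ) : ℂ)‖ ≤
      G * (δ * #D + #{d ∈ D | 1 - δ ≤ Int.fract (y d)} + #D / (δ * K)) +
        ∑ k ∈ Icc 1 K, A k / (Real.pi * k) := by
  have h1 := norm_sum_mul_fract_add_le hδ hδ1 hK D g y hG0 hG
  have h2 := norm_sum_sawtoothCoeff_mul_le hδ (Icc 1 K) (fun k hk => (mem_Icc.1 hk).1) D g y A hA
  have h3 := norm_sub_le (∑ d ∈ D, g d * ((Int.fract (y d) - 1 / 2 : ℝ) : ℂ) + ∑ k ∈ Icc 1 K,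
      (sawtoothCoeff δ k : ℂ) *
        ∑ d ∈ D, g d * (Real.sin (2 * Real.pi * k * (y d + δ / 2)) : ℂ))
      (∑ k ∈ Icc 1 K, (sawtoothCoeff δ k : ℂ) *
        ∑ d ∈ D, g d * (Real.sin (2 * Real.pi * k * (y d + δ / 2)) : ℂ))
  rw [add_sub_cancel_right] at h3
  linarith

lemma le_norm_sum_mul_fract_add {δ : ℝ} (hδ : 0 < δ) (hδ1 : δ ≤ 1 / 2) {K : ℕ} (hK : 1 ≤ K)
    (D : Finset ℕ) (g : ℕ → ℂ) (y : ℕ → ℝ) {G : ℝ} (hG0 : 0 ≤ G) (hG : ∀ d ∈ D, ‖g d‖ ≤ G)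
    (A : ℕ → ℝ) (hA : ∀ k ∈ Icc 2 K,
      (‖∑ d ∈ D, g d * unitExp (k * y d)‖ + ‖∑ d ∈ D, g d * unitExp (-(k * y d))‖) / 2 ≤ A k) :
    (‖∑ d ∈ D, g d * unitExp (-y d)‖ - ‖∑ d ∈ D, g d * unitExp (y d)‖) / Real.pi ^ 2 ≤
      ‖∑ d ∈ D, g d * ((Int.fract (y d) - 1 / 2 : ℝ) : ℂ)‖ +
      (G * (δ * #D + #{d ∈ D | 1 - δ ≤ Int.fract (y d)} + #D / (δ * K)) +
        ∑ k ∈ Icc 2 K, A k / (Real.pi * k)) := by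
  have hp := Real.pi_pos
  set S := ∑ d ∈ D, g d * ((Int.fract (y d) - 1 / 2 : ℝ) : ℂ) with hS
  set u : ℕ → ℂ := fun k => ∑ d ∈ D, g d * (Real.sin (2 * Real.pi * k * (y d + δ / 2)) : ℂ) with hu
  have h1 := norm_sum_mul_fract_add_le hδ (by linarith) hK D g y hG0 hG
  rw [← hS] at h1
  change ‖S + ∑ k ∈ Icc 1 K, (sawtoothCoeff δ k : ℂ) * u k‖ ≤ _ at h1
  have h2 : ‖∑ k ∈ Icc 2 K, (sawtoothCoeff δ k : ℂ) * u k‖ ≤ _ :=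
    norm_sum_sawtoothCoeff_mul_le hδ (Icc 2 K) (fun k hk => by
      rw [mem_Icc] at hk
      omega) D g y A hA
  have e : ∑ k ∈ Icc 1 K, (sawtoothCoeff δ k : ℂ) * u k =
      (sawtoothCoeff δ 1 : ℂ) * u 1 + ∑ k ∈ Icc 2 K, (sawtoothCoeff δ k : ℂ) * u k := by
    rw [← insert_Icc_add_one_left_eq_Icc hK, sum_insert (by simp)]
    rfl
  rw [e] at h1
  have h3 := norm_sub_le (S + ((sawtoothCoeff δ 1 : ℂ) * u 1 +
    ∑ k ∈ Icc 2 K, (sawtoothCoeff δ k : ℂ) * u k)) S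
  have h4 := norm_sub_le ((sawtoothCoeff δ 1 : ℂ) * u 1 +
    ∑ k ∈ Icc 2 K, (sawtoothCoeff δ k : ℂ) * u k) (∑ k ∈ Icc 2 K, (sawtoothCoeff δ k : ℂ) * u k)
  rw [add_sub_cancel_left] at h3
  rw [add_sub_cancel_right, norm_mul, Complex.norm_real, Real.norm_eq_abs] at h4
  have h5 := sub_le_norm_sum_mul_sin D g y 1 (δ / 2)
  simp only [Nat.cast_one, one_mul] at h5
  have h6 : ‖u 1‖ = ‖∑ d ∈ D, g d * (Real.sin (2 * Real.pi * ((1 : ℕ) : ℝ) * (y d + δ / 2)) : ℂ)‖ :=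
    rfl
  rw [Nat.cast_one] at h6
  rw [← h6] at h5
  have h7 := (two_div_pi_sq_le_sawtoothCoeff_one hδ hδ1).trans (le_abs_self _)
  have h8 : (‖∑ d ∈ D, g d * unitExp (-y d)‖ - ‖∑ d ∈ D, g d * unitExp (y d)‖) / Real.pi ^ 2 ≤
      |sawtoothCoeff δ 1| * ‖u 1‖ := by
    calc _ = 2 / Real.pi ^ 2 * ((‖∑ d ∈ D, g d * unitExp (-y d)‖ -
          ‖∑ d ∈ D, g d * unitExp (y d)‖) / 2) := by ring
      _ ≤ 2 / Real.pi ^ 2 * ‖u 1‖ := by gcongr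
      _ ≤ _ := by gcongr
  linarith

lemma card_le_one_add_of_forall_sub_le {S : Finset ℕ} {R : ℝ} (hR : 0 ≤ R)
    (h : ∀ a ∈ S, ∀ b ∈ S, a < b → (b : ℝ) - a ≤ R) : (#S : ℝ) ≤ 1 + R := by
  rcases S.eq_empty_or_nonempty with rfl | hS
  · simp only [card_empty, Nat.cast_zero]
    positivity
  · set a := S.min' hS
    have hsub : S ⊆ Icc a (a + ⌊R⌋₊) := fun b hb => by
      rw [mem_Icc]
      refine ⟨S.min'_le b hb, ?_⟩
      rcases (S.min'_le b hb).eq_or_lt with hab | hab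
      · omega
      · have h1 := h a (S.min'_mem hS) b hb hab
        have h2 : b - a ≤ ⌊R⌋₊ := Nat.le_floor (by
          rw [Nat.cast_sub hab.le]
          exact h1)
        omega
    have h3 := card_le_card hsub
    rw [Nat.card_Icc] at h3
    have h4 : #S ≤ 1 + ⌊R⌋₊ := by omega
    calc (#S : ℝ) ≤ ((1 + ⌊R⌋₊ : ℕ) : ℝ) := by exact_mod_cast h4
      _ ≤ 1 + R := by
        push_cast
        linarith [Nat.floor_le hR]

lemma sub_le_of_one_sub_le_fract {δ : ℝ} (hδ : 0 < δ) (hδ1 : δ < 1) {x j a b v : ℕ}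
    (hj : 1 ≤ j) (hv : 1 ≤ v) (ha : 0 < a) (hab : a < b)
    (hav : (x : ℝ) / a ^ j < v + 1) (hbv : (v : ℝ) + 1 - δ ≤ x / (b : ℝ) ^ j) :
    (b : ℝ) - a ≤ a * δ / v := by
  have ha' : (0 : ℝ) < a := by exact_mod_cast ha
  have hb' : (0 : ℝ) < b := by exact_mod_cast ha.trans hab
  have hv' : (1 : ℝ) ≤ v := by exact_mod_cast hv
  rw [div_lt_iff₀ (by positivity)] at hav
  rw [le_div_iff₀ (by positivity)] at hbv
  have h1 : 1 ≤ (b : ℝ) / a := by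
    rw [one_le_div ha']
    exact_mod_cast hab.le
  have h2 : (b : ℝ) / a ≤ (b / a : ℝ) ^ j := le_self_pow₀ h1 (by omega)
  have h3 : (b / a : ℝ) ^ j ≤ (v + 1) / (v + 1 - δ) := by
    rw [div_pow, div_le_div_iff₀ (by positivity) (by linarith)]
    linarith
  have h4 : ((v : ℝ) + 1) / (v + 1 - δ) ≤ 1 + δ / v := by
    rw [div_le_iff₀ (by linarith), ← sub_nonneg]
    have : (1 + δ / v) * ((v : ℝ) + 1 - δ) - (v + 1) = δ * (1 - δ) / v := by
      field_simp
      ring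
    rw [this]
    have : 0 < 1 - δ := by linarith
    positivity
  have h5 := h2.trans (h3.trans h4)
  rw [div_le_iff₀ ha'] at h5
  have e : (1 + δ / v) * (a : ℝ) = a + a * δ / v := by ring
  linarith

lemma card_one_sub_le_fract_div_pow_le {δ T : ℝ} (hδ : 0 < δ) (hδ1 : δ < 1) (hT : 1 ≤ T)
    {P A B x j : ℕ} (hP : 1 ≤ P) (hj : 1 ≤ j) (hA : P ≤ A) (hB : B ≤ 2 * P) (hx : B ^ j ≤ x)
    (hxT : (x : ℝ) / P ^ j ≤ T) :
    (#({d ∈ Ioc A B | 1 - δ ≤ Int.fract ((x : ℝ) / (d : ℝ) ^ j)} : Finset ℕ) : ℝ) ≤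
      T + 2 * P * δ * (1 + Real.log T) := by
  set S : Finset ℕ := {d ∈ Ioc A B | 1 - δ ≤ Int.fract ((x : ℝ) / (d : ℝ) ^ j)}
  have hP' : (0 : ℝ) < P := by exact_mod_cast hP
  have hmaps : ∀ d ∈ S, ⌊(x : ℝ) / (d : ℝ) ^ j⌋₊ ∈ Ioc 0 ⌊T⌋₊ := fun d hd => by
    have hd' := mem_Ioc.1 (mem_filter.1 hd).1
    have hd0 : (0 : ℝ) < d := by exact_mod_cast (show 0 < d by omega)
    rw [mem_Ioc]
    refine ⟨Nat.floor_pos.2 ?_, Nat.floor_le_floor (le_trans ?_ hxT)⟩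
    · rw [one_le_div (by positivity)]
      exact_mod_cast (Nat.pow_le_pow_left hd'.2 j).trans hx
    · have : (P : ℝ) ≤ d := by exact_mod_cast (show P ≤ d by omega)
      gcongr
  have hfib : ∀ v ∈ Ioc 0 ⌊T⌋₊, (#({d ∈ S | ⌊(x : ℝ) / (d : ℝ) ^ j⌋₊ = v} : Finset ℕ) : ℝ) ≤
      1 + 2 * P * δ * (1 / v) := fun v hv => by
    have hv1 : 1 ≤ v := (mem_Ioc.1 hv).1
    refine card_le_one_add_of_forall_sub_le (by positivity) fun a ha b hb hab => ?_
    rw [mem_filter] at ha hb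
    have ha' := mem_Ioc.1 (mem_filter.1 ha.1).1
    have hnn : ∀ d : ℕ, 0 ≤ (x : ℝ) / (d : ℝ) ^ j := fun d => by positivity
    refine (sub_le_of_one_sub_le_fract (x := x) hδ hδ1 hj hv1 (by omega) hab ?_ ?_).trans ?_
    · rw [← ha.2]
      exact Nat.lt_floor_add_one _
    · have h1 := (mem_filter.1 hb.1).2
      have h2 := Int.fract_add_floor ((x : ℝ) / (b : ℝ) ^ j)
      have h3 : ((⌊(x : ℝ) / (b : ℝ) ^ j⌋ : ℤ) : ℝ) = (⌊(x : ℝ) / (b : ℝ) ^ j⌋₊ : ℝ) :=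
        (natCast_floor_eq_intCast_floor (hnn b)).symm
      rw [h3, hb.2] at h2
      linarith
    · have hle : (a : ℝ) ≤ 2 * P := by exact_mod_cast (show a ≤ 2 * P by omega)
      rw [mul_one_div]
      gcongr
  rw [card_eq_sum_card_fiberwise hmaps]
  push_cast
  calc _ ≤ ∑ v ∈ Ioc 0 ⌊T⌋₊, (1 + 2 * P * δ * (1 / (v : ℝ))) := sum_le_sum hfib
    _ = ⌊T⌋₊ + 2 * P * δ * ∑ v ∈ Ioc 0 ⌊T⌋₊, 1 / (v : ℝ) := by
        rw [sum_add_distrib, ← mul_sum]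
        simp
    _ ≤ T + 2 * P * δ * (1 + Real.log T) := by
        have h1 := Nat.floor_le (zero_le_one.trans hT)
        have h2 : Real.log (⌊T⌋₊ : ℝ) ≤ Real.log T :=
          Real.log_le_log (by exact_mod_cast Nat.floor_pos.2 hT) h1
        have h3 := sum_Ioc_inv_le ⌊T⌋₊
        gcongr
        linarith

/-- Few integers `d` of a dyadic interval have `x / d ^ j` just below an integer. -/
lemma eventually_card_one_sub_le_fract_div_pow_le {δ₀ : ℝ} (hδ₀ : 0 < δ₀) (hδ₀' : δ₀ ≤ 1 / 2) :
    ∀ᶠ P : ℕ in Filter.atTop, ∀ x j : ℕ, 1 ≤ j → j ≤ Real.log P ^ ((1 : ℝ) / 2) →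
      Real.log x + Real.log P ≤ Real.log P ^ (3 / 2 - δ₀) →
      ∀ A B : ℕ, P ≤ A → B ≤ 2 * P → B ^ j ≤ x →
      (#({d ∈ Ioc A B | 1 - (Real.log P ^ 6)⁻¹ ≤ Int.fract ((x : ℝ) / (d : ℝ) ^ j)} :
        Finset ℕ) : ℝ) ≤
        P / Real.log P ^ 4 := by
  obtain ⟨Q₀, hQ₀⟩ := exists_norm_sum_twoTermPhase_le hδ₀ hδ₀' 24
  filter_upwards [Filter.eventually_ge_atTop Q₀, Filter.eventually_ge_atTop 1,
    eventually_log_pow_le_rpow 5 (show (0 : ℝ) < 1 / 10 by norm_num),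
    eventually_log_pow_le_rpow 12 one_pos, eventually_le_log_natCast 16] with
    P hPQ hP1 hP5 hP12 hlam x j hj hjl hxl A B hA hB hBx
  set lam := Real.log P with hlamdef
  have hP' : (0 : ℝ) < P := by exact_mod_cast hP1
  have hP1' : (1 : ℝ) ≤ P := by exact_mod_cast hP1
  have hl0 : 0 < lam := by linarith
  have hl1 : 1 ≤ lam := by linarith
  have hδ : 0 < (lam ^ 6)⁻¹ := by positivity
  have h6 : 4 ≤ lam ^ 6 := by
    calc (4 : ℝ) ≤ lam ^ 1 := by linarith
      _ ≤ lam ^ 6 := pow_le_pow_right₀ hl1 (by norm_num)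
  have hδ1 : (lam ^ 6)⁻¹ ≤ 1 / 4 := by
    rw [one_div]
    exact inv_anti₀ (by norm_num) h6
  rcases le_total ((x : ℝ) / P ^ j) ((P : ℝ) ^ ((9 : ℝ) / 10)) with hT | hT
  · have hT1 : 1 ≤ (P : ℝ) ^ ((9 : ℝ) / 10) := Real.one_le_rpow hP1' (by norm_num)
    refine (card_one_sub_le_fract_div_pow_le hδ (by linarith) hT1 hP1 hj hA hB hBx hT).trans ?_
    rw [Real.log_rpow hP', ← hlamdef]
    have h1 : (P : ℝ) ^ ((9 : ℝ) / 10) * lam ^ 5 ≤ P := by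
      calc _ ≤ (P : ℝ) ^ ((9 : ℝ) / 10) * (P : ℝ) ^ ((1 : ℝ) / 10) := by gcongr
        _ = P := by
          rw [← Real.rpow_add hP']
          norm_num
    have h2 : (P : ℝ) ^ ((9 : ℝ) / 10) ≤ P / lam ^ 5 := by
      rwa [le_div_iff₀ (by positivity)]
    have h3 : 2 * (P : ℝ) * (lam ^ 6)⁻¹ * (1 + 9 / 10 * lam) ≤ 4 * (P / lam ^ 5) := by
      calc _ ≤ 2 * (P : ℝ) * (lam ^ 6)⁻¹ * (2 * lam) := by
            gcongr
            linarith
        _ = _ := by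
          field_simp
          norm_num
    calc _ ≤ 5 * (P / lam ^ 5) := by linarith
      _ ≤ lam * (P / lam ^ 5) := by
        gcongr
        linarith
      _ = _ := by field_simp
  · have hx0 : 0 < (x : ℝ) := by
      by_contra hx
      have : (x : ℝ) = 0 := le_antisymm (not_lt.1 hx) (Nat.cast_nonneg x)
      rw [this, zero_div] at hT
      exact absurd hT (not_le.2 (by positivity))
    set K := ⌊lam ^ 12⌋₊ with hK
    have hl12 : 1 ≤ lam ^ 12 := one_le_pow₀ hl1
    have hK1 : 1 ≤ K := Nat.floor_pos.2 hl12
    have hKle : (K : ℝ) ≤ lam ^ 12 := Nat.floor_le (by positivity)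
    have hKge : lam ^ 12 / 2 ≤ K := by
      have : (1 : ℝ) ≤ K := by exact_mod_cast hK1
      linarith [Nat.lt_floor_add_one (lam ^ 12)]
    have hcard : (#(Ioc A B) : ℝ) ≤ P := by
      rw [Nat.card_Ioc]
      exact_mod_cast (show B - A ≤ P by omega)
    have h := card_one_sub_le_fract_le hδ hδ1 hK1 (Ioc A B)
      (fun d => (x : ℝ) / (d : ℝ) ^ j) (E := P / lam ^ 24) fun k hk => ?_
    · have hmain : (lam ^ 6)⁻¹ *
          (#({d ∈ Ioc A B | 1 - (lam ^ 6)⁻¹ ≤ Int.fract ((x : ℝ) / (d : ℝ) ^ j)} : Finset ℕ) : ℝ) ≤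
          7 * (P / lam ^ 12) := by
        refine h.trans ?_
        have e1 : 4 * ((lam ^ 6)⁻¹) ^ 2 * (#(Ioc A B) : ℝ) ≤ 4 * (P / lam ^ 12) := by
          calc _ ≤ 4 * ((lam ^ 6)⁻¹) ^ 2 * (P : ℝ) := by gcongr
            _ = _ := by
              field_simp
        have e2 : (K : ℝ) * (P / lam ^ 24) ≤ P / lam ^ 12 := by
          calc _ ≤ lam ^ 12 * (P / lam ^ 24) := by gcongr
            _ = _ := by
              field_simp
        have e3 : (#(Ioc A B) : ℝ) / K ≤ 2 * (P / lam ^ 12) := by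
          calc _ ≤ (P : ℝ) / (lam ^ 12 / 2) := by gcongr
            _ = _ := by
              field_simp
        linarith
      rw [inv_mul_le_iff₀ (by positivity)] at hmain
      refine hmain.trans ?_
      calc lam ^ 6 * (7 * (P / lam ^ 12)) = 7 * (P / lam ^ 6) := by field_simp
        _ ≤ lam ^ 2 * (P / lam ^ 6) := by
          gcongr
          nlinarith
        _ = _ := by field_simp
    · rw [mem_Icc] at hk
      have hk1 : (1 : ℝ) ≤ k := by exact_mod_cast hk.1
      have hkP : (k : ℝ) ≤ P := by
        calc (k : ℝ) ≤ K := by exact_mod_cast hk.2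
          _ ≤ lam ^ 12 := hKle
          _ ≤ (P : ℝ) ^ (1 : ℝ) := hP12
          _ = P := Real.rpow_one _
      have hj' : j - 1 + 1 = j := by omega
      have habs : |(k : ℝ) * x| = k * x := abs_of_nonneg (by positivity)
      have H := hQ₀ P hPQ (k * x) 0 (j - 1) 0 (by positivity) ?_ ?_ ?_ ?_ ?_ A B hA hB
      · convert! H using 4 with d hd
        rw [twoTermPhase, hj']
        ring
      · rw [hj', habs]
        refine hT.trans ?_
        gcongr
        exact le_mul_of_one_le_left hx0.le hk1
      · rw [hj', habs]
        refine le_trans ?_ hxl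
        rw [← Real.log_mul hx0.ne' hP'.ne']
        refine Real.log_le_log (by positivity) ?_
        calc (k : ℝ) * x / P ^ j ≤ k * x := div_le_self (by positivity) (one_le_pow₀ hP1')
          _ ≤ P * x := by gcongr
          _ = _ := mul_comm _ _
      · rw [abs_zero, zero_div]
        positivity
      · calc ((j - 1 : ℕ) : ℝ) ≤ j := by exact_mod_cast Nat.sub_le j 1
          _ ≤ _ := hjl
          _ ≤ _ := Real.rpow_le_rpow_of_exponent_le hl1 (by norm_num)
      · rw [Nat.cast_zero]
        positivity

lemma eventually_sawtooth_error_le {δ₀ : ℝ} (hδ₀ : 0 < δ₀) (hδ₀' : δ₀ ≤ 1 / 2) :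
    ∀ᶠ P : ℕ in Filter.atTop, ∀ x j : ℕ, 1 ≤ j → j ≤ Real.log P ^ ((1 : ℝ) / 2) →
      Real.log x + Real.log P ≤ Real.log P ^ (3 / 2 - δ₀) →
      ∀ B : ℕ, B ≤ 2 * P → B ^ j ≤ x → ∀ D : Finset ℕ, D ⊆ Ioc P B →
      2 * Real.log P * ((Real.log P ^ 6)⁻¹ * #D +
        #({d ∈ D | 1 - (Real.log P ^ 6)⁻¹ ≤ Int.fract ((x : ℝ) / (d : ℝ) ^ j)} : Finset ℕ) +
        #D / ((Real.log P ^ 6)⁻¹ * ⌊Real.log P ^ 12⌋₊)) ≤ 8 * (P / Real.log P ^ 3) := by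
  filter_upwards [eventually_card_one_sub_le_fract_div_pow_le hδ₀ hδ₀',
    eventually_le_log_natCast 1] with P hcard hl1 x j hj hjl hxl B hB hBx D hD
  have h1 := hcard x j hj hjl hxl P B le_rfl hB hBx
  set lam := Real.log P
  have hD1 : (#D : ℝ) ≤ P := by
    have := card_le_card hD
    rw [Nat.card_Ioc] at this
    exact_mod_cast (show #D ≤ P by omega)
  have h2 : (#({d ∈ D | 1 - (lam ^ 6)⁻¹ ≤ Int.fract ((x : ℝ) / (d : ℝ) ^ j)} : Finset ℕ) : ℝ) ≤
      P / lam ^ 4 :=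
    le_trans (by exact_mod_cast card_le_card (filter_subset_filter _ hD)) h1
  have hK : lam ^ 12 / 2 ≤ ⌊lam ^ 12⌋₊ := by
    have hK1 : (1 : ℝ) ≤ ⌊lam ^ 12⌋₊ := by exact_mod_cast Nat.floor_pos.2 (one_le_pow₀ hl1)
    linarith [Nat.lt_floor_add_one (lam ^ 12)]
  have hl0 : 0 < lam := by linarith
  calc _ ≤ 2 * lam * ((lam ^ 6)⁻¹ * P + P / lam ^ 4 + P / ((lam ^ 6)⁻¹ * (lam ^ 12 / 2))) := by
        gcongr
    _ = 2 * (P / lam ^ 3) + 6 * (P / lam ^ 5) := by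
        field_simp
        ring
    _ ≤ 2 * (P / lam ^ 3) + 6 * (P / lam ^ 3) := by
        gcongr
        norm_num
    _ = _ := by ring

lemma exists_pow_le_iff_le {P x j : ℕ} :
    ∃ B, P ≤ B ∧ B ≤ 2 * P ∧ ∀ d ∈ Ioc P (2 * P), d ^ j ≤ x ↔ d ≤ B := by
  classical
  refine ⟨Nat.findGreatest (fun d => d ≤ P ∨ d ^ j ≤ x) (2 * P),
    Nat.le_findGreatest (by omega) (Or.inl le_rfl), Nat.findGreatest_le _, fun d hd => ?_⟩
  rw [mem_Ioc] at hd
  refine ⟨fun h => Nat.le_findGreatest hd.2 (Or.inr h), fun h => ?_⟩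
  have h1 := Nat.findGreatest_spec (P := fun d => d ≤ P ∨ d ^ j ≤ x) (m := 0) (n := 2 * P)
    (Nat.zero_le _) (Or.inl (Nat.zero_le _))
  rcases h1 with h1 | h1
  · omega
  · exact (Nat.pow_le_pow_left h j).trans h1

/-- The primes of the dyadic interval `(P, 2 * P]`. -/
def dyadicPrimes (P : ℕ) : Finset ℕ := {p ∈ Ioc P (2 * P) | p.Prime}

lemma log_le_two_mul_log {P p : ℕ} (hP : 2 ≤ P) (hp : p ∈ Ioc P (2 * P)) :
    Real.log p ≤ 2 * Real.log P := by
  rw [mem_Ioc] at hp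
  have hP' : (2 : ℝ) ≤ P := by exact_mod_cast hP
  rw [← Nat.cast_ofNat, ← Real.log_pow]
  refine Real.log_le_log (by exact_mod_cast (show 0 < p by omega)) ?_
  have : (p : ℝ) ≤ 2 * P := by exact_mod_cast hp.2
  nlinarith

lemma norm_log_mul_unitExp_le {P p : ℕ} (hP : 2 ≤ P) (hp : p ∈ Ioc P (2 * P)) (z : ℝ) :
    ‖(Real.log p : ℂ) * unitExp z‖ ≤ 2 * Real.log P := by
  rw [norm_mul, norm_unitExp, mul_one, Complex.norm_real, Real.norm_eq_abs,
    abs_of_nonneg (Real.log_natCast_nonneg p)]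
  exact log_le_two_mul_log hP hp

lemma sum_div_pi_mul_le {E : ℝ} (hE : 0 ≤ E) {I : Finset ℕ} (hI : ∀ k ∈ I, 1 ≤ k) :
    ∑ k ∈ I, E / (Real.pi * k) ≤ #I * E := by
  rw [← nsmul_eq_mul]
  refine sum_le_card_nsmul _ _ _ fun k hk => div_le_self hE ?_
  have : (1 : ℝ) ≤ k := by exact_mod_cast hI k hk
  nlinarith [Real.pi_gt_three]

lemma eventually_norm_sum_log_mul_fract_div_pow_le {δ₀ : ℝ} (hδ₀ : 0 < δ₀) (hδ₀' : δ₀ ≤ 1 / 2) :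
    ∀ᶠ P : ℕ in Filter.atTop, ∀ n x j : ℕ, 2 ≤ j → j ≤ Real.log P ^ ((1 : ℝ) / 2) → P ^ 10 ≤ n →
      x ≤ n → 1 ≤ x → Real.log n + Real.log P ≤ Real.log P ^ (3 / 2 - δ₀) →
      ‖∑ p ∈ dyadicPrimes P, (Real.log p : ℂ) * unitExp (n / p) *
        ((Int.fract ((x : ℝ) / (p : ℝ) ^ j) : ℝ) : ℂ)‖ ≤ P / Real.log P ^ 2 := by
  filter_upwards [eventually_sawtooth_error_le hδ₀ hδ₀',
    eventually_norm_sum_prime_twoTermPhase_le hδ₀ hδ₀' 20 12, eventually_le_log_natCast 16,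
    Filter.eventually_ge_atTop 2] with P herr hexp hl16 hP2 n x j hj hjl hPn hxn hx1 hlog
  set lam := Real.log P with hlam
  have hl0 : 0 < lam := by linarith
  have hl1 : 1 ≤ lam := by linarith
  have hP' : (0 : ℝ) < P := by exact_mod_cast (by omega : 0 < P)
  have hn' : (P : ℝ) ^ 10 ≤ |(n : ℝ)| := by
    rw [Nat.abs_cast]
    exact_mod_cast hPn
  have hlogn : Real.log |(n : ℝ)| ≤ lam ^ (3 / 2 - δ₀) := by
    rw [Nat.abs_cast]
    linarith
  have hlogx : Real.log x + lam ≤ lam ^ (3 / 2 - δ₀) := by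
    have : Real.log x ≤ Real.log n :=
      Real.log_le_log (by exact_mod_cast hx1) (by exact_mod_cast hxn)
    linarith
  have h1l : (1 : ℝ) ≤ lam ^ ((1 : ℝ) / 2) := Real.one_le_rpow hl1 (by norm_num)
  have hexp0 : ∀ A C : ℕ, P ≤ A → C ≤ 2 * P →
      ‖∑ p ∈ Ioc A C with p.Prime, (Real.log p : ℂ) * unitExp (n / p)‖ ≤ P / lam ^ 20 := by
    intro A C hA hC
    have := hexp n 0 1 le_rfl hn' hlogn (by rw [abs_zero]; positivity) (by simpa using h1l)
      A C hA hC
    simpa [twoTermPhase] using this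
  obtain ⟨B, hPB, hB2, hB⟩ := exists_pow_le_iff_le (P := P) (x := x) (j := j)
  have hsplit : dyadicPrimes P = {p ∈ Ioc P B | p.Prime} ∪ {p ∈ Ioc B (2 * P) | p.Prime} := by
    rw [dyadicPrimes, ← filter_union, Ioc_union_Ioc_eq_Ioc hPB hB2]
  have hdisj : Disjoint {p ∈ Ioc P B | p.Prime} {p ∈ Ioc B (2 * P) | p.Prime} :=
    (disjoint_left.2 fun a ha hb => by
      rw [mem_Ioc] at ha hb
      omega : Disjoint (Ioc P B) (Ioc B (2 * P))).mono (filter_subset _ _) (filter_subset _ _)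
  rw [hsplit, sum_union hdisj]
  have hhigh : ‖∑ p ∈ Ioc B (2 * P) with p.Prime, (Real.log p : ℂ) * unitExp (n / p) *
      ((Int.fract ((x : ℝ) / (p : ℝ) ^ j) : ℝ) : ℂ)‖ ≤ 2 * (P / lam ^ 20) := by
    have hsmall : ∀ d : ℕ, B < d → d ≤ 2 * P → (x : ℝ) < (d : ℝ) ^ j := fun d h1 h2 => by
      have := mt (hB d (mem_Ioc.2 ⟨by omega, h2⟩)).1 (by omega)
      exact_mod_cast not_le.1 this
    have hanti : ∀ d ∈ Ico (B + 1) (2 * P),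
        (x : ℝ) / ((d + 1 : ℕ) : ℝ) ^ j ≤ (x : ℝ) / (d : ℝ) ^ j := fun d hd => by
      have hd0 : (0 : ℝ) < d := by exact_mod_cast (by rw [mem_Ico] at hd; omega : 0 < d)
      gcongr
      omega
    rcases hB2.eq_or_lt with rfl | hB2'
    · simp only [Ioc_self, filter_empty, sum_empty, norm_zero]
      positivity
    have h := norm_sum_Ioc_mul_le_of_variation (fun d : ℕ => (x : ℝ) / (d : ℝ) ^ j)
      (fun p => if p.Prime then (Real.log p : ℂ) * unitExp (n / p) else 0) (A := B) (B := 2 * P)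
      (X := P / lam ^ 20) (V := 1) (by positivity) (fun C _ hC => by
        rw [← sum_filter]
        exact hexp0 B C hPB hC) (by
        rw [sum_congr rfl fun d hd => (abs_of_nonpos (sub_nonpos.2 (hanti d hd)) : _ = _),
          sum_neg_distrib, sum_Ico_sub (fun d : ℕ => (x : ℝ) / (d : ℝ) ^ j) (by omega),
          abs_of_nonneg (by positivity)]
        have h1 := hsmall (B + 1) (by omega) (by omega)
        have h2 : (x : ℝ) / ((B + 1 : ℕ) : ℝ) ^ j ≤ 1 := div_le_one_of_le₀ h1.le (by positivity)
        linarith)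
    have e : ∑ p ∈ Ioc B (2 * P) with p.Prime, (Real.log p : ℂ) * unitExp (n / p) *
        ((Int.fract ((x : ℝ) / (p : ℝ) ^ j) : ℝ) : ℂ) =
        ∑ d ∈ Ioc B (2 * P), (((x : ℝ) / (d : ℝ) ^ j : ℝ) : ℂ) *
          (if d.Prime then (Real.log d : ℂ) * unitExp (n / d) else 0) := by
      rw [sum_filter]
      refine sum_congr rfl fun d hd => ?_
      rw [mem_Ioc] at hd
      have hd0 : (0 : ℝ) < d := by exact_mod_cast (by omega : 0 < d)
      split_ifs
      · rw [Int.fract_eq_self.2 ⟨by positivity,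
          (div_lt_one (by positivity)).2 (hsmall d hd.1 hd.2)⟩,
          mul_comm]
      · rw [mul_zero]
    rw [e]
    refine h.trans ?_
    have : 0 ≤ P / lam ^ 20 := by positivity
    linarith
  have hlow : ‖∑ p ∈ Ioc P B with p.Prime, (Real.log p : ℂ) * unitExp (n / p) *
      ((Int.fract ((x : ℝ) / (p : ℝ) ^ j) : ℝ) : ℂ)‖ ≤ 10 * (P / lam ^ 3) := by
    rcases hPB.eq_or_lt with rfl | hPB'
    · simp only [Ioc_self, filter_empty, sum_empty, norm_zero]
      positivity
    have hBx : B ^ j ≤ x := (hB B (mem_Ioc.2 ⟨hPB', hB2⟩)).2 le_rfl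
    have hδ : 0 < (lam ^ 6)⁻¹ := by positivity
    have hδ1 : (lam ^ 6)⁻¹ < 1 := inv_lt_one_of_one_lt₀ (one_lt_pow₀ (by linarith) (by norm_num))
    have hK1 : 1 ≤ ⌊lam ^ 12⌋₊ := Nat.floor_pos.2 (one_le_pow₀ hl1)
    have hKle : (⌊lam ^ 12⌋₊ : ℝ) ≤ lam ^ 12 := Nat.floor_le (by positivity)
    have hbd : ∀ b : ℝ, |b| ≤ lam ^ 12 * x →
        ‖∑ p ∈ Ioc P B with p.Prime, (Real.log p : ℂ) * unitExp (n / p) *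
          unitExp (b / (p : ℝ) ^ j)‖ ≤ P / lam ^ 20 := by
      intro b hb
      have := hexp n b (j - 1) (by omega) hn' hlogn (hb.trans (by
        rw [mul_comm, Nat.abs_cast]
        gcongr)) (le_trans (by exact_mod_cast Nat.sub_le j 1) hjl) P B le_rfl hB2
      refine le_of_eq_of_le ?_ this
      congr 1
      refine sum_congr rfl fun p _ => ?_
      rw [twoTermPhase, unitExp_add, Nat.sub_add_cancel (by omega), zero_add, pow_one, mul_assoc]
    have hmain := norm_sum_mul_fract_le hδ hδ1 hK1 {p ∈ Ioc P B | p.Prime}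
      (fun p => (Real.log p : ℂ) * unitExp (n / p)) (fun p => (x : ℝ) / (p : ℝ) ^ j)
      (G := 2 * lam) (by positivity) (fun p hp => norm_log_mul_unitExp_le hP2 (by
        have := mem_Ioc.1 (mem_filter.1 hp).1
        exact mem_Ioc.2 ⟨this.1, this.2.trans hB2⟩) _) (fun _ => P / lam ^ 20) (fun k hk => by
        have hk' : (k : ℝ) * x ≤ lam ^ 12 * x := by
          gcongr
          exact le_trans (by exact_mod_cast (mem_Icc.1 hk).2) hKle
        have h1 := hbd (k * x) (by rwa [abs_of_nonneg (by positivity)])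
        have h2 := hbd (-(k * x)) (by rwa [abs_neg, abs_of_nonneg (by positivity)])
        simp only [mul_div_assoc, neg_div] at h1 h2
        linarith)
    have herr' := herr x j (by omega) hjl hlogx B hB2 hBx {p ∈ Ioc P B | p.Prime}
      (filter_subset _ _)
    have hsum : ∑ k ∈ Icc 1 ⌊lam ^ 12⌋₊, P / lam ^ 20 / (Real.pi * k) ≤ P / lam ^ 8 := by
      refine (sum_div_pi_mul_le (by positivity) fun k hk => (mem_Icc.1 hk).1).trans ?_
      rw [Nat.card_Icc, Nat.add_sub_cancel]
      calc _ ≤ lam ^ 12 * (P / lam ^ 20) := by gcongr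
        _ = _ := by field_simp
    have h0 := hexp0 P B le_rfl hB2
    have e : ∑ p ∈ Ioc P B with p.Prime, (Real.log p : ℂ) * unitExp (n / p) *
        ((Int.fract ((x : ℝ) / (p : ℝ) ^ j) : ℝ) : ℂ) =
        ∑ p ∈ Ioc P B with p.Prime, (Real.log p : ℂ) * unitExp (n / p) *
          ((Int.fract ((x : ℝ) / (p : ℝ) ^ j) - 1 / 2 : ℝ) : ℂ) +
        1 / 2 * ∑ p ∈ Ioc P B with p.Prime, (Real.log p : ℂ) * unitExp (n / p) := by
      rw [mul_sum, ← sum_add_distrib]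
      refine sum_congr rfl fun p _ => ?_
      push_cast
      ring
    rw [e]
    refine (norm_add_le _ _).trans ?_
    have e1 : ‖(1 / 2 : ℂ)‖ = 1 / 2 := by simp
    rw [norm_mul, e1]
    have e2 : P / lam ^ 8 ≤ P / lam ^ 3 := by
      gcongr
      norm_num
    have e3 : P / lam ^ 20 ≤ P / lam ^ 3 := by
      gcongr
      norm_num
    have e4 : 0 ≤ P / lam ^ 3 := by positivity
    linarith
  refine (norm_add_le _ _).trans ((add_le_add hlow hhigh).trans ?_)
  have e3 : P / lam ^ 20 ≤ P / lam ^ 3 := by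
    gcongr
    norm_num
  calc _ ≤ 16 * (P / lam ^ 3) := by
        have : 0 ≤ P / lam ^ 3 := by positivity
        linarith
    _ ≤ lam * (P / lam ^ 3) := by gcongr
    _ = _ := by field_simp

lemma eventually_norm_sum_dyadicPrimes_le {δ₀ : ℝ} (hδ₀ : 0 < δ₀) (hδ₀' : δ₀ ≤ 1 / 2) (N : ℕ) :
    ∀ᶠ P : ℕ in Filter.atTop, ∀ a : ℝ, (P : ℝ) ^ 10 ≤ |a| →
      Real.log |a| ≤ Real.log P ^ (3 / 2 - δ₀) →
      ‖∑ p ∈ dyadicPrimes P, (Real.log p : ℂ) * unitExp (a / p)‖ ≤ P / Real.log P ^ N := by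
  filter_upwards [eventually_norm_sum_prime_twoTermPhase_le hδ₀ hδ₀' N 0,
    eventually_le_log_natCast 1] with P h hl1 a ha hlog
  have := h a 0 1 le_rfl ha hlog (by rw [abs_zero]; positivity)
    (by simpa using Real.one_le_rpow hl1 (by norm_num)) P (2 * P) le_rfl le_rfl
  simpa [twoTermPhase, dyadicPrimes] using this

/-- The frequencies `n ± k x`, apart from `n - k₀ x`, give small exponential sums over primes. -/
lemma eventually_norm_sum_log_mul_shift_le {δ₀ : ℝ} (hδ₀ : 0 < δ₀) (hδ₀' : δ₀ ≤ 1 / 2) :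
    ∀ᶠ P : ℕ in Filter.atTop, ∀ n x k : ℕ, P ^ 10 ≤ n → x ≤ n → k ≤ Real.log P ^ 12 →
      Real.log n + Real.log P ≤ Real.log P ^ (3 / 2 - δ₀) →
      ‖∑ p ∈ dyadicPrimes P, (Real.log p : ℂ) * unitExp (n / p) * unitExp (k * (x / p))‖ ≤
        P / Real.log P ^ 20 ∧
      ((P : ℝ) ^ 10 ≤ |(n : ℝ) - k * x| →
        ‖∑ p ∈ dyadicPrimes P, (Real.log p : ℂ) * unitExp (n / p) * unitExp (-(k * (x / p)))‖ ≤
          P / Real.log P ^ 20) := by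
  filter_upwards [eventually_norm_sum_dyadicPrimes_le hδ₀ hδ₀' 20, eventually_le_log_natCast 2,
    eventually_log_pow_le_rpow 13 one_pos, Filter.eventually_ge_atTop 1] with
    P h hl2 hl13 hP1 n x k hPn hxn hk hlog
  set lam := Real.log P
  have hP' : (0 : ℝ) < P := by exact_mod_cast hP1
  have hn0 : (0 : ℝ) < n := by
    exact_mod_cast (Nat.pow_pos (by omega : 0 < P) : 0 < P ^ 10).trans_le hPn
  have hn' : (P : ℝ) ^ 10 ≤ n := by exact_mod_cast hPn
  have hkP : 1 + (k : ℝ) ≤ P := by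
    rw [Real.rpow_one] at hl13
    have : (1 : ℝ) ≤ lam ^ 12 := one_le_pow₀ (by linarith)
    calc 1 + (k : ℝ) ≤ 2 * lam ^ 12 := by linarith
      _ ≤ lam * lam ^ 12 := by gcongr
      _ = lam ^ 13 := by ring
      _ ≤ P := hl13
  have hkx : (k : ℝ) * x ≤ k * n := by gcongr
  have hlogle : ∀ a : ℝ, (P : ℝ) ^ 10 ≤ |a| → |a| ≤ n + k * x →
      Real.log |a| ≤ lam ^ (3 / 2 - δ₀) := fun a ha1 ha2 => by
    refine le_trans ?_ hlog
    rw [← Real.log_mul hn0.ne' hP'.ne']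
    refine Real.log_le_log (lt_of_lt_of_le (by positivity) ha1) (ha2.trans ?_)
    nlinarith
  have hnonneg : 0 ≤ (k : ℝ) * x := by positivity
  have key : ∀ a b : ℝ, (n : ℝ) + b = a → (P : ℝ) ^ 10 ≤ |a| → |a| ≤ n + k * x →
      ‖∑ p ∈ dyadicPrimes P, (Real.log p : ℂ) * unitExp (n / p) * unitExp (b / p)‖ ≤
        P / lam ^ 20 := fun a b hab ha1 ha2 => by
    refine le_of_eq_of_le ?_ (h a ha1 (hlogle a ha1 ha2))
    congr 1
    refine sum_congr rfl fun p _ => ?_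
    rw [mul_assoc, ← unitExp_add, ← add_div, hab]
  constructor
  · have h1 := key (n + k * x) (k * x) rfl (by rw [abs_of_nonneg (by positivity)]; linarith)
      (by rw [abs_of_nonneg (by positivity)])
    simpa only [mul_div_assoc] using h1
  · intro hbig
    have h1 := key (n - k * x) (-(k * x)) (by ring) hbig (by
      rw [abs_le]
      constructor <;> linarith)
    simpa only [mul_div_assoc, neg_div] using h1

lemma norm_sum_log_mul_le {D : Finset ℕ} (u v : ℕ → ℝ) :
    ‖∑ p ∈ D, (Real.log p : ℂ) * unitExp (u p) * unitExp (v p)‖ ≤ ∑ p ∈ D, Real.log p := by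
  refine (norm_sum_le _ _).trans (sum_le_sum fun p _ => ?_)
  rw [norm_mul, norm_mul, norm_unitExp, norm_unitExp, mul_one, mul_one, Complex.norm_real,
    Real.norm_eq_abs, abs_of_nonneg (Real.log_natCast_nonneg p)]

lemma eventually_norm_sum_log_mul_fract_le {δ₀ : ℝ} (hδ₀ : 0 < δ₀) (hδ₀' : δ₀ ≤ 1 / 2) :
    ∀ᶠ P : ℕ in Filter.atTop, ∀ n x k₀ : ℕ, P ^ 10 ≤ n → x ≤ n → 2 * P ≤ x →
      Real.log n + Real.log P ≤ Real.log P ^ (3 / 2 - δ₀) → k₀ ≠ 1 →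
      (∀ k : ℕ, 1 ≤ k → k ≤ Real.log P ^ 12 → k ≠ k₀ → (P : ℝ) ^ 10 ≤ |(n : ℝ) - k * x|) →
      ‖∑ p ∈ dyadicPrimes P, (Real.log p : ℂ) * unitExp (n / p) *
        ((Int.fract ((x : ℝ) / p) - 1 / 2 : ℝ) : ℂ)‖ ≤
        (if k₀ = 0 then 0 else (∑ p ∈ dyadicPrimes P, Real.log p) / (4 * Real.pi)) +
          9 * (P / Real.log P ^ 3) := by
  filter_upwards [eventually_norm_sum_log_mul_shift_le hδ₀ hδ₀',
    eventually_sawtooth_error_le hδ₀ hδ₀', eventually_le_log_natCast 2,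
    Filter.eventually_ge_atTop 2] with P hshift herr hl2 hP2 n x k₀ hPn hxn hPx hlog hk₀ hfreq
  set lam := Real.log P
  set W := ∑ p ∈ dyadicPrimes P, Real.log p
  have hW : 0 ≤ W := sum_nonneg fun p _ => Real.log_natCast_nonneg p
  have hl1 : 1 ≤ lam := by linarith
  have hl0 : 0 < lam := by linarith
  have hδ : 0 < (lam ^ 6)⁻¹ := by positivity
  have hδ1 : (lam ^ 6)⁻¹ < 1 := inv_lt_one_of_one_lt₀ (one_lt_pow₀ (by linarith) (by norm_num))
  have hK1 : 1 ≤ ⌊lam ^ 12⌋₊ := Nat.floor_pos.2 (one_le_pow₀ hl1)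
  have hKle : (⌊lam ^ 12⌋₊ : ℝ) ≤ lam ^ 12 := Nat.floor_le (by positivity)
  have hp := Real.pi_pos
  have hlogx : Real.log x + lam ≤ lam ^ (3 / 2 - δ₀) := by
    have : Real.log x ≤ Real.log n :=
      Real.log_le_log (by exact_mod_cast (by omega : 0 < x)) (by exact_mod_cast hxn)
    linarith
  have hmain := norm_sum_mul_fract_le hδ hδ1 hK1 (dyadicPrimes P)
    (fun p => (Real.log p : ℂ) * unitExp (n / p)) (fun p => (x : ℝ) / p)
    (G := 2 * lam) (by positivity)
    (fun p hp => norm_log_mul_unitExp_le hP2 (mem_filter.1 hp).1 _)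
    (fun k => P / lam ^ 20 + if k = k₀ then W / 2 else 0) (fun k hk => by
      rw [mem_Icc] at hk
      have hkl : (k : ℝ) ≤ lam ^ 12 := le_trans (by exact_mod_cast hk.2) hKle
      obtain ⟨h1, h2⟩ := hshift n x k hPn hxn hkl hlog
      split_ifs with hkk
      · have h3 := norm_sum_log_mul_le (D := dyadicPrimes P) (fun p => (n : ℝ) / p)
          (fun p => -(k * ((x : ℝ) / p)))
        have : 0 ≤ P / lam ^ 20 := by positivity
        linarith
      · have h3 := h2 (hfreq k hk.1 hkl hkk)
        linarith)
  have herr' := herr x 1 le_rfl (by simpa using Real.one_le_rpow hl1 (by norm_num)) hlogx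
    (2 * P) le_rfl (by simpa using hPx) (dyadicPrimes P) (filter_subset _ _)
  simp only [pow_one] at herr'
  have hsum : ∑ k ∈ Icc 1 ⌊lam ^ 12⌋₊,
      (P / lam ^ 20 + if k = k₀ then W / 2 else 0) / (Real.pi * k) ≤
      P / lam ^ 8 + if k₀ = 0 then 0 else W / (4 * Real.pi) := by
    simp_rw [add_div]
    rw [sum_add_distrib]
    refine add_le_add ?_ ?_
    · refine (sum_div_pi_mul_le (by positivity) fun k hk => (mem_Icc.1 hk).1).trans ?_
      rw [Nat.card_Icc, Nat.add_sub_cancel]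
      calc _ ≤ lam ^ 12 * (P / lam ^ 20) := by gcongr
        _ = _ := by field_simp
    · simp_rw [ite_div, zero_div]
      rw [sum_ite_eq']
      split_ifs with h1 h2 h2
      · rw [mem_Icc] at h1
        omega
      · have : (2 : ℝ) ≤ k₀ := by exact_mod_cast (by omega : 2 ≤ k₀)
        rw [div_div]
        refine div_le_div_of_nonneg_left hW (by positivity) ?_
        nlinarith
      · exact le_rfl
      · positivity
  have e2 : P / lam ^ 8 ≤ P / lam ^ 3 := by
    gcongr
    norm_num
  linarith

lemma eventually_sum_log_le_norm_sum_log_mul_fract {δ₀ : ℝ} (hδ₀ : 0 < δ₀) (hδ₀' : δ₀ ≤ 1 / 2) :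
    ∀ᶠ P : ℕ in Filter.atTop, ∀ n : ℕ, P ^ 10 ≤ n →
      Real.log n + Real.log P ≤ Real.log P ^ (3 / 2 - δ₀) →
      (∑ p ∈ dyadicPrimes P, Real.log p) / Real.pi ^ 2 ≤
        ‖∑ p ∈ dyadicPrimes P, (Real.log p : ℂ) * unitExp (n / p) *
          ((Int.fract ((n : ℝ) / p) - 1 / 2 : ℝ) : ℂ)‖ + 10 * (P / Real.log P ^ 3) := by
  filter_upwards [eventually_norm_sum_log_mul_shift_le hδ₀ hδ₀',
    eventually_sawtooth_error_le hδ₀ hδ₀', eventually_le_log_natCast 2,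
    Filter.eventually_ge_atTop 2] with P hshift herr hl2 hP2 n hPn hlog
  set lam := Real.log P
  set W := ∑ p ∈ dyadicPrimes P, Real.log p with hW
  have hl1 : 1 ≤ lam := by linarith
  have hl0 : 0 < lam := by linarith
  have hδ : 0 < (lam ^ 6)⁻¹ := by positivity
  have hδ1 : (lam ^ 6)⁻¹ ≤ 1 / 2 := by
    rw [one_div]
    exact inv_anti₀ (by norm_num) (hl2.trans (le_self_pow₀ hl1 (by norm_num)))
  have hK1 : 1 ≤ ⌊lam ^ 12⌋₊ := Nat.floor_pos.2 (one_le_pow₀ hl1)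
  have hKle : (⌊lam ^ 12⌋₊ : ℝ) ≤ lam ^ 12 := Nat.floor_le (by positivity)
  have hn' : (P : ℝ) ^ 10 ≤ n := by exact_mod_cast hPn
  have hPn2 : 2 * P ≤ n := by
    have : 2 * P ≤ P ^ 10 := by
      calc 2 * P ≤ P * P := Nat.mul_le_mul_right P hP2
        _ = P ^ 2 := (sq P).symm
        _ ≤ P ^ 10 := Nat.pow_le_pow_right (by omega) (by norm_num)
    omega
  have hmain := le_norm_sum_mul_fract_add hδ hδ1 hK1 (dyadicPrimes P)
    (fun p => (Real.log p : ℂ) * unitExp (n / p)) (fun p => (n : ℝ) / p)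
    (G := 2 * lam) (by positivity)
    (fun p hp => norm_log_mul_unitExp_le hP2 (mem_filter.1 hp).1 _)
    (fun k => P / lam ^ 20) (fun k hk => by
      rw [mem_Icc] at hk
      have hkl : (k : ℝ) ≤ lam ^ 12 := le_trans (by exact_mod_cast hk.2) hKle
      obtain ⟨h1, h2⟩ := hshift n n k hPn le_rfl hkl hlog
      have hk2 : (2 : ℝ) ≤ k := by exact_mod_cast hk.1
      have h3 := h2 (by
        rw [abs_sub_comm]
        refine le_trans ?_ (le_abs_self _)
        nlinarith)
      linarith)
  have herr' := herr n 1 le_rfl (by simpa using Real.one_le_rpow hl1 (by norm_num)) hlog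
    (2 * P) le_rfl (by simpa using hPn2) (dyadicPrimes P) (filter_subset _ _)
  simp only [pow_one] at herr'
  have hsum : ∑ k ∈ Icc 2 ⌊lam ^ 12⌋₊, P / lam ^ 20 / (Real.pi * k) ≤ P / lam ^ 8 := by
    refine (sum_div_pi_mul_le (by positivity) fun k hk => by
      rw [mem_Icc] at hk
      omega).trans ?_
    calc _ ≤ lam ^ 12 * (P / lam ^ 20) := by
          gcongr
          refine le_trans ?_ hKle
          rw [Nat.card_Icc]
          exact_mod_cast (by omega)
      _ = _ := by field_simp
  have e0 : 0 ≤ P / lam ^ 3 := by positivity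
  have e2 : P / lam ^ 8 ≤ 1 / 2 * (P / lam ^ 3) := by
    have h5 : 2 ≤ lam ^ 5 := hl2.trans (le_self_pow₀ hl1 (by norm_num))
    calc P / lam ^ 8 = P / lam ^ 3 / lam ^ 5 := by field_simp
      _ ≤ P / lam ^ 3 / 2 := div_le_div_of_nonneg_left e0 (by norm_num) h5
      _ = _ := by ring
  have e3 : P / lam ^ 20 ≤ P / lam ^ 3 := by
    gcongr
    norm_num
  have h1 := (hshift n n 1 hPn le_rfl (by simpa using one_le_pow₀ hl1) hlog).1
  have hdiag : ‖∑ p ∈ dyadicPrimes P, (Real.log p : ℂ) * unitExp (n / p) * unitExp (-(n / p))‖ =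
      W := by
    have : ∑ p ∈ dyadicPrimes P, (Real.log p : ℂ) * unitExp (n / p) * unitExp (-(n / p)) =
        (W : ℂ) := by
      rw [hW]
      push_cast
      refine sum_congr rfl fun p _ => ?_
      rw [mul_assoc, ← unitExp_add, add_neg_cancel, unitExp_zero, mul_one]
    rw [this, Complex.norm_real, Real.norm_eq_abs,
      abs_of_nonneg (sum_nonneg fun p _ => Real.log_natCast_nonneg p)]
  simp only [Nat.cast_one, one_mul] at h1
  rw [hdiag, sub_div] at hmain
  have e4 : ‖∑ p ∈ dyadicPrimes P, (Real.log p : ℂ) * unitExp (n / p) * unitExp (n / p)‖ /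
      Real.pi ^ 2 ≤ 1 / 2 * (P / lam ^ 3) := by
    have hpi : (2 : ℝ) ≤ Real.pi ^ 2 := by nlinarith [Real.pi_gt_three]
    calc _ ≤ P / lam ^ 3 / Real.pi ^ 2 := by
          gcongr
          exact h1.trans e3
      _ ≤ P / lam ^ 3 / 2 := div_le_div_of_nonneg_left e0 (by norm_num) hpi
      _ = _ := by ring
  have := hmain.trans (add_le_add_right (add_le_add herr' (hsum.trans e2)) _)
  linarith

/-! ### Binomial coefficients -/

/-- At most one multiple of `x` or of `x - y` comes close to `n`. -/
lemma exists_exceptional_frequency {n x y Q K : ℝ} (hQ : 0 < Q) (hK : 1 ≤ K) (hy : Q ≤ y)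
    (hyx : y * (4 * K) ≤ x) (hxn : x + Q ≤ n) :
    ∃ k₁ k₂ : ℕ, k₁ ≠ 1 ∧ k₂ ≠ 1 ∧ (k₁ = 0 ∨ k₂ = 0) ∧
      (∀ k : ℕ, 1 ≤ k → (k : ℝ) ≤ K → k ≠ k₁ → Q ≤ |n - k * x|) ∧
      (∀ k : ℕ, 1 ≤ k → (k : ℝ) ≤ K → k ≠ k₂ → Q ≤ |n - k * (x - y)|) := by
  have hyK : y ≤ y * K := le_mul_of_one_le_right (by linarith) hK
  have hx : 4 * Q ≤ x := by linarith
  have hsame : ∀ z : ℝ, 2 * Q ≤ z → ∀ k l : ℕ, |n - k * z| < Q → k ≠ l → Q ≤ |n - l * z| := by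
    intro z hz k l hk hkl
    by_contra! hl
    rw [abs_lt] at hk hl
    rcases Nat.lt_or_gt_of_ne hkl with h | h
    · have : (k : ℝ) + 1 ≤ l := by exact_mod_cast h
      nlinarith
    · have : (l : ℝ) + 1 ≤ k := by exact_mod_cast h
      nlinarith
  have hone₁ : ∀ k : ℕ, |n - k * x| < Q → k ≠ 1 := by
    rintro k hk rfl
    rw [Nat.cast_one, one_mul, abs_lt] at hk
    linarith
  have hone₂ : ∀ k : ℕ, |n - k * (x - y)| < Q → k ≠ 1 := by
    rintro k hk rfl
    rw [Nat.cast_one, one_mul, abs_lt] at hk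
    linarith
  by_cases h₁ : ∃ k : ℕ, 1 ≤ k ∧ (k : ℝ) ≤ K ∧ |n - k * x| < Q
  · obtain ⟨k, hk1, hkK, hk⟩ := h₁
    refine ⟨k, 0, hone₁ k hk, by norm_num, Or.inr rfl,
      fun l _ _ hl => hsame x (by linarith) k l hk hl.symm, fun l hl1 hlK _ => ?_⟩
    by_contra! hl
    have hk2 : (2 : ℝ) ≤ k := by
      have := hone₁ k hk
      exact_mod_cast (show 2 ≤ k by omega)
    rw [abs_lt] at hk hl
    have hly : l * y ≤ K * y := by gcongr; linarith
    have hl0 : 0 ≤ (l : ℝ) * y := by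
      have : 0 ≤ y := by linarith
      positivity
    rcases lt_trichotomy k l with h | rfl | h
    · have : (k : ℝ) + 1 ≤ l := by exact_mod_cast h
      nlinarith
    · nlinarith
    · have : (l : ℝ) + 1 ≤ k := by exact_mod_cast h
      nlinarith
  · push Not at h₁
    by_cases h₂ : ∃ k : ℕ, 1 ≤ k ∧ (k : ℝ) ≤ K ∧ |n - k * (x - y)| < Q
    · obtain ⟨k, hk1, hkK, hk⟩ := h₂
      exact ⟨0, k, by norm_num, hone₂ k hk, Or.inl rfl, fun l hl1 hlK _ => h₁ l hl1 hlK,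
        fun l _ _ hl => hsame (x - y) (by linarith) k l hk hl.symm⟩
    · push Not at h₂
      exact ⟨0, 0, by norm_num, by norm_num, Or.inl rfl, fun l hl1 hlK _ => h₁ l hl1 hlK,
        fun l hl1 hlK _ => h₂ l hl1 hlK⟩

lemma fract_natCast_div_pow (x p j : ℕ) :
    Int.fract ((x : ℝ) / (p : ℝ) ^ j) = (x : ℝ) / (p : ℝ) ^ j - ((x / p ^ j : ℕ) : ℝ) := by
  rw [Int.fract, ← Nat.cast_pow, ← Nat.floor_div_eq_div (K := ℝ),
    natCast_floor_eq_intCast_floor (by positivity)]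

/-- Legendre's formula for binomial coefficients, in terms of fractional parts. -/
lemma sum_fract_choose {p n m b : ℕ} (hp : p.Prime) (hmn : m ≤ n) (hb0 : b ≠ 0)
    (hb : n < p ^ b) :
    ∑ j ∈ Ico 1 b, (Int.fract ((n : ℝ) / (p : ℝ) ^ j) - Int.fract ((m : ℝ) / (p : ℝ) ^ j) -
      Int.fract (((n - m : ℕ) : ℝ) / (p : ℝ) ^ j)) = -(padicValNat p (n.choose m) : ℝ) := by
  have := Fact.mk hp
  have hlog : ∀ x ≤ n, Nat.log p x < b := fun x hx =>
    Nat.log_lt_of_lt_pow' hb0 (hx.trans_lt hb)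
  have hfac := congrArg (padicValNat p) (Nat.choose_mul_factorial_mul_factorial hmn)
  have h0 := (Nat.choose_pos hmn).ne'
  rw [padicValNat.mul (mul_ne_zero h0 (Nat.factorial_ne_zero _)) (Nat.factorial_ne_zero _),
    padicValNat.mul h0 (Nat.factorial_ne_zero _), padicValNat_factorial (hlog n le_rfl),
    padicValNat_factorial (hlog m hmn), padicValNat_factorial (hlog _ (Nat.sub_le _ _))] at hfac
  have hfac' : (padicValNat p (n.choose m) : ℝ) + ∑ j ∈ Ico 1 b, ((m / p ^ j : ℕ) : ℝ) +
      ∑ j ∈ Ico 1 b, (((n - m) / p ^ j : ℕ) : ℝ) = ∑ j ∈ Ico 1 b, ((n / p ^ j : ℕ) : ℝ) := by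
    exact_mod_cast hfac
  have : ∀ j ∈ Ico 1 b, Int.fract ((n : ℝ) / (p : ℝ) ^ j) - Int.fract ((m : ℝ) / (p : ℝ) ^ j) -
      Int.fract (((n - m : ℕ) : ℝ) / (p : ℝ) ^ j) = ((m / p ^ j : ℕ) : ℝ) +
        (((n - m) / p ^ j : ℕ) : ℝ) - ((n / p ^ j : ℕ) : ℝ) := by
    intro j _
    simp only [fract_natCast_div_pow]
    rw [Nat.cast_sub hmn]
    ring
  rw [sum_congr rfl this, sum_sub_distrib, sum_add_distrib, ← hfac']
  ring

lemma fract_identity_of_choose_eq {p n m n' m' b : ℕ} (hp : p.Prime) (hmn : m ≤ n) (hmn' : m' ≤ n')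
    (hb2 : 2 ≤ b) (hb : n < p ^ b) (hb' : n' < p ^ b) (h : n.choose m = n'.choose m') :
    Int.fract ((n : ℝ) / p) - 1 / 2 =
      (Int.fract ((m : ℝ) / p) - 1 / 2) + (Int.fract (((n - m : ℕ) : ℝ) / p) - 1 / 2) +
      (Int.fract ((n' : ℝ) / p) - 1 / 2) - (Int.fract ((m' : ℝ) / p) - 1 / 2) -
      (Int.fract (((n' - m' : ℕ) : ℝ) / p) - 1 / 2) +
      ∑ j ∈ Ico 2 b, (Int.fract ((m : ℝ) / (p : ℝ) ^ j) +
        Int.fract (((n - m : ℕ) : ℝ) / (p : ℝ) ^ j) + Int.fract ((n' : ℝ) / (p : ℝ) ^ j) -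
        Int.fract ((m' : ℝ) / (p : ℝ) ^ j) - Int.fract (((n' - m' : ℕ) : ℝ) / (p : ℝ) ^ j) -
        Int.fract ((n : ℝ) / (p : ℝ) ^ j)) := by
  have h1 := sum_fract_choose hp hmn (by omega) hb
  have h2 := sum_fract_choose hp hmn' (by omega) hb'
  rw [sum_eq_sum_Ico_succ_bot (by omega : 1 < b)] at h1 h2
  rw [h, ← h2] at h1
  simp only [sum_add_distrib, sum_sub_distrib, pow_one, Nat.reduceAdd] at h1 ⊢
  linarith

/-- Sums over the primes of a dyadic block, twisted by `log p` and `e(n / p)`. -/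
noncomputable def twistedPrimeSum (P n : ℕ) (f : ℕ → ℝ) : ℂ :=
  ∑ p ∈ dyadicPrimes P, (Real.log p : ℂ) * unitExp (n / p) * (f p : ℂ)

lemma twistedPrimeSum_add (P n : ℕ) (f g : ℕ → ℝ) :
    twistedPrimeSum P n (fun p => f p + g p) = twistedPrimeSum P n f + twistedPrimeSum P n g := by
  simp only [twistedPrimeSum, ← sum_add_distrib]
  exact sum_congr rfl fun p _ => by push_cast; ring

lemma twistedPrimeSum_sub (P n : ℕ) (f g : ℕ → ℝ) :
    twistedPrimeSum P n (fun p => f p - g p) = twistedPrimeSum P n f - twistedPrimeSum P n g := by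
  simp only [twistedPrimeSum, ← sum_sub_distrib]
  exact sum_congr rfl fun p _ => by push_cast; ring

lemma twistedPrimeSum_sum (P n : ℕ) (s : Finset ℕ) (f : ℕ → ℕ → ℝ) :
    twistedPrimeSum P n (fun p => ∑ j ∈ s, f j p) = ∑ j ∈ s, twistedPrimeSum P n (f j) := by
  simp only [twistedPrimeSum]
  rw [sum_comm]
  exact sum_congr rfl fun p _ => by push_cast; rw [mul_sum]

lemma twistedPrimeSum_congr {P n : ℕ} {f g : ℕ → ℝ} (h : ∀ p ∈ dyadicPrimes P, f p = g p) :
    twistedPrimeSum P n f = twistedPrimeSum P n g :=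
  sum_congr rfl fun p hp => by rw [h p hp]

/-- The sum over primes obtained from Legendre's formula for two equal binomial coefficients. -/
lemma norm_twistedPrimeSum_le_of_choose_eq {P n m n' m' b : ℕ} {E : ℝ} (hE0 : 0 ≤ E)
    (hn' : n' ≤ n) (hb2 : 2 ≤ b) (hb : n < P ^ b)
    (h : n.choose m = n'.choose m') (hm : 1 ≤ m) (hm' : 1 ≤ m') (hnm : m < n) (hnm' : m' < n')
    (hE : ∀ x j : ℕ, 1 ≤ x → x ≤ n → 2 ≤ j → j < b →
      ‖twistedPrimeSum P n fun p => Int.fract ((x : ℝ) / (p : ℝ) ^ j)‖ ≤ E) :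
    ‖twistedPrimeSum P n fun p => Int.fract ((n : ℝ) / p) - 1 / 2‖ ≤
      ‖twistedPrimeSum P n fun p => Int.fract ((m : ℝ) / p) - 1 / 2‖ +
      ‖twistedPrimeSum P n fun p => Int.fract (((n - m : ℕ) : ℝ) / p) - 1 / 2‖ +
      ‖twistedPrimeSum P n fun p => Int.fract ((n' : ℝ) / p) - 1 / 2‖ +
      ‖twistedPrimeSum P n fun p => Int.fract ((m' : ℝ) / p) - 1 / 2‖ +
      ‖twistedPrimeSum P n fun p => Int.fract (((n' - m' : ℕ) : ℝ) / p) - 1 / 2‖ +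
      6 * (b * E) := by
  have key : twistedPrimeSum P n (fun p => Int.fract ((n : ℝ) / p) - 1 / 2) = _ :=
    twistedPrimeSum_congr fun p hp => by
      simp only [dyadicPrimes, mem_filter, mem_Ioc] at hp
      have hpb : P ^ b ≤ p ^ b := Nat.pow_le_pow_left hp.1.1.le b
      exact fract_identity_of_choose_eq hp.2 hnm.le hnm'.le hb2 (by omega) (by omega) h
  have htail : ‖twistedPrimeSum P n (fun p => ∑ j ∈ Ico 2 b, (Int.fract ((m : ℝ) / (p : ℝ) ^ j) +
        Int.fract (((n - m : ℕ) : ℝ) / (p : ℝ) ^ j) + Int.fract ((n' : ℝ) / (p : ℝ) ^ j) -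
        Int.fract ((m' : ℝ) / (p : ℝ) ^ j) - Int.fract (((n' - m' : ℕ) : ℝ) / (p : ℝ) ^ j) -
        Int.fract ((n : ℝ) / (p : ℝ) ^ j)))‖ ≤ 6 * (b * E) := by
    rw [twistedPrimeSum_sum]
    calc _ ≤ ∑ j ∈ Ico 2 b, 6 * E := norm_sum_le_of_le _ fun j hj => by
          rw [mem_Ico] at hj
          simp only [twistedPrimeSum_sub, twistedPrimeSum_add]
          have hx := fun x hx hxn => hE x j hx hxn hj.1 hj.2
          refine (norm_sub_le_of_le (norm_sub_le_of_le (norm_sub_le_of_le (norm_add_le_of_le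
            (norm_add_le_of_le (hx m hm hnm.le) (hx (n - m) (by omega) (by omega)))
            (hx n' (by omega) hn')) (hx m' hm' (by omega))) (hx (n' - m') (by omega) (by omega)))
            (hx n (by omega) le_rfl)).trans_eq (by ring)
      _ ≤ b * (6 * E) := by
          rw [sum_const, Nat.card_Ico, nsmul_eq_mul]
          gcongr
          omega
      _ = _ := by ring
  rw [key, twistedPrimeSum_add, twistedPrimeSum_sub, twistedPrimeSum_sub, twistedPrimeSum_add,
    twistedPrimeSum_add]
  exact norm_add_le_of_le (norm_sub_le_of_le (norm_sub_le_of_le (norm_add_le_of_le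
    (norm_add_le_of_le le_rfl le_rfl) le_rfl) le_rfl) le_rfl) htail

lemma exists_lt_pow_of_log_le {P n : ℕ} {δ₀ : ℝ} (hδ₀ : 0 < δ₀) (hP : 1 ≤ Real.log P)
    (hPn : P ≤ n) (h : Real.log n + Real.log P ≤ Real.log P ^ (3 / 2 - δ₀)) :
    ∃ b : ℕ, 2 ≤ b ∧ n < P ^ b ∧ (b : ℝ) ≤ Real.log P ^ ((1 : ℝ) / 2) := by
  set lam := Real.log P with hlam
  have hl0 : 0 < lam := by linarith
  have hP0 : 0 < P := Nat.pos_of_ne_zero fun h0 => by simp [hlam, h0] at hl0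
  have hn0 : 0 < n := by omega
  have hlogle : lam ≤ Real.log n := Real.log_le_log (by exact_mod_cast hP0) (by exact_mod_cast hPn)
  refine ⟨⌊Real.log n / lam⌋₊ + 1, ?_, ?_, ?_⟩
  · have : 1 ≤ ⌊Real.log n / lam⌋₊ := Nat.le_floor (by rw [Nat.cast_one, le_div_iff₀ hl0]; linarith)
    omega
  · have h1 := Nat.lt_floor_add_one (Real.log n / lam)
    rw [div_lt_iff₀ hl0] at h1
    have : Real.log n < Real.log ((P ^ (⌊Real.log n / lam⌋₊ + 1) : ℕ) : ℝ) := by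
      push_cast
      rw [Real.log_pow]
      push_cast
      exact h1
    exact_mod_cast (Real.log_lt_log_iff (by exact_mod_cast hn0) (by positivity)).1 this
  · have h1 := Nat.floor_le (a := Real.log n / lam) (by positivity)
    push_cast
    have h2 : Real.log n / lam + 1 ≤ lam ^ (3 / 2 - δ₀) / lam := by
      rw [le_div_iff₀ hl0, add_mul, div_mul_cancel₀ _ hl0.ne']
      linarith
    have h3 : lam ^ (3 / 2 - δ₀) / lam = lam ^ (1 / 2 - δ₀) := by
      rw [← Real.rpow_sub_one hl0.ne']
      ring_nf
    have h4 : lam ^ (1 / 2 - δ₀) ≤ lam ^ ((1 : ℝ) / 2) :=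
      Real.rpow_le_rpow_of_exponent_le hP (by linarith)
    linarith

lemma div_four_pi_add_le_div_pi_sq {W : ℝ} (hW : 0 ≤ W) :
    W / (4 * Real.pi) + W / 50 ≤ W / Real.pi ^ 2 := by
  have hpi := Real.pi_gt_three
  have h2 : Real.pi ^ 2 ≤ 3.15 ^ 2 := by
    gcongr
    exact Real.pi_lt_d2.le
  have key : 1 / (4 * Real.pi) + 1 / 50 ≤ 1 / Real.pi ^ 2 := by
    have h0 : Real.pi ≠ 0 := by positivity
    have : 1 / (4 * Real.pi) = Real.pi / 4 / Real.pi ^ 2 := by field_simp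
    rw [this, ← sub_nonneg, show 1 / Real.pi ^ 2 - (Real.pi / 4 / Real.pi ^ 2 + 1 / 50) =
      (1 - Real.pi / 4 - Real.pi ^ 2 / 50) / Real.pi ^ 2 by field_simp; ring]
    exact div_nonneg (by linarith [Real.pi_lt_d2]) (by positivity)
  calc _ = W * (1 / (4 * Real.pi) + 1 / 50) := by ring
    _ ≤ W * (1 / Real.pi ^ 2) := by gcongr
    _ = _ := by ring

/-- Two well separated binomial coefficients cannot be equal: a suitable dyadic block of primes
distinguishes them. -/
theorem eventually_choose_ne_choose {δ₀ : ℝ} (hδ₀ : 0 < δ₀) (hδ₀' : δ₀ ≤ 1 / 2) :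
    ∀ᶠ P : ℕ in Filter.atTop, ∀ n m n' m' : ℕ, P ^ 10 ≤ m → P ^ 10 ≤ m' → n' + P ^ 10 ≤ n →
      m * Real.log P ^ 13 ≤ n → m' * Real.log P ^ 13 ≤ n' →
      Real.log n + Real.log P ≤ Real.log P ^ (3 / 2 - δ₀) →
      (P : ℝ) / 3 ≤ ∑ p ∈ dyadicPrimes P, Real.log p → n.choose m ≠ n'.choose m' := by
  filter_upwards [eventually_norm_sum_log_mul_fract_le hδ₀ hδ₀',
    eventually_sum_log_le_norm_sum_log_mul_fract hδ₀ hδ₀',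
    eventually_norm_sum_log_mul_fract_div_pow_le hδ₀ hδ₀', eventually_le_log_natCast 10000,
    Filter.eventually_ge_atTop 2] with P hupper hlower htail hl hP2 n m n' m' hm hm' hnn' hmn hmn'
      hlog hW heq
  set lam := Real.log P with hlam
  set W := ∑ p ∈ dyadicPrimes P, Real.log p
  have hl0 : 0 < lam := by linarith
  have hl1 : 1 ≤ lam := by linarith
  have hQ : 2 * P ≤ P ^ 10 := by
    calc 2 * P ≤ P * P := Nat.mul_le_mul_right P hP2
      _ = P ^ 2 := (sq P).symm
      _ ≤ P ^ 10 := Nat.pow_le_pow_right (by omega) (by norm_num)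
  have hQ0 : (0 : ℝ) < (P : ℝ) ^ 10 := by positivity
  have hmQ : (P : ℝ) ^ 10 ≤ m := by exact_mod_cast hm
  have hmQ' : (P : ℝ) ^ 10 ≤ m' := by exact_mod_cast hm'
  have hnQ : (n' : ℝ) + (P : ℝ) ^ 10 ≤ n := by exact_mod_cast hnn'
  have hK : 1 ≤ lam ^ 12 := one_le_pow₀ hl1
  have h13 : 4 * lam ^ 12 ≤ lam ^ 13 := by
    rw [pow_succ lam 12]
    nlinarith
  have hmK : m * (4 * lam ^ 12) ≤ n := le_trans (by gcongr) hmn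
  have hmK' : m' * (4 * lam ^ 12) ≤ n' := le_trans (by gcongr) hmn'
  have hm4 : (m : ℝ) * 4 ≤ n := le_trans (by gcongr; linarith) hmK
  have hm4' : (m' : ℝ) * 4 ≤ n' := le_trans (by gcongr; linarith) hmK'
  have hmn4 : m * 4 ≤ n := by exact_mod_cast hm4
  have hmn4' : m' * 4 ≤ n' := by exact_mod_cast hm4'
  have hPn : P ^ 10 ≤ n := by omega
  obtain ⟨b, hb2, hb, hbl⟩ := exists_lt_pow_of_log_le hδ₀ hl1 (by omega) hlog
  have hmain := norm_twistedPrimeSum_le_of_choose_eq (E := P / lam ^ 2) (by positivity) (by omega)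
    hb2 hb heq (by omega) (by omega) (by omega) (by omega) fun x j hx hxn hj hjb =>
      htail n x j hj (le_trans (by exact_mod_cast hjb.le) hbl) hPn hxn hx hlog
  simp only [twistedPrimeSum] at hmain
  obtain ⟨k₁, k₂, hk₁, hk₂, hk₁₂, hfreq₁, hfreq₂⟩ :=
    exists_exceptional_frequency hQ0 hK hmQ' hmK' hnQ
  have hsmall : ∀ y : ℝ, (P : ℝ) ^ 10 ≤ y → y * (4 * lam ^ 12) ≤ n → ∀ k : ℕ, 1 ≤ k →
      k ≤ lam ^ 12 → k ≠ 0 → (P : ℝ) ^ 10 ≤ |(n : ℝ) - k * y| := by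
    intro y hy hyn k _ hk _
    refine le_trans ?_ (le_abs_self _)
    have h1 : k * y ≤ lam ^ 12 * y := by gcongr; linarith
    have h2 : y ≤ lam ^ 12 * y := le_mul_of_one_le_left (by linarith) hK
    linarith
  have b1 := hupper n m 0 hPn (by omega) (by omega) hlog (by norm_num) (hsmall m hmQ hmK)
  have b2 := hupper n (n - m) 0 hPn (by omega) (by omega) hlog (by norm_num) (by
    intro k hk1 hk _
    rw [Nat.cast_sub (by omega)]
    rcases hk1.eq_or_lt with rfl | hk2
    · refine le_trans ?_ (le_abs_self _)
      push_cast
      linarith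
    · have hk2' : (2 : ℝ) ≤ k := by exact_mod_cast hk2
      rw [abs_sub_comm]
      refine le_trans ?_ (le_abs_self _)
      have h2 : 2 * ((n : ℝ) - m) ≤ k * ((n : ℝ) - m) := by gcongr; linarith
      linarith)
  have b3 := hupper n n' k₁ hPn (by omega) (by omega) hlog hk₁ hfreq₁
  have b4 := hupper n m' 0 hPn (by omega) (by omega) hlog (by norm_num)
    (hsmall m' hmQ' (by linarith))
  have b5 := hupper n (n' - m') k₂ hPn (by omega) (by omega) hlog hk₂ (by
    intro k hk1 hk hkk
    rw [Nat.cast_sub (by omega)]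
    exact hfreq₂ k hk1 hk hkk)
  have hlow := hlower n hPn hlog
  have hP0 : (0 : ℝ) < P := by exact_mod_cast (by omega : 0 < P)
  have hW0 : 0 < W := lt_of_lt_of_le (by positivity) hW
  have hexc : (if k₁ = 0 then 0 else W / (4 * Real.pi)) +
      (if k₂ = 0 then 0 else W / (4 * Real.pi)) ≤
      W / (4 * Real.pi) := by
    have : 0 ≤ W / (4 * Real.pi) := by positivity
    rcases hk₁₂ with h | h <;> simp only [h, if_true] <;> split_ifs <;> linarith
  have htail' : b * (P / lam ^ 2) ≤ P / lam := by
    have h1 : lam ^ ((1 : ℝ) / 2) ≤ lam := by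
      simpa using Real.rpow_le_rpow_of_exponent_le hl1 (by norm_num : (1 : ℝ) / 2 ≤ 1)
    calc _ ≤ lam * (P / lam ^ 2) := by
          gcongr
          linarith
      _ = _ := by field_simp
  have hcube : P / lam ^ 3 ≤ P / lam := by
    gcongr
    exact le_self_pow₀ hl1 (by norm_num)
  have hlast : P / lam ≤ P / 10000 := by gcongr
  have hpi := div_four_pi_add_le_div_pi_sq hW0.le
  simp only [if_true] at b1 b2 b4
  linarith

lemma sum_dyadicPrimes_log (P : ℕ) :
    ∑ p ∈ dyadicPrimes P, Real.log p =
      Chebyshev.theta ((2 * P : ℕ) : ℝ) - Chebyshev.theta (P : ℝ) := by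
  rw [Chebyshev.theta, Chebyshev.theta, Nat.floor_natCast, Nat.floor_natCast, dyadicPrimes,
    eq_sub_iff_add_eq, sum_filter, sum_filter, sum_filter, add_comm,
    sum_Ioc_consecutive _ (Nat.zero_le _) (by omega)]

/-- Among three consecutive dyadic blocks, one contains many primes. -/
lemma eventually_exists_dyadicPrimes_log_ge :
    ∀ᶠ Q : ℕ in Filter.atTop, ∃ P : ℕ, Q ≤ P ∧ P ≤ 4 * Q ∧
      (P : ℝ) / 3 ≤ ∑ p ∈ dyadicPrimes P, Real.log p := by
  have h := tendsto_natCast_atTop_atTop (R := ℝ) |>.eventually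
    (eventually_rpow_add_le (by norm_num : (3 : ℝ) / 4 < 1) 12 1 (by norm_num : (0 : ℝ) < 1 / 10))
  have h8 : Filter.Tendsto (fun Q : ℕ => 8 * Q) Filter.atTop Filter.atTop :=
    Filter.tendsto_id.const_mul_atTop' (by norm_num)
  filter_upwards [h8.eventually h, Filter.eventually_ge_atTop 1] with Q hQ hQ1
  have hlow := Chebyshev.theta_ge (8 * Q)
  have hup := Chebyshev.theta_le_log4_mul_x (x := (Q : ℝ)) (by positivity)
  set x : ℝ := ((8 * Q : ℕ) : ℝ) with hx
  have hx8 : x = 8 * Q := by rw [hx]; push_cast; ring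
  have hx1 : 1 ≤ x := by
    rw [hx]
    exact_mod_cast (by omega : 1 ≤ 8 * Q)
  have hx0 : 0 < x := by linarith
  have hlogx : Real.log x ≤ 4 * x ^ ((1 : ℝ) / 4) := by
    have := Real.log_le_rpow_div hx0.le (by norm_num : (0 : ℝ) < 1 / 4)
    linarith
  have hlogx1 : Real.log (x + 1) ≤ 4 * x ^ ((3 : ℝ) / 4) + 1 := by
    have h1 : Real.log (x + 1) ≤ Real.log (2 * x) := Real.log_le_log (by linarith) (by linarith)
    rw [Real.log_mul (by norm_num) hx0.ne'] at h1
    have h2 : x ^ ((1 : ℝ) / 4) ≤ x ^ ((3 : ℝ) / 4) :=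
      Real.rpow_le_rpow_of_exponent_le hx1 (by norm_num)
    linarith [Real.log_two_lt_d9]
  have hsq : 2 * √x * Real.log x ≤ 8 * x ^ ((3 : ℝ) / 4) := by
    calc 2 * √x * Real.log x ≤ 2 * √x * (4 * x ^ ((1 : ℝ) / 4)) := by gcongr
      _ = 8 * (x ^ ((1 : ℝ) / 2) * x ^ ((1 : ℝ) / 4)) := by rw [Real.sqrt_eq_rpow]; ring
      _ = _ := by rw [← Real.rpow_add hx0]; norm_num
  have hlog4 : Real.log 4 = 2 * Real.log 2 := by
    rw [show (4 : ℝ) = 2 ^ 2 by norm_num, Real.log_pow]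
    norm_num
  by_contra! hcon
  have c1 := hcon Q le_rfl (by omega)
  have c2 := hcon (2 * Q) (by omega) (by omega)
  have c3 := hcon (4 * Q) (by omega) le_rfl
  rw [sum_dyadicPrimes_log] at c1 c2 c3
  rw [show 2 * (2 * Q) = 4 * Q by ring] at c2
  rw [show 2 * (4 * Q) = 8 * Q by ring] at c3
  have hQ0 : (1 : ℝ) ≤ Q := by exact_mod_cast hQ1
  have hl2 : Q * 0.69 ≤ Q * Real.log 2 := by
    gcongr
    linarith [Real.log_two_gt_d9]
  rw [← hx] at c3
  rw [hlog4] at hup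
  have hxl : x * Real.log 2 = 8 * (Q * Real.log 2) := by rw [hx8]; ring
  push_cast at c1 c2 c3
  linarith

/-- Increasing the upper index multiplies a binomial coefficient by a controlled factor. -/
lemma choose_add_le_choose_mul_exp {N m : ℕ} (hm : 2 * m ≤ N) (d : ℕ) :
    ((N + d).choose m : ℝ) ≤ N.choose m * Real.exp (2 * m / N * d) := by
  induction d with
  | zero => simp
  | succ d ih =>
    rcases m.eq_zero_or_pos with rfl | hm0
    · simp
    have h1 : ((N + d).choose m : ℝ) * (N + d + 1) = (N + (d + 1)).choose m * (N + d + 1 - m) := by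
      have := Nat.choose_mul_succ_eq (N + d) m
      have h2 : ((N + d + 1 - m : ℕ) : ℝ) = N + d + 1 - m := by
        rw [Nat.cast_sub (by omega)]
        push_cast
        ring
      rw [← h2]
      exact_mod_cast this
    have hmN : 2 * (m : ℝ) ≤ N := by exact_mod_cast hm
    have hm1 : (1 : ℝ) ≤ m := by exact_mod_cast hm0
    have hd : (0 : ℝ) ≤ d := d.cast_nonneg
    have hpos : 0 < (N : ℝ) + d + 1 - m := by linarith
    have h3 : ((N : ℝ) + d + 1) / (N + d + 1 - m) ≤ Real.exp (2 * m / N) := by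
      refine le_trans ?_ (Real.add_one_le_exp _)
      rw [div_le_iff₀ hpos, div_add_one (by linarith), div_mul_eq_mul_div,
        le_div_iff₀ (by linarith)]
      nlinarith
    calc ((N + (d + 1)).choose m : ℝ)
        = (N + d).choose m * (((N : ℝ) + d + 1) / (N + d + 1 - m)) := by
          rw [← mul_div_assoc, h1, mul_div_cancel_right₀ _ hpos.ne']
      _ ≤ N.choose m * Real.exp (2 * m / N * d) * Real.exp (2 * m / N) := by gcongr
      _ = _ := by
          rw [mul_assoc, ← Real.exp_add]
          push_cast
          ring_nf

lemma choose_le_choose_of_le_half {n a b : ℕ} (hab : a ≤ b) (hb : 2 * b ≤ n) :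
    n.choose a ≤ n.choose b := by
  induction b, hab using Nat.le_induction with
  | base => rfl
  | succ b _ ih => exact (ih (by omega)).trans (Nat.choose_le_succ_of_lt_half_left (by omega))

/-- If `C(n, m) = C(n', m')` with `n' ≤ n` and the lower indices are small, then the upper indices
are far apart. -/
lemma half_le_sub_of_choose_eq {n m n' m' : ℕ} {E : ℝ} (hE : 4 ≤ E) (hm' : m' * E ≤ n')
    (hmm' : m < m') (hnn' : n' ≤ n) (h : n.choose m = n'.choose m') :
    E / 2 ≤ (n : ℝ) - n' := by
  obtain ⟨d, rfl⟩ := Nat.exists_eq_add_of_le hnn'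
  have hm'4 : m' * 4 ≤ n' := by
    have : (m' : ℝ) * 4 ≤ n' := le_trans (by gcongr) hm'
    exact_mod_cast this
  have h1 := choose_add_le_choose_mul_exp (N := n') (m := m) (by omega) d
  have h2 : n'.choose (m + 1) ≤ n'.choose m' := choose_le_choose_of_le_half hmm' (by omega)
  rw [h] at h1
  have h3 : (n'.choose (m + 1) : ℝ) * (m + 1) = n'.choose m * (n' - m) := by
    have := Nat.choose_succ_right_eq n' m
    rw [← Nat.cast_sub (by omega)]
    exact_mod_cast this
  have hmm : (m : ℝ) + 1 ≤ m' := by exact_mod_cast hmm'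
  have hm0 : (0 : ℝ) ≤ m := m.cast_nonneg
  have hc0 : (0 : ℝ) < n'.choose m := by exact_mod_cast Nat.choose_pos (by omega)
  have hn'0 : (0 : ℝ) < n' := by exact_mod_cast (by omega : 0 < n')
  have h4 : ((m : ℝ) + 1) * 3 ≤ n' - m := by
    have : (m' : ℝ) * 4 ≤ n' := by exact_mod_cast hm'4
    linarith
  have h5 : (n'.choose m : ℝ) * 3 ≤ n'.choose m * Real.exp (2 * m / n' * d) := by
    refine le_trans ?_ ((Nat.cast_le (α := ℝ).2 h2).trans h1)
    refine le_of_mul_le_mul_right ?_ (by linarith : (0 : ℝ) < m + 1)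
    rw [h3]
    nlinarith
  have h6 : 3 ≤ Real.exp (2 * m / n' * d) := le_of_mul_le_mul_left h5 hc0
  have h7 : 1 ≤ 2 * m / n' * (d : ℝ) := by
    by_contra! hlt
    have := Real.exp_lt_exp.2 hlt
    linarith [Real.exp_one_lt_d9]
  rw [div_mul_eq_mul_div, le_div_iff₀ hn'0] at h7
  push_cast
  rw [add_sub_cancel_left]
  have h8 : m' * E ≤ m' * (2 * d) := by
    have : (m : ℝ) * d ≤ m' * d := by gcongr
    linarith
  linarith [le_of_mul_le_mul_left h8 (by linarith)]

lemma eventually_rpow_add_le_rpow {α β : ℝ} (hαβ : α < β) (hβ : 0 < β) (C D : ℝ) :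
    ∀ᶠ x : ℝ in Filter.atTop, C * x ^ α + D ≤ x ^ β := by
  have h := (tendsto_rpow_atTop hβ).eventually
    (eventually_rpow_add_le ((div_lt_one hβ).2 hαβ) C D one_pos)
  filter_upwards [h, Filter.eventually_ge_atTop 0] with x hx hx0
  rwa [← Real.rpow_mul hx0, mul_div_cancel₀ _ hβ.ne', one_mul] at hx

lemma eventually_exists_dyadic_scale {θ θ₁ δ₀ : ℝ} (hθ0 : 0 < θ) (hθ : θ < θ₁) (hθ₁ : θ₁ ≤ 1)
    (hδ₀ : 1 < θ * (3 / 2 - δ₀)) {p : ℕ → Prop} (hp : ∀ᶠ P in Filter.atTop, p P) :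
    ∀ᶠ n : ℕ in Filter.atTop, ∃ P : ℕ, p P ∧ 1 ≤ Real.log P ∧
      2 * (P : ℝ) ^ 10 ≤ Real.exp (Real.log n ^ θ₁) ∧
      Real.log P ^ 13 ≤ Real.exp (Real.log n ^ θ₁) ∧
      Real.log n + Real.log P ≤ Real.log P ^ (3 / 2 - δ₀) ∧
      (P : ℝ) / 3 ≤ ∑ q ∈ dyadicPrimes P, Real.log q := by
  have hlog := Real.tendsto_log_atTop.comp (tendsto_natCast_atTop_atTop (R := ℝ))
  have hθ1 : 0 < θ₁ := hθ0.trans hθ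
  have hθlog := (tendsto_rpow_atTop hθ0).comp hlog
  obtain ⟨P₀, hP₀⟩ := Filter.eventually_atTop.1 hp
  have hQ := (tendsto_nat_ceil_atTop.comp (Real.tendsto_exp_atTop.comp hθlog)).eventually
    (eventually_exists_dyadicPrimes_log_ge.and (Filter.eventually_ge_atTop P₀))
  have hexp : ∀ᶠ x : ℝ in Filter.atTop, x ^ 13 ≤ Real.exp (x ^ θ₁) := by
    have h := (tendsto_rpow_atTop hθ1).eventually
      ((isLittleO_rpow_exp_pos_mul_atTop (13 / θ₁) one_pos).bound one_pos)
    filter_upwards [h, Filter.eventually_ge_atTop 0] with x hx hx0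
    rw [← Real.rpow_mul hx0, mul_div_cancel₀ _ hθ1.ne', one_mul, one_mul, Real.norm_of_nonneg
      (by positivity), Real.norm_of_nonneg (by positivity)] at hx
    exact_mod_cast hx
  filter_upwards [hQ, hlog.eventually hexp,
    hlog.eventually (eventually_rpow_add_le_rpow hθ hθ1 10 (10 * Real.log 8 + Real.log 2)),
    hlog.eventually (eventually_rpow_add_le_rpow (hθ.trans_le hθ₁) one_pos 1 (Real.log 8)),
    hlog.eventually (eventually_rpow_add_le_rpow hδ₀ (by linarith) 2 0),
    hθlog.eventually_ge_atTop 1, hlog.eventually_ge_atTop 1] with n hQn h13 h10 h8 h2 hge hL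
  simp only [Function.comp_apply] at *
  set L := Real.log n
  obtain ⟨⟨P, hQP, hPQ, hsum⟩, hQP₀⟩ := hQn
  have hPge : Real.exp (L ^ θ) ≤ P := (Nat.le_ceil _).trans (by exact_mod_cast hQP)
  have hP0 : (0 : ℝ) < P := (Real.exp_pos _).trans_le hPge
  have hPle : (P : ℝ) ≤ 8 * Real.exp (L ^ θ) := by
    have h1 : (P : ℝ) ≤ 4 * ⌈Real.exp (L ^ θ)⌉₊ := by exact_mod_cast hPQ
    have h3 := Nat.ceil_lt_add_one (Real.exp_pos (L ^ θ)).le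
    have h4 := Real.one_le_exp (zero_le_one.trans hge)
    linarith
  have hlamge : L ^ θ ≤ Real.log P := (Real.le_log_iff_exp_le hP0).2 hPge
  have hlamle : Real.log P ≤ Real.log 8 + L ^ θ := by
    have := Real.log_le_log hP0 hPle
    rwa [Real.log_mul (by norm_num) (Real.exp_ne_zero _), Real.log_exp] at this
  have hlam0 : 0 ≤ Real.log P := by linarith
  rw [Real.rpow_one, one_mul] at h8
  have hlamL : Real.log P ≤ L := by linarith
  refine ⟨P, hP₀ P (hQP₀.trans hQP), hge.trans hlamge, ?_,
    (pow_le_pow_left₀ hlam0 hlamL 13).trans h13, ?_, hsum⟩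
  · rw [← Real.log_le_iff_le_exp (by positivity), Real.log_mul (by norm_num) (by positivity),
      Real.log_pow]
    push_cast
    linarith
  · have h3 : (L ^ θ) ^ (3 / 2 - δ₀) ≤ Real.log P ^ (3 / 2 - δ₀) := by
      refine Real.rpow_le_rpow (by linarith) hlamge ?_
      by_contra! hneg
      nlinarith
    rw [← Real.rpow_mul (by linarith)] at h3
    rw [Real.rpow_one] at h2
    linarith

lemma exists_exponents {s ε' : ℝ} (hs : 2 / 3 < s) (hε' : 2 / 3 < s * (1 - ε')) (hε'0 : 0 < ε')
    (hs1 : s < 1) : ∃ θ δ₀ : ℝ, 0 < θ ∧ θ < s * (1 - ε') ∧ 0 < δ₀ ∧ δ₀ ≤ 1 / 2 ∧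
      1 < θ * (3 / 2 - δ₀) := by
  obtain ⟨θ, h1, h2⟩ := exists_between hε'
  have hθ0 : 0 < θ := by linarith
  have hθ1 : θ < 1 := by nlinarith
  refine ⟨θ, (3 / 2 - 1 / θ) / 2, hθ0, h2, ?_, ?_, ?_⟩
  · have : 1 / θ < 3 / 2 := by
      rw [div_lt_iff₀ hθ0]
      linarith
    linarith
  · have : 1 ≤ 1 / θ := by
      rw [le_div_iff₀ hθ0]
      linarith
    linarith
  · have : θ * (3 / 2 - (3 / 2 - 1 / θ) / 2) = 3 / 4 * θ + 1 / 2 := by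
      field_simp
      ring
    linarith

/-- Two distinct interior solutions of `C(n, m) = C(n', m')` cannot both be large. -/
lemma eventually_choose_ne_of_interior {s ε' : ℝ} (hs : 2 / 3 < s) (hs1 : s < 1) (hε'0 : 0 < ε')
    (hε'1 : ε' < 1) (hε' : 2 / 3 < s * (1 - ε')) :
    ∀ᶠ n : ℕ in Filter.atTop, ∀ m n' m' : ℕ, n' ≤ n → 1 ≤ m' → m' < n' → (n' < n ∨ m < m') →
      Real.exp (Real.log n ^ s) ≤ m → (m : ℝ) ≤ n / Real.exp (Real.log n ^ (1 - ε')) →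
      (m' : ℝ) ≤ n' / Real.exp (Real.log n' ^ (1 - ε')) → n.choose m ≠ n'.choose m' := by
  obtain ⟨θ, δ₀, hθ0, hθ, hδ₀, hδ₀', h⟩ := exists_exponents hs hε' hε'0 hs1
  set θ₁ := s * (1 - ε') with hθ₁
  have hθ₁1 : θ₁ ≤ 1 := by nlinarith
  have hlog := Real.tendsto_log_atTop.comp (tendsto_natCast_atTop_atTop (R := ℝ))
  filter_upwards [eventually_exists_dyadic_scale hθ0 hθ hθ₁1 h
      (eventually_choose_ne_choose hδ₀ hδ₀'),
    hlog.eventually_ge_atTop 1,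
    ((tendsto_rpow_atTop (by linarith : 0 < θ₁)).comp hlog).eventually_ge_atTop (Real.log 4)]
    with n ⟨P, hP, hlam, h10, h13, hsc, hW⟩ hL h4 m n' m' hnn' hm'1 hm'n' hor hm hmn hmn' heq
  simp only [Function.comp_apply] at hL h4
  set L := Real.log n
  set E := Real.exp (L ^ θ₁)
  have hE4 : 4 ≤ E := (Real.log_le_iff_le_exp (by norm_num)).1 h4
  have hEs : E ≤ m := le_trans (Real.exp_le_exp.2
    (Real.rpow_le_rpow_of_exponent_le hL (by nlinarith))) hm
  have hEn : m * E ≤ n := by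
    rw [le_div_iff₀ (Real.exp_pos _)] at hmn
    refine le_trans ?_ hmn
    gcongr
    exact Real.exp_le_exp.2 (Real.rpow_le_rpow_of_exponent_le hL (by nlinarith))
  have hm2 : 2 * m ≤ n := by
    have : (m : ℝ) * 4 ≤ n := le_trans (by gcongr) hEn
    have : m * 4 ≤ n := by exact_mod_cast this
    omega
  have hmm' : m < m' := by
    refine hor.elim (fun hlt => ?_) id
    by_contra! hle
    have h1 := choose_le_choose_of_le_half hle hm2
    have h2 : n'.choose m' < n.choose m' := by
      obtain ⟨k, rfl⟩ := Nat.exists_eq_add_of_lt hlt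
      obtain ⟨j, rfl⟩ := Nat.exists_eq_add_of_le' hm'1
      have hpos : 0 < n'.choose j := Nat.choose_pos (by omega)
      calc n'.choose (j + 1) < (n' + 1).choose (j + 1) := by
            rw [Nat.choose_succ_succ']
            omega
        _ ≤ _ := Nat.choose_le_choose _ (by omega)
    omega
  have hEn' : m' * E ≤ n' := by
    rw [le_div_iff₀ (Real.exp_pos _)] at hmn'
    refine le_trans ?_ hmn'
    gcongr
    have hL' : L ^ s ≤ Real.log n' := by
      rw [Real.le_log_iff_exp_le (by exact_mod_cast (by omega : 0 < n'))]
      exact hm.trans (by exact_mod_cast (by omega : m ≤ n'))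
    refine Real.exp_le_exp.2 ?_
    rw [hθ₁, Real.rpow_mul (by linarith)]
    exact Real.rpow_le_rpow (by positivity) hL' (by linarith)
  have hd := half_le_sub_of_choose_eq hE4 hEn' hmm' hnn' heq
  have hmP : P ^ 10 ≤ m := by
    have : (P : ℝ) ^ 10 ≤ m := by
      have : (0 : ℝ) ≤ (P : ℝ) ^ 10 := by positivity
      linarith
    exact_mod_cast this
  have hdP : n' + P ^ 10 ≤ n := by
    have : (n' : ℝ) + (P : ℝ) ^ 10 ≤ n := by linarith
    exact_mod_cast this
  exact hP n m n' m' hmP (by omega) hdP (le_trans (by gcongr) hEn) (le_trans (by gcongr) hEn')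
    hsc hW heq

end

/-- For every `0 < ε < 1` and `0 < ε' < ε/(2/3+ε)` there is `t₀` such that for all
integers `t ≥ t₀` there is at most one pair `(n, m)` with `1 ≤ m < n`,
`exp((log n)^(2/3+ε)) ≤ m ≤ n / exp((log n)^(1-ε'))` and `C(n,m) = t`. -/
theorem stmt_2 (ε ε' : ℝ) (hε0 : 0 < ε) (hε1 : ε < 1)
    (hε'0 : 0 < ε') (hε'1 : ε' < ε / (2 / 3 + ε)) :
    ∃ t₀ : ℕ, ∀ t : ℕ, t₀ ≤ t →
      {p : ℕ × ℕ | 1 ≤ p.2 ∧ p.2 < p.1 ∧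
        Real.exp ((Real.log p.1) ^ ((2 : ℝ) / 3 + ε)) ≤ (p.2 : ℝ) ∧
        (p.2 : ℝ) ≤ (p.1 : ℝ) / Real.exp ((Real.log p.1) ^ ((1 : ℝ) - ε')) ∧
        Nat.choose p.1 p.2 = t}.encard ≤ 1 := by
  have hs0 : 0 < 2 / 3 + ε := by linarith
  rw [lt_div_iff₀ hs0] at hε'1
  have hlarge : ∀ N t n m : ℕ, 2 ^ N < t → n.choose m = t → N ≤ n := by
    intro N t n m ht h
    by_contra! hn
    have := Nat.choose_le_two_pow n m
    have := Nat.pow_le_pow_right (by norm_num : 0 < 2) hn.le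
    omega
  rcases lt_or_ge (2 / 3 + ε) 1 with hs1 | hs1
  · obtain ⟨N, hN⟩ := Filter.eventually_atTop.1 (eventually_choose_ne_of_interior
      (s := 2 / 3 + ε) (ε' := ε') (by linarith) hs1 hε'0 (by nlinarith) (by nlinarith))
    refine ⟨2 ^ N + 1, fun t ht => Set.encard_le_one_iff.2 ?_⟩
    have key : ∀ n m n' m' : ℕ, n' ≤ n → (n' < n ∨ m < m') → 1 ≤ m' → m' < n' →
        Real.exp (Real.log n ^ (2 / 3 + ε)) ≤ m → (m : ℝ) ≤ n / Real.exp (Real.log n ^ (1 - ε')) →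
        (m' : ℝ) ≤ n' / Real.exp (Real.log n' ^ (1 - ε')) → n.choose m = t → n'.choose m' = t →
        False := fun n m n' m' hn hor h1 h2 h3 h4 h5 h6 h7 =>
      hN n (hlarge N t n m (by omega) h6) m n' m' hn h1 h2 hor h3 h4 h5 (h6.trans h7.symm)
    rintro ⟨n, m⟩ ⟨n', m'⟩ ⟨a1, a2, a3, a4, a5⟩ ⟨b1, b2, b3, b4, b5⟩
    simp only at a1 a2 a3 a4 a5 b1 b2 b3 b4 b5
    by_contra hne
    have hne' : n = n' → m ≠ m' := fun h h' => hne (by rw [h, h'])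
    have hcases : (n' ≤ n ∧ (n' < n ∨ m < m')) ∨ (n ≤ n' ∧ (n < n' ∨ m' < m)) := by omega
    rcases hcases with ⟨h1, h2⟩ | ⟨h1, h2⟩
    · exact key n m n' m' h1 h2 b1 b2 a3 a4 b4 a5 b5
    · exact key n' m' n m h1 h2 a1 a2 b3 b4 a4 b5 a5
  · refine ⟨2 ^ 3 + 1, fun t ht => Set.encard_le_one_iff.2 ?_⟩
    rintro ⟨n, m⟩ - ⟨-, a2, a3, -, a5⟩
    exfalso
    simp only at a2 a3 a5
    have hn : 3 ≤ n := hlarge 3 t n m (by omega) a5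
    have hn3 : (3 : ℝ) ≤ n := by exact_mod_cast hn
    have hlog : 1 ≤ Real.log n := by
      rw [Real.le_log_iff_exp_le (by linarith)]
      linarith [Real.exp_one_lt_d9]
    have h1 : Real.log n ≤ Real.log n ^ (2 / 3 + ε) := Real.self_le_rpow_of_one_le hlog hs1
    have h2 := Real.exp_le_exp.2 h1
    rw [Real.exp_log (by linarith)] at h2
    have h3 : (m : ℝ) < n := by exact_mod_cast a2
    linarith
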